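/- arXiv:1406.3078 — 4 statements merged into one kernel-verified Lean document; each statement's English description precedes it below -/
import Mathlib

section
/- Let (G,<) be an ordered group and let x, y ∈ G be distinct elements with 1 < x and 1 < y such that the submonoid of G generated by {x, y} is the free monoid on {x, y}. Then for any field k, in the group algebra k[G] the elements x + x⁻¹ and y + y⁻¹ generate a free k-algebra on {x + x⁻¹, y + y⁻¹}. -/
/-- An algebra map out of a monoid algebra is injective if the images of the monoid elements
have pairwise distinct leading terms. -/
theorem MonoidAlgebra.lift_injective_of_leading {k M G : Type*} [Field k] [Monoid M] [Group G]
    [LinearOrder G] (φ : M →* MonoidAlgebra k G) (e : M → G) (he : Function.Injective e)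
    (hlead : ∀ m, (φ m).coeff (e m) ≠ 0) (hlt : ∀ m g, e m < g → (φ m).coeff g = 0) :
    Function.Injective (MonoidAlgebra.lift k (MonoidAlgebra k G) M φ) := by
  rw [injective_iff_map_eq_zero]
  intro p hp
  by_contra hne
  have hs : p.coeff.support.Nonempty := by
    rw [Finsupp.support_nonempty_iff]
    simpa using hne
  obtain ⟨m, hm, hmax⟩ := Finset.exists_max_image p.coeff.support e hs
  have h0 : (MonoidAlgebra.lift k (MonoidAlgebra k G) M φ p).coeff (e m) = 0 := by simp [hp]
  rw [MonoidAlgebra.lift_apply, Finsupp.sum, MonoidAlgebra.coeff_sum, Finsupp.finsetSum_apply,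
    Finset.sum_eq_single_of_mem m hm] at h0
  · rw [MonoidAlgebra.coeff_smul, Finsupp.smul_apply, smul_eq_mul] at h0
    exact mul_ne_zero (Finsupp.mem_support_iff.1 hm) (hlead m) h0
  · intro n hn hnm
    simp [hlt n (e m) (lt_of_le_of_ne (hmax n hn) (he.ne hnm))]

/-- A word in the elements `a i + (a i)⁻¹`, where every `a i` is greater than `1`, has as its
leading term the corresponding word in the `a i`, with coefficient `1`. -/
theorem MonoidAlgebra.leading_lift_of_add_of_inv {k ι G : Type*} [Field k] [Group G]
    [LinearOrder G] [MulLeftStrictMono G] [MulRightStrictMono G] (a : ι → G) (ha : ∀ i, 1 < a i)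
    (w : FreeMonoid ι) :
    (FreeMonoid.lift (fun i ↦ of k G (a i) + of k G (a i)⁻¹) w).coeff (FreeMonoid.lift a w) = 1 ∧
      ∀ g, FreeMonoid.lift a w < g →
        (FreeMonoid.lift (fun i ↦ of k G (a i) + of k G (a i)⁻¹) w).coeff g = 0 := by
  induction w using FreeMonoid.inductionOn' with
  | one =>
    refine ⟨by simp [MonoidAlgebra.one_def], fun g hg ↦ ?_⟩
    rw [map_one] at hg
    simp [MonoidAlgebra.one_def, Finsupp.single_eq_of_ne hg.ne']
  | of_mul i w ih =>
    obtain ⟨ih1, ih0⟩ := ih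
    have key : ∀ g, FreeMonoid.lift a w < g → FreeMonoid.lift a w < a i * (a i * g) := fun g hg ↦
      hg.trans ((lt_mul_of_one_lt_left' g (ha i)).trans (lt_mul_of_one_lt_left' _ (ha i)))
    have hstep : ∀ g, (FreeMonoid.lift (fun i ↦ of k G (a i) + of k G (a i)⁻¹)
        (FreeMonoid.of i * w)).coeff g =
        (FreeMonoid.lift (fun i ↦ of k G (a i) + of k G (a i)⁻¹) w).coeff ((a i)⁻¹ * g) +
        (FreeMonoid.lift (fun i ↦ of k G (a i) + of k G (a i)⁻¹) w).coeff (a i * g) := by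
      intro g
      simp [add_mul]
    constructor
    · rw [hstep, map_mul (FreeMonoid.lift a), FreeMonoid.lift_eval_of, inv_mul_cancel_left, ih1, ih0, add_zero]
      exact (lt_mul_of_one_lt_left' _ (ha i)).trans (lt_mul_of_one_lt_left' _ (ha i))
    · intro g hg
      rw [map_mul, FreeMonoid.lift_eval_of, ← lt_inv_mul_iff_mul_lt] at hg
      rw [hstep, ih0 _ hg, ih0 _ (by simpa using key _ hg), add_zero]

/-- In the group algebra of an ordered group, if `x, y` are distinct positive
elements generating a free submonoid, then `x + x⁻¹` and `y + y⁻¹` generate a free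
`k`-algebra. -/
theorem free_algebra_in_group_algebra_of_ordered_group
    (G : Type*) [Group G] [LinearOrder G]
    [CovariantClass G G (· * ·) (· < ·)]
    [CovariantClass G G (Function.swap (· * ·)) (· < ·)]
    (x y : G) (hxy : x ≠ y) (hx : 1 < x) (hy : 1 < y)
    (hfree : Function.Injective ⇑(FreeMonoid.lift (![x, y] : Fin 2 → G)))
    (k : Type*) [Field k] :
    Function.Injective ⇑(FreeAlgebra.lift k
      ![MonoidAlgebra.of k G x + MonoidAlgebra.of k G x⁻¹,
        MonoidAlgebra.of k G y + MonoidAlgebra.of k G y⁻¹]) := by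
  have ha : ∀ i, 1 < ![x, y] i := by simp [Fin.forall_fin_two, hx, hy]
  have hvec : ![MonoidAlgebra.of k G x + MonoidAlgebra.of k G x⁻¹,
      MonoidAlgebra.of k G y + MonoidAlgebra.of k G y⁻¹] =
      fun i ↦ MonoidAlgebra.of k G (![x, y] i) + MonoidAlgebra.of k G (![x, y] i)⁻¹ := by
    ext i : 1
    fin_cases i <;> rfl
  rw [hvec]
  have hlead := MonoidAlgebra.leading_lift_of_add_of_inv (k := k) ![x, y] ha
  have hinj := MonoidAlgebra.lift_injective_of_leading _ _ hfree
    (fun w ↦ by rw [(hlead w).1]; exact one_ne_zero) (fun w ↦ (hlead w).2)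
  have hcomp : FreeAlgebra.lift k
      (fun i ↦ MonoidAlgebra.of k G (![x, y] i) + MonoidAlgebra.of k G (![x, y] i)⁻¹) =
      (MonoidAlgebra.lift k (MonoidAlgebra k G) (FreeMonoid (Fin 2)) (FreeMonoid.lift fun i ↦
        MonoidAlgebra.of k G (![x, y] i) + MonoidAlgebra.of k G (![x, y] i)⁻¹)).comp
        (FreeAlgebra.equivMonoidAlgebraFreeMonoid : _ ≃ₐ[k] _).toAlgHom := by
    ext i : 2
    simp [FreeAlgebra.equivMonoidAlgebraFreeMonoid]
  rw [hcomp]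
  exact hinj.comp FreeAlgebra.equivMonoidAlgebraFreeMonoid.injective
end

section
/- Let G be the free group on a two-element set {x, y} and let k be a field. Then in the group algebra k[G] the elements x + x⁻¹ and y + y⁻¹ generate a free k-algebra on {x + x⁻¹, y + y⁻¹}. -/
namespace FreeGroup

variable {α : Type*}

theorem of_mul_mk_map_true (a : α) (w : List α) :
    of a * mk (w.map fun b => (b, true)) = mk ((a :: w).map fun b => (b, true)) := by
  rw [of, mul_mk, List.map_cons, List.singleton_append]

theorem isReduced_map_true (w : List α) : IsReduced (w.map fun a => (a, true)) := by
  rw [IsReduced, List.isChain_map]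
  induction w with
  | nil => simp
  | cons a w ih => cases w <;> simp_all

variable [DecidableEq α]

theorem IsReduced.norm_mk {L : List (α × Bool)} (h : IsReduced L) :
    (mk L).norm = L.length := by
  rw [norm, toWord_mk, h.reduce_eq]

theorem norm_mk_map_true (w : List α) : (mk (w.map fun a => (a, true))).norm = w.length := by
  simpa using (isReduced_map_true w).norm_mk

theorem norm_inv_of_mul_mk_map_true {a b : α} (hab : a ≠ b) (w : List α) :
    ((of a)⁻¹ * mk ((b :: w).map fun c => (c, true))).norm = w.length + 2 := by
  have h : IsReduced ((a, false) :: (b :: w).map fun c => (c, true)) := by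
    rw [List.map_cons, isReduced_cons_cons, ← List.map_cons (f := fun c => (c, true))]
    exact ⟨fun h => absurd h hab, isReduced_map_true (b :: w)⟩
  rw [of, inv_mk, mul_mk]
  simpa [invRev] using h.norm_mk

end FreeGroup

namespace MonoidAlgebra

open FreeGroup

/-- The image in `k[FreeGroup α]` of the monomial `w` under `a ↦ a + a⁻¹`. -/
noncomputable def symmWord (k : Type*) {α : Type*} [CommRing k] (w : List α) :
    MonoidAlgebra k (FreeGroup α) :=
  (w.map fun a => of k (FreeGroup α) (FreeGroup.of a) +
    of k (FreeGroup α) (FreeGroup.of a)⁻¹).prod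

variable {k α : Type*} [CommRing k]

theorem coeff_symmWord_cons (a : α) (v : List α) (g : FreeGroup α) :
    (symmWord k (a :: v)).coeff g =
      (symmWord k v).coeff ((FreeGroup.of a)⁻¹ * g) +
        (symmWord k v).coeff (FreeGroup.of a * g) := by
  rw [symmWord, List.map_cons, List.prod_cons, ← symmWord, add_mul, coeff_add, Finsupp.add_apply,
    of_apply, of_apply, coeff_single_mul_apply, coeff_single_mul_apply]
  simp

variable [DecidableEq α]

theorem coeff_symmWord_of_length_lt_norm (v : List α) {g : FreeGroup α} (h : v.length < g.norm) :
    (symmWord k v).coeff g = 0 := by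
  induction v generalizing g with
  | nil =>
    have hg : 1 ≠ g := by rintro rfl; simp at h
    simp [symmWord, one_def, hg]
  | cons a v ih =>
    have h₁ := norm_mul_le (FreeGroup.of a) ((FreeGroup.of a)⁻¹ * g)
    have h₂ := norm_mul_le (FreeGroup.of a)⁻¹ (FreeGroup.of a * g)
    rw [mul_inv_cancel_left, norm_of] at h₁
    rw [inv_mul_cancel_left, norm_inv_eq, norm_of] at h₂
    rw [List.length_cons] at h
    rw [coeff_symmWord_cons, ih (by omega), ih (by omega), add_zero]

theorem coeff_symmWord_mk_map_true {v w : List α} (h : v.length ≤ w.length) :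
    (symmWord k v).coeff (FreeGroup.mk (w.map fun a => (a, true))) = if v = w then 1 else 0 := by
  induction v generalizing w with
  | nil =>
    cases w with
    | nil => simp [symmWord, one_def, ← FreeGroup.one_eq_mk]
    | cons b w =>
      rw [coeff_symmWord_of_length_lt_norm _ (by rw [norm_mk_map_true]; simp)]
      simp
  | cons a v ih =>
    cases w with
    | nil => simp at h
    | cons b w =>
      simp only [List.length_cons, add_le_add_iff_right] at h
      rw [coeff_symmWord_cons, of_mul_mk_map_true,
        coeff_symmWord_of_length_lt_norm v (g := FreeGroup.mk _)
          (by rw [norm_mk_map_true]; simp; omega), add_zero]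
      by_cases hab : a = b
      · subst hab
        rw [← of_mul_mk_map_true, inv_mul_cancel_left, ih h]
        simp
      · rw [coeff_symmWord_of_length_lt_norm v (by rw [norm_inv_of_mul_mk_map_true hab]; omega)]
        simp [hab]

end MonoidAlgebra

theorem FreeAlgebra.lift_of_add_of_inv_injective (k α : Type*) [CommRing k] :
    Function.Injective (FreeAlgebra.lift k fun a : α =>
      MonoidAlgebra.of k (FreeGroup α) (FreeGroup.of a) +
        MonoidAlgebra.of k (FreeGroup α) (FreeGroup.of a)⁻¹) := by
  classical
  set F : α → MonoidAlgebra k (FreeGroup α) := fun a =>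
    MonoidAlgebra.of k (FreeGroup α) (FreeGroup.of a) +
      MonoidAlgebra.of k (FreeGroup α) (FreeGroup.of a)⁻¹
  have hcomp : FreeAlgebra.lift k F =
      (MonoidAlgebra.lift k _ _ (FreeMonoid.lift F)).comp
        (equivMonoidAlgebraFreeMonoid (R := k) (X := α)).toAlgHom := by
    ext a : 2
    simp [equivMonoidAlgebraFreeMonoid]
  suffices h : Function.Injective (MonoidAlgebra.lift k _ _ (FreeMonoid.lift F)) by
    rw [hcomp]
    exact h.comp equivMonoidAlgebraFreeMonoid.injective
  rw [injective_iff_map_eq_zero]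
  intro f hf
  by_contra hne
  have hsupp : f.coeff.support.Nonempty := by
    rw [Finsupp.support_nonempty_iff]
    exact fun h => hne (MonoidAlgebra.coeffEquiv.injective h)
  obtain ⟨w, hw, hmax⟩ := f.coeff.support.exists_max_image FreeMonoid.length hsupp
  refine Finsupp.mem_support_iff.1 hw ?_
  have hcoeff := congrArg
    (fun p => p.coeff (FreeGroup.mk ((FreeMonoid.toList w).map fun a => (a, true)))) hf
  simp only [MonoidAlgebra.lift_apply, Finsupp.sum, MonoidAlgebra.coeff_sum,
    Finsupp.finsetSum_apply, MonoidAlgebra.coeff_smul, Finsupp.smul_apply,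
    MonoidAlgebra.coeff_zero, Finsupp.zero_apply] at hcoeff
  rw [Finset.sum_eq_single_of_mem w hw] at hcoeff
  · rw [FreeMonoid.lift_apply, ← MonoidAlgebra.symmWord,
      MonoidAlgebra.coeff_symmWord_mk_map_true le_rfl] at hcoeff
    simpa using hcoeff
  · intro v hv hvw
    rw [FreeMonoid.lift_apply, ← MonoidAlgebra.symmWord,
      MonoidAlgebra.coeff_symmWord_mk_map_true (hmax v hv),
      if_neg (FreeMonoid.toList.injective.ne hvw), smul_zero]

/-- In the group algebra of the free group on `{x, y}`, the elements
`x + x⁻¹` and `y + y⁻¹` generate a free `k`-algebra. -/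
theorem free_algebra_in_group_algebra_of_free_group
    (k : Type*) [Field k] :
    Function.Injective ⇑(FreeAlgebra.lift k
      ![MonoidAlgebra.of k (FreeGroup (Fin 2)) (FreeGroup.of 0) +
          MonoidAlgebra.of k (FreeGroup (Fin 2)) (FreeGroup.of 0)⁻¹,
        MonoidAlgebra.of k (FreeGroup (Fin 2)) (FreeGroup.of 1) +
          MonoidAlgebra.of k (FreeGroup (Fin 2)) (FreeGroup.of 1)⁻¹]) := by
  convert FreeAlgebra.lift_of_add_of_inv_injective k (Fin 2) using 3
  ext1 a
  fin_cases a <;> rfl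
end

section
/- Let k be a field of characteristic zero, A₁ the first Weyl algebra over k with generators X, Y satisfying YX − XY = 1, and D₁ its Ore division ring of fractions. The elements YX − 5/6, YX − 1/6, 1 + Y² and 1 − Y² of A₁ are nonzero, hence invertible in D₁; set s = (YX − 5/6)(YX − 1/6)⁻¹ and u = (1 − Y²)(1 + Y²)⁻¹. Then s is invertible in D₁ and the elements s + s⁻¹ and u(s + s⁻¹)u⁻¹ generate a free k-algebra on {s + s⁻¹, u(s + s⁻¹)u⁻¹}. -/
/-- The defining relation of the first Weyl algebra: `YX = XY + 1`, where
`X` is the 0th and `Y` the 1st generator of the free algebra on two generators. -/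
inductive WeylRel (k : Type*) [CommRing k] :
    FreeAlgebra k (Fin 2) → FreeAlgebra k (Fin 2) → Prop
  | rel : WeylRel k (FreeAlgebra.ι k 1 * FreeAlgebra.ι k 0)
      (FreeAlgebra.ι k 0 * FreeAlgebra.ι k 1 + 1)

/-- The first Weyl algebra `A₁ = k⟨X,Y⟩/(YX − XY − 1)`. -/
abbrev WeylAlgebra (k : Type*) [CommRing k] := RingQuot (WeylRel k)

/-- The generator `X` of the first Weyl algebra. -/
noncomputable def WeylAlgebra.X (k : Type*) [CommRing k] : WeylAlgebra k :=
  RingQuot.mkAlgHom k (WeylRel k) (FreeAlgebra.ι k 0)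

/-- The generator `Y` of the first Weyl algebra. -/
noncomputable def WeylAlgebra.Y (k : Type*) [CommRing k] : WeylAlgebra k :=
  RingQuot.mkAlgHom k (WeylRel k) (FreeAlgebra.ι k 1)

/-- The word `p β * G g₁ * v * G g₂ * v * ⋯ * v` with `v = p false - p true`. -/
noncomputable def iteratedWord {F D : Type*} [Field F] [Ring D] [Module F D]
    (p : Bool → D) (G : Fin 3 → F) : Bool → List (Fin 3) → D
  | β, [] => p β
  | β, g :: l =>
      p β * (G g • (iteratedWord p G false l - iteratedWord p G true l))

section Independence

variable {F D : Type*} [Field F] [Ring D] [Module F D] [IsScalarTower F D D]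

theorem mul_iteratedWord_cons (t : D) (p : Bool → D) (G : Fin 3 → F) (a : Bool → F)
    (hp : ∀ β, t * p β = 1 + a β • p β) (β : Bool) (g : Fin 3) (l : List (Fin 3)) :
    t * iteratedWord p G β (g :: l) = G g • iteratedWord p G false l
      - G g • iteratedWord p G true l + a β • iteratedWord p G β (g :: l) := by
  rw [iteratedWord, ← mul_assoc, hp, add_mul, one_mul, smul_mul_assoc, smul_sub]

/-- Left multiplication by `t - a α` on the span of the words, in coordinates. -/
theorem exists_coeff_mul_linearCombination (t : D) (δ : F →+ F)
    (ht : ∀ c d, t * (c • d) = c • (t * d) + δ c • d)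
    (p : Bool → D) (G : Fin 3 → F) (a : Bool → F)
    (hp : ∀ β, t * p β = 1 + a β • p β)
    (A : Submodule F D) (hA : 1 ∈ A) (α : Bool) (c : Bool × List (Fin 3) →₀ F) :
    ∃ d : Bool × List (Fin 3) →₀ F,
      (t * Finsupp.linearCombination F (fun w => iteratedWord p G w.1 w.2) c
        - a α • Finsupp.linearCombination F (fun w => iteratedWord p G w.1 w.2) c
        - Finsupp.linearCombination F (fun w => iteratedWord p G w.1 w.2) d ∈ A) ∧
      ∀ β l, d (β, l) = δ (c (β, l)) + (a β - a α) * c (β, l) +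
        (bif β then -1 else 1) * ∑ g, (c (false, g :: l) + c (true, g :: l)) * G g := by
  classical
  induction c using Finsupp.induction_linear with
  | zero => exact ⟨0, by simp, by simp⟩
  | add c₁ c₂ h₁ h₂ =>
    obtain ⟨d₁, hA₁, hd₁⟩ := h₁
    obtain ⟨d₂, hA₂, hd₂⟩ := h₂
    refine ⟨d₁ + d₂, ?_, fun β l => ?_⟩
    · convert A.add_mem hA₁ hA₂ using 1
      simp only [map_add, mul_add, smul_add]
      abel
    · simp only [Finsupp.add_apply, hd₁, hd₂, map_add, Fin.sum_univ_three]
      ring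
  | single w x =>
    obtain ⟨β, l⟩ := w
    cases l with
    | nil =>
      refine ⟨Finsupp.single (β, []) (δ x + (a β - a α) * x), ?_, fun β' l' => ?_⟩
      · simp only [Finsupp.linearCombination_single, iteratedWord, ht, hp]
        convert A.smul_mem x hA using 1
        module
      · by_cases h : (β, ([] : List (Fin 3))) = (β', l')
        · obtain ⟨rfl, rfl⟩ := Prod.mk.inj h
          simp
        · simp [Finsupp.single_eq_of_ne' h]
    | cons g l =>
      refine ⟨Finsupp.single (β, g :: l) (δ x + (a β - a α) * x)
        + Finsupp.single (false, l) (x * G g) - Finsupp.single (true, l) (x * G g),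
        ?_, fun β' l' => ?_⟩
      · convert A.zero_mem using 1
        simp only [Finsupp.linearCombination_single, map_add, map_sub, ht,
          mul_iteratedWord_cons t p G a hp]
        module
      · have key : ∀ β'', ∑ g', Finsupp.single (β, g :: l) x (β'', g' :: l') * G g' =
            if β = β'' ∧ l = l' then x * G g else 0 := by
          intro β''
          rw [Finset.sum_eq_single g]
          · by_cases h : β = β'' ∧ l = l' <;> simp [h]
          · intro g' _ hg
            simp [hg.symm]
          · simp
        simp only [add_mul, Finset.sum_add_distrib, key]
        have h1 : Finsupp.single (β, g :: l) (δ x + (a β - a α) * x) (β', l') =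
            δ (Finsupp.single (β, g :: l) x (β', l'))
              + (a β' - a α) * Finsupp.single (β, g :: l) x (β', l') := by
          by_cases h : (β, g :: l) = (β', l')
          · obtain ⟨rfl, rfl⟩ := Prod.mk.inj h
            simp
          · simp [Finsupp.single_eq_of_ne' h]
        rw [Finsupp.sub_apply, Finsupp.add_apply, h1]
        by_cases hl : l = l' <;> cases β <;> cases β' <;> simp [hl, Finsupp.single_apply]

theorem iteratedWord_independent {k : Type*} [Field k] [Algebra k F] (t : D) (δ : F →+ F)
    (ht : ∀ c d, t * (c • d) = c • (t * d) + δ c • d) (hδ1 : δ 1 = 0)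
    (p : Bool → D) (G : Fin 3 → F) (a : Bool → F)
    (hp : ∀ β, t * p β = 1 + a β • p β)
    (A : Submodule F D) (hA : 1 ∈ A) (hAt : ∀ d ∈ A, t * d ∈ A) (hAp : ∀ β, p β ∉ A)
    (h1 : ∀ c, δ c = 0 → c ∈ (algebraMap k F).range)
    (h2 : ∀ c β β', β ≠ β' → δ c = (a β - a β') * c → c = 0)
    (h3 : ∀ (r : Fin 3 → k) (c : F), ∑ g, algebraMap k F (r g) * G g = δ c → r = 0) :
    ∀ c : Bool × List (Fin 3) →₀ F,
      Finsupp.linearCombination F (fun w => iteratedWord p G w.1 w.2) c ∈ A → c = 0 := by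
  classical
  have hshrink : ∀ α (c : Bool × List (Fin 3) →₀ F),
      Finsupp.linearCombination F (fun w => iteratedWord p G w.1 w.2) c ∈ A →
      ∀ d : Bool × List (Fin 3) →₀ F,
      (t * Finsupp.linearCombination F (fun w => iteratedWord p G w.1 w.2) c
        - a α • Finsupp.linearCombination F (fun w => iteratedWord p G w.1 w.2) c
        - Finsupp.linearCombination F (fun w => iteratedWord p G w.1 w.2) d ∈ A) →
      Finsupp.linearCombination F (fun w => iteratedWord p G w.1 w.2) d ∈ A := by
    intro α c hc d hd
    simpa using A.sub_mem (A.sub_mem (hAt _ hc) (A.smul_mem (a α) hc)) hd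
  suffices H : ∀ n : ℕ, ∀ c : Bool × List (Fin 3) →₀ F, (∀ w, n ≤ w.2.length → c w = 0) →
      Finsupp.linearCombination F (fun w => iteratedWord p G w.1 w.2) c ∈ A → c = 0 by
    intro c
    refine H (c.support.sup (fun w => w.2.length) + 1) c fun w hw => ?_
    by_contra h
    have := Finset.le_sup (f := fun w : Bool × List (Fin 3) => w.2.length)
      (Finsupp.mem_support_iff.mpr h)
    omega
  intro n
  induction n with
  | zero => exact fun c hc _ => Finsupp.ext fun w => hc w (Nat.zero_le _)
  | succ n ihn =>
    suffices H : ∀ m : ℕ, ∀ c : Bool × List (Fin 3) →₀ F, (∀ w, n + 1 ≤ w.2.length → c w = 0) →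
        (c.support.filter fun w => w.2.length = n).card = m →
        Finsupp.linearCombination F (fun w => iteratedWord p G w.1 w.2) c ∈ A → c = 0 from
      fun c hc => H _ c hc rfl
    intro m
    induction m using Nat.strong_induction_on with
    | _ m ihm =>
    intro c hc hm hcA
    by_cases htop : ∀ w, w.2.length = n → c w = 0
    · refine ihn c (fun w hw => ?_) hcA
      rcases hw.eq_or_lt with h | h
      exacts [htop w h.symm, hc w h]
    push Not at htop
    obtain ⟨⟨α, l₀⟩, hl₀, hw₀⟩ := htop
    simp only at hl₀
    exfalso
    set e := (c (α, l₀))⁻¹ • c with he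
    have heA : Finsupp.linearCombination F (fun w => iteratedWord p G w.1 w.2) e ∈ A := by
      rw [he, map_smul]
      exact A.smul_mem _ hcA
    have he0 : e (α, l₀) = 1 := by simp [he, hw₀]
    have hez : ∀ w, c w = 0 → e w = 0 := fun w h => by simp [he, h]
    obtain ⟨d, hdA, hd⟩ := exists_coeff_mul_linearCombination t δ ht p G a hp A hA α e
    have htopd : ∀ β l, n ≤ l.length → d (β, l) = δ (e (β, l)) + (a β - a α) * e (β, l) := by
      intro β l hl
      rw [hd]
      have : ∀ β g, e (β, g :: l) = 0 := fun β g => hez _ (hc _ (by simpa using hl))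
      simp [this]
    have hd0 : d = 0 := by
      refine ihm _ ?_ d (fun w hw => ?_) rfl (hshrink α e heA d hdA)
      · rw [← hm]
        refine Finset.card_lt_card (Finset.ssubset_iff_of_subset ?_ |>.mpr
          ⟨(α, l₀), by simp [hw₀, hl₀], ?_⟩)
        · rintro ⟨β, l⟩ hw
          simp only [Finset.mem_filter, Finsupp.mem_support_iff] at hw ⊢
          refine ⟨fun h => hw.1 ?_, hw.2⟩
          rw [htopd β l hw.2.ge, hez _ h]
          simp
        · simp [htopd α l₀ hl₀.ge, he0, hδ1]
      · obtain ⟨β, l⟩ := w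
        simp only at hw
        rw [htopd β l (by omega), hez _ (hc _ hw)]
        simp
    have hother : ∀ β l, β ≠ α → l.length = n → e (β, l) = 0 := by
      intro β l hβ hl
      have := htopd β l hl.ge
      rw [hd0, Finsupp.zero_apply] at this
      refine h2 _ α β hβ.symm ?_
      linear_combination -this
    have hsame : ∀ l, l.length = n → ∃ r : k, algebraMap k F r = e (α, l) := by
      intro l hl
      have := htopd α l hl.ge
      rw [hd0, Finsupp.zero_apply] at this
      exact h1 _ (by linear_combination -this)
    cases l₀ with
    | nil =>
      simp only [List.length_nil] at hl₀
      refine hAp α ?_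
      have : e = Finsupp.single (α, []) 1 := by
        ext ⟨β, l⟩
        rcases Nat.eq_zero_or_pos l.length with hl | hl
        · obtain rfl := List.length_eq_zero_iff.mp hl
          by_cases hβ : β = α
          · rw [hβ, he0]; simp
          · rw [hother β [] hβ hl₀, Finsupp.single_eq_of_ne]
            simpa using hβ
        · rw [hez _ (hc _ (by simp only; omega)), Finsupp.single_eq_of_ne]
          rintro h
          simp [(Prod.mk.inj h).2] at hl
      rw [this] at heA
      simpa [iteratedWord] using heA
    | cons g₀ l =>
      simp only [List.length_cons] at hl₀
      choose r hr using fun g : Fin 3 => hsame (g :: l) (by simpa using hl₀)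
      have hsum : ∀ g, e (false, g :: l) + e (true, g :: l) = algebraMap k F (r g) := by
        intro g
        rw [hr]
        cases α
        · rw [hother true (g :: l) (by simp) (by simpa using hl₀), add_zero]
        · rw [hother false (g :: l) (by simp) (by simpa using hl₀), zero_add]
      have key := hd α l
      rw [hd0] at key
      simp only [hsum, Finsupp.zero_apply, sub_self, zero_mul, add_zero] at key
      have hr0 : r = 0 := by
        have := h3 (fun g => (bif α then 1 else -1) * r g) (e (α, l)) (by
          cases α <;> simp only [Fin.sum_univ_three, map_mul, map_neg, map_one, cond_true,
            cond_false] at key ⊢ <;> linear_combination key)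
        ext g
        have hg := congrFun this g
        cases α <;> simpa using hg
      have := hr g₀
      rw [he0, hr0] at this
      simp at this

end Independence

section RationalFunctions

open Polynomial

/-- The derivative of a reduced fraction `P / Q` has no simple poles. -/
theorem eval_eq_zero_of_mul_sq_eq_mul_wronskian {K : Type*} [Field K] [CharZero K]
    {P Q N S : K[X]} (hPQ : IsCoprime P Q) (hQ : Q ≠ 0) {r : K} (hS : S.eval r ≠ 0)
    (h : N * Q ^ 2 = (X - C r) * S * (derivative P * Q - P * derivative Q)) : N.eval r = 0 := by
  obtain ⟨R, hR, hRr⟩ := Q.exists_eq_pow_rootMultiplicity_mul_and_not_dvd hQ r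
  rw [dvd_iff_isRoot, IsRoot.def] at hRr
  rcases Nat.eq_zero_or_pos (Q.rootMultiplicity r) with h0 | h0
  · rw [h0, pow_zero, one_mul] at hR
    have := congrArg (eval r) h
    simpa [hR, hRr] using this
  · exfalso
    obtain ⟨e, he⟩ := Nat.exists_eq_add_of_lt h0
    rw [zero_add] at he
    rw [he] at hR
    have hQr : Q.eval r = 0 := by rw [hR]; simp
    have hPr : P.eval r ≠ 0 := by
      intro hP
      obtain ⟨u, v, huv⟩ := hPQ
      simpa [hP, hQr] using congrArg (eval r) huv
    have hdQ : derivative Q = (X - C r) ^ e * (((e : K[X]) + 1) * R + (X - C r) * derivative R) := by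
      rw [hR]
      simp [derivative_X_sub_C_pow]
      ring
    have hne : (X - C r) ^ (e + 1) ≠ 0 := pow_ne_zero _ (X_sub_C_ne_zero r)
    have key : N * (X - C r) ^ (e + 1) * R ^ 2 = S * (derivative P * (X - C r) * R
        - P * (((e : K[X]) + 1) * R + (X - C r) * derivative R)) := by
      refine mul_left_cancel₀ hne ?_
      rw [hdQ] at h
      nth_rewrite 1 2 [hR] at h
      linear_combination h
    have := congrArg (eval r) key
    simp [hS, hPr, hRr] at this
    exact Nat.cast_add_one_ne_zero e this

variable {k : Type*} [Field k] [CharZero k]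

theorem exists_C_of_wronskian_eq_zero {P Q : k[X]} (hPQ : IsCoprime P Q)
    (h : derivative P * Q - P * derivative Q = 0) : ∃ x y, P = C x ∧ Q = C y := by
  have := hPQ.wronskian_eq_zero_iff.mp (by rw [wronskian]; linear_combination -h)
  exact ⟨_, _, eq_C_of_derivative_eq_zero this.1, eq_C_of_derivative_eq_zero this.2⟩

theorem exists_int_of_X_mul_wronskian {P Q : k[X]} (hP : P ≠ 0) (hQ : Q ≠ 0) {κ : k}
    (h : -X * (derivative P * Q - P * derivative Q) = C κ * (P * Q)) : ∃ n : ℤ, κ = n := by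
  have hX : ∀ R : k[X], (X * derivative R).natDegree ≤ R.natDegree ∧
      (X * derivative R).coeff R.natDegree = R.natDegree * R.leadingCoeff := by
    intro R
    constructor
    · rcases Nat.eq_zero_or_pos R.natDegree with h0 | h0
      · rw [eq_C_of_natDegree_eq_zero h0]
        simp
      · refine natDegree_mul_le.trans ?_
        have := natDegree_derivative_lt h0.ne'
        simp only [natDegree_X]
        omega
    · rcases hn : R.natDegree with _ | n
      · simp
      · rw [coeff_X_mul, coeff_derivative, leadingCoeff, hn]
        push_cast
        ring
  refine ⟨Q.natDegree - P.natDegree, ?_⟩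
  have h' : P * (X * derivative Q) - X * derivative P * Q = C κ * (P * Q) := by
    linear_combination h
  have := congrArg (fun R => coeff R (P.natDegree + Q.natDegree)) h'
  simp only [coeff_sub, coeff_C_mul] at this
  rw [coeff_mul_add_eq_of_natDegree_le le_rfl (hX Q).1,
    coeff_mul_add_eq_of_natDegree_le (hX P).1 le_rfl,
    coeff_mul_add_eq_of_natDegree_le le_rfl le_rfl, (hX P).2, (hX Q).2] at this
  simp only [coeff_natDegree] at this
  have hPQ : P.leadingCoeff * Q.leadingCoeff ≠ 0 := by simp [hP, hQ]
  refine mul_right_cancel₀ hPQ ?_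
  push_cast
  linear_combination -this

/-- The functions `1`, `u`, `u⁻¹` with `u = (1 - Y²) / (1 + Y²)` are linearly independent modulo
the image of `-Y d/dY`. -/
theorem eq_zero_of_residues {P Q : k[X]} (hPQ : IsCoprime P Q) (hQ : Q ≠ 0) {a b c : k}
    (h : (C a * (1 - X ^ 4) + C b * (1 - X ^ 2) ^ 2 + C c * (1 + X ^ 2) ^ 2) * Q ^ 2 =
      -X * (1 - X ^ 4) * (derivative P * Q - P * derivative Q)) : a = 0 ∧ b = 0 ∧ c = 0 := by
  let K := AlgebraicClosure k
  obtain ⟨i, hi⟩ := IsAlgClosed.exists_pow_nat_eq (-1 : K) (n := 2) (by norm_num)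
  let σ := algebraMap k K
  have hPQ' : IsCoprime (P.map σ) (Q.map σ) := hPQ.map (mapRingHom σ)
  have hQ' : Q.map σ ≠ 0 := (Polynomial.map_ne_zero_iff σ.injective).mpr hQ
  have h' := congrArg (Polynomial.map σ) h
  simp only [Polynomial.map_mul, Polynomial.map_add, Polynomial.map_sub, Polynomial.map_pow,
    Polynomial.map_one, Polynomial.map_neg, map_X, map_C, ← derivative_map] at h'
  have hi4 : i ^ 4 = 1 := by linear_combination (i ^ 2 - 1) * hi
  have hi0 : i ≠ 0 := by
    rintro rfl
    norm_num at hi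
  have h0 := eval_eq_zero_of_mul_sq_eq_mul_wronskian (r := 0) (S := X ^ 4 - 1) hPQ' hQ' (by simp)
    (h'.trans (by simp only [map_zero]; ring))
  have h1 := eval_eq_zero_of_mul_sq_eq_mul_wronskian (r := 1) (S := X * (1 + X) * (1 + X ^ 2))
    hPQ' hQ' (by simp) (h'.trans (by simp only [map_one]; ring))
  have hIC : C i ^ 2 = (-1 : K[X]) := by rw [← C_pow, hi]; simp
  have hI := eval_eq_zero_of_mul_sq_eq_mul_wronskian (r := i) (S := X * (X + C i) * (X ^ 2 - 1))
    hPQ' hQ' (by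
      have : i * (i + i) * (i ^ 2 - 1) = 4 := by linear_combination (2 * i ^ 2 - 4) * hi
      simp [this]) (h'.trans (by
      linear_combination (X * (X ^ 2 - 1) * (derivative (P.map σ) * (Q.map σ)
        - (P.map σ) * derivative (Q.map σ))) * hIC))
  have hc : c = 0 := by simpa using h1
  have hb : b = 0 := by simpa [hi, hi4] using hI
  subst hc hb
  simpa using h0

end RationalFunctions

section Unipotent

variable {F D : Type*} [Field F] [Ring D] [Module F D]

theorem pow_sub_one_apply_mul (τ : Module.End F D) (t : D) (hτ : ∀ d, τ (t * d) = t * τ d + τ d)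
    (n : ℕ) : ∀ d, ((τ - 1) ^ (n + 1)) (t * d) =
      t * ((τ - 1) ^ (n + 1)) d + ((n : F) + 1) • τ (((τ - 1) ^ n) d) := by
  have h1 : ∀ d, (τ - 1) (t * d) = t * (τ - 1) d + τ d := fun d => by
    simp only [LinearMap.sub_apply, Module.End.one_apply, hτ, mul_sub]
    abel
  induction n with
  | zero => simpa using h1
  | succ n ih =>
    intro d
    have hc : ((τ - 1) ^ (n + 1)) (τ d) = τ (((τ - 1) ^ (n + 1)) d) := by
      have : Commute ((τ - 1) ^ (n + 1)) τ :=
        ((Commute.refl τ).sub_left (Commute.one_left τ)).pow_left _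
      exact congrArg (fun f : Module.End F D => f d) this.eq
    have hp : ∀ (m : ℕ) (e : D), ((τ - 1) ^ m) ((τ - 1) e) = ((τ - 1) ^ (m + 1)) e := fun m e => by
      rw [pow_succ, Module.End.mul_apply]
    rw [← hp (n + 1) (t * d), h1, map_add, ih, hc, hp, hp]
    push_cast
    module

theorem mul_mem_maxGenEigenspace (τ : Module.End F D) (t : D)
    (hτ : ∀ d, τ (t * d) = t * τ d + τ d) {d : D}
    (hd : d ∈ (τ - 1).maxGenEigenspace 0) : t * d ∈ (τ - 1).maxGenEigenspace 0 := by
  simp only [Module.End.mem_maxGenEigenspace, zero_smul, sub_zero] at hd ⊢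
  obtain ⟨n, hn⟩ := hd
  refine ⟨n + 1, ?_⟩
  rw [pow_sub_one_apply_mul τ t hτ, pow_succ', Module.End.mul_apply, hn]
  simp

theorem notMem_maxGenEigenspace [CharZero F] [Nontrivial D] (τ : Module.End F D)
    (hinj : Function.Injective τ)
    (t : D) (hτ : ∀ d, τ (t * d) = t * τ d + τ d) (hτ1 : τ 1 = 1) {p : D} {a : F}
    (hp : t * p = 1 + a • p) : p ∉ (τ - 1).maxGenEigenspace 0 := by
  classical
  simp only [Module.End.mem_maxGenEigenspace, zero_smul, sub_zero]
  intro h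
  have hn := Nat.find_spec h
  rcases hm : Nat.find h with _ | m
  · rw [hm, pow_zero, Module.End.one_apply] at hn
    simp [hn] at hp
  · rw [hm] at hn
    refine Nat.find_min h (m := m) (by omega) (hinj ?_)
    have := pow_sub_one_apply_mul τ t hτ m p
    rw [hp, map_add, map_smul, hn, pow_succ, Module.End.mul_apply] at this
    simpa [hτ1, Nat.cast_add_one_ne_zero] using this.symm

end Unipotent

section FreeAlgebra

variable {k F D : Type*} [Field k] [Field F] [Ring D] [Algebra k F] [Algebra k D] [Module F D]

/-- The factors `1`, `u`, `u⁻¹` (indexed by `Fin 3`) between the letters of a word in `v` and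
`u v u⁻¹`, followed by a final letter `u v u⁻¹`. -/
def wordLinks : List (Fin 2) → List (Fin 3)
  | [] => []
  | a :: m => (![![0, 1], ![2, 0]] a (m.headD 1) : Fin 3) :: wordLinks m

theorem wordLinks_injective : Function.Injective wordLinks := by
  intro m
  induction m with
  | nil =>
    rintro (_ | ⟨b, m'⟩) h
    · rfl
    · simp [wordLinks] at h
  | cons a m ih =>
    rintro (_ | ⟨b, m'⟩) h
    · simp [wordLinks] at h
    · simp only [wordLinks, List.cons.injEq] at h
      obtain rfl := ih h.2
      have key : ∀ a b c : Fin 2, (![![0, 1], ![2, 0]] a c : Fin 3) = ![![0, 1], ![2, 0]] b c →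
          a = b := by decide
      rw [key _ _ _ h.1]

theorem prod_mul_eq_smul_iteratedWord [IsScalarTower F D D] (p : Bool → D) {u : F} (hu : u ≠ 0)
    (m : List (Fin 2)) :
    (m.map ![p false - p true, u • ((p false - p true) * (u⁻¹ • 1))]).prod
        * (u • (p false - p true)) =
      (![1, u] (m.headD 1) : F) • (iteratedWord p ![1, u, u⁻¹] false (wordLinks m)
        - iteratedWord p ![1, u, u⁻¹] true (wordLinks m)) := by
  induction m with
  | nil => simp [wordLinks, iteratedWord]
  | cons a m ih =>
    rw [List.map_cons, List.prod_cons, mul_assoc, ih, wordLinks, iteratedWord, iteratedWord,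
      ← sub_mul]
    generalize m.headD 1 = b
    fin_cases a <;> fin_cases b <;>
      simp [smul_mul_assoc, mul_assoc, smul_smul, hu]

theorem linearIndependent_sub_of_prod {ι : Type*} {E : Bool × ι → D} (h : LinearIndependent F E) :
    LinearIndependent F fun i => E (false, i) - E (true, i) := by
  classical
  rw [linearIndependent_iff] at h ⊢
  intro c hc
  have := h (c.mapDomain (Prod.mk false) - c.mapDomain (Prod.mk true)) (by
    rw [map_sub, Finsupp.linearCombination_mapDomain, Finsupp.linearCombination_mapDomain, ← hc]
    simp [Finsupp.linearCombination_apply, smul_sub, Finsupp.sum, Function.comp_def])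
  ext i
  have hi := DFunLike.congr_fun this (false, i)
  rw [Finsupp.sub_apply, Finsupp.mapDomain_apply (Prod.mk_right_injective false),
    Finsupp.mapDomain_of_notMem_range _ _ (by simp), sub_zero] at hi
  simpa using hi

theorem lift_injective_of_linearIndependent [IsScalarTower F D D] [IsScalarTower k F D]
    (p : Bool → D) {u : F} (hu : u ≠ 0)
    (h : LinearIndependent F fun l => iteratedWord p ![1, u, u⁻¹] false l
        - iteratedWord p ![1, u, u⁻¹] true l) :
    Function.Injective (FreeAlgebra.lift k
      ![p false - p true, u • ((p false - p true) * (u⁻¹ • 1))]) := by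
  set f := ![p false - p true, u • ((p false - p true) * (u⁻¹ • 1))] with hf
  have hg : ∀ b : Fin 2, (![1, u] b : F) ≠ 0 := by
    intro b
    fin_cases b <;> simp [hu]
  have h1 := (h.comp wordLinks wordLinks_injective).units_smul
    fun m : List (Fin 2) => Units.mk0 _ (hg (m.headD 1))
  have h2 : LinearIndependent k fun m : List (Fin 2) =>
      (m.map f).prod * (u • (p false - p true)) := by
    convert h1.restrict_scalars' k using 2 with m
    rw [hf, prod_mul_eq_smul_iteratedWord p hu]
    rfl
  have h3 : LinearIndependent k fun m : List (Fin 2) => (m.map f).prod :=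
    LinearIndependent.of_comp (LinearMap.mulRight k (u • (p false - p true))) h2
  have hb : ∀ m : FreeMonoid (Fin 2),
      FreeAlgebra.lift k f (FreeAlgebra.basisFreeMonoid k (Fin 2) m) =
      (m.toList.map f).prod := fun m => by
    simp [FreeAlgebra.basisFreeMonoid, FreeAlgebra.equivMonoidAlgebraFreeMonoid,
      FreeMonoid.lift_apply, map_list_prod, Function.comp_def]
  have h4 : LinearIndependent k
      ((FreeAlgebra.lift k f).toLinearMap ∘ FreeAlgebra.basisFreeMonoid k (Fin 2)) := by
    have : ((FreeAlgebra.lift k f).toLinearMap ∘ FreeAlgebra.basisFreeMonoid k (Fin 2)) =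
        (fun m : List (Fin 2) => (m.map f).prod) ∘ FreeMonoid.toList := funext hb
    rw [this]
    exact h3.comp _ FreeMonoid.toList.injective
  rw [injective_iff_map_eq_zero]
  intro x hx
  have hx' := Finsupp.apply_linearCombination k (FreeAlgebra.lift k f).toLinearMap
    (FreeAlgebra.basisFreeMonoid k (Fin 2)) ((FreeAlgebra.basisFreeMonoid k (Fin 2)).repr x)
  rw [Module.Basis.linearCombination_repr, AlgHom.toLinearMap_apply, hx] at hx'
  simpa using linearIndependent_iff.mp h4 _ hx'.symm

end FreeAlgebra

section WeylPair

open Polynomial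

variable {k D : Type*} [Field k] [DivisionRing D] [Algebra k D]

theorem aeval_mul_sub_mul_aeval {x y : D} (hxy : y * x - x * y = 1) (P : k[X]) :
    aeval y P * x - x * aeval y P = aeval y (derivative P) := by
  induction P using Polynomial.induction_on with
  | C a => simp [Algebra.commutes]
  | add p q hp hq =>
    rw [derivative_add, map_add, map_add, ← hp, ← hq]
    noncomm_ring
  | monomial n a ih =>
    rw [pow_succ, ← mul_assoc]
    generalize C a * X ^ n = q at ih ⊢
    have h : y * x = x * y + 1 := by rw [← hxy]; abel
    rw [derivative_mul, derivative_X, mul_one, map_add, map_mul, map_mul, aeval_X, ← ih, mul_assoc,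
      h]
    noncomm_ring

theorem aeval_injective_of_commutator [CharZero k] {x y : D} (hxy : y * x - x * y = 1) :
    Function.Injective (aeval (R := k) y) := by
  rw [injective_iff_map_eq_zero]
  suffices H : ∀ n : ℕ, ∀ P : k[X], P.natDegree ≤ n → aeval y P = 0 → P = 0 from
    fun P => H _ P le_rfl
  intro n
  induction n with
  | zero =>
    intro P hP h
    rw [eq_C_of_natDegree_le_zero hP] at h ⊢
    simpa using h
  | succ n ih =>
    intro P hP h
    have hd : derivative P = 0 := ih _ ((natDegree_derivative_le P).trans (by omega)) (by
      rw [← aeval_mul_sub_mul_aeval hxy, h]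
      simp)
    rw [eq_C_of_derivative_eq_zero hd] at h ⊢
    simpa using h

/-- The embedding of `k(Y)` into a division ring containing a Weyl pair. -/
theorem exists_ratFunc_hom [CharZero k] {x y : D} (hxy : y * x - x * y = 1) :
    ∃ φ : RatFunc k →+* D, ∀ P : k[X], φ (algebraMap k[X] (RatFunc k) P) = aeval y P := by
  have hu : ∀ Q : nonZeroDivisors k[X],
      IsUnit (((aeval (R := k) y).toRingHom.toMonoidHom.comp (nonZeroDivisors k[X]).subtype) Q) := by
    intro Q
    rw [isUnit_iff_ne_zero]
    exact (map_ne_zero_iff _ (aeval_injective_of_commutator hxy)).mpr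
      (nonZeroDivisors.ne_zero Q.2)
  let ψ : FractionRing k[X] →+* D := OreLocalization.universalHom
    (aeval (R := k) y).toRingHom (IsUnit.liftRight _ hu) (fun s => rfl)
  refine ⟨ψ.comp (FractionRing.algEquiv k[X] (RatFunc k)).symm, fun P => ?_⟩
  simp only [RingHom.comp_apply, RingHom.coe_coe, AlgEquiv.commutes]
  exact OreLocalization.universalHom_commutes _ _ _

/-- The commutator with `y * x` restricts to a derivation of `k(y)`. -/
theorem exists_derivation {x y : D} (hxy : y * x - x * y = 1) (φ : RatFunc k →+* D)
    (hφ : ∀ P : k[X], φ (algebraMap k[X] (RatFunc k) P) = aeval y P) :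
    ∃ δ : RatFunc k →+ RatFunc k, (∀ c, y * x * φ c = φ c * (y * x) + φ (δ c)) ∧
      ∀ c, δ c * algebraMap k[X] (RatFunc k) (c.denom ^ 2) = algebraMap k[X] (RatFunc k)
        (-X * (derivative c.num * c.denom - c.num * derivative c.denom)) := by
  have hP : ∀ P : k[X], y * x * φ (algebraMap _ _ P) =
      φ (algebraMap _ _ P) * (y * x) + φ (algebraMap _ _ (-X * derivative P)) := by
    intro P
    have hc : y * aeval y P = aeval y P * y := by
      simpa using congrArg (aeval y) (mul_comm X P)
    simp only [hφ, map_mul, map_neg, aeval_X, ← aeval_mul_sub_mul_aeval hxy]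
    rw [← mul_assoc _ y x, ← hc]
    noncomm_ring
  have hex : ∀ c : RatFunc k, ∃ d, y * x * φ c = φ c * (y * x) + φ d ∧
      d * algebraMap k[X] (RatFunc k) (c.denom ^ 2) = algebraMap k[X] (RatFunc k)
        (-X * (derivative c.num * c.denom - c.num * derivative c.denom)) := by
    intro c
    have hQ : algebraMap k[X] (RatFunc k) c.denom ≠ 0 := by simpa using c.denom_ne_zero
    have hcQ : c * algebraMap k[X] (RatFunc k) c.denom = algebraMap _ _ c.num := by
      rw [← eq_div_iff hQ, RatFunc.num_div_denom]
    obtain ⟨d, hd⟩ : ∃ d, d * algebraMap k[X] (RatFunc k) c.denom =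
        algebraMap _ _ (-X * derivative c.num)
          - c * algebraMap _ _ (-X * derivative c.denom) := ⟨_ / _, div_mul_cancel₀ _ hQ⟩
    refine ⟨d, ?_, ?_⟩
    · have hφQ : φ (algebraMap k[X] (RatFunc k) c.denom) ≠ 0 := by simpa using hQ
      refine mul_right_cancel₀ hφQ ?_
      have h1 := congrArg φ hd
      have h2 := congrArg φ hcQ
      simp only [map_sub, map_mul φ] at h1 h2
      rw [add_mul, h1, mul_assoc, h2, hP, mul_assoc (φ c), hP, mul_add,
        ← mul_assoc (φ c) _ (y * x), h2]
      abel
    · simp only [map_mul, map_sub, map_pow] at hd hcQ ⊢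
      linear_combination (algebraMap k[X] (RatFunc k) c.denom) * hd
        - (algebraMap k[X] (RatFunc k) (-X) * algebraMap k[X] (RatFunc k) (derivative c.denom)) * hcQ
  choose δ hδ hδ' using hex
  have hδφ : ∀ c, φ (δ c) = y * x * φ c - φ c * (y * x) := fun c => by rw [hδ]; abel
  refine ⟨⟨⟨δ, ?_⟩, ?_⟩, hδ, hδ'⟩
  · apply φ.injective
    simp [hδφ]
  · intro a b
    apply φ.injective
    simp only [hδφ, map_add]
    noncomm_ring

end WeylPair

section RatFuncDerivation

open Polynomial

variable {k : Type*} [Field k] [CharZero k] {δ : RatFunc k → RatFunc k}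

theorem ratFunc_mem_range_of_derivation_eq_zero
    (hδ : ∀ c, δ c * algebraMap k[X] (RatFunc k) (c.denom ^ 2) = algebraMap k[X] (RatFunc k)
        (-X * (derivative c.num * c.denom - c.num * derivative c.denom)))
    {c : RatFunc k} (hc : δ c = 0) : c ∈ (algebraMap k (RatFunc k)).range := by
  have h := hδ c
  rw [hc, zero_mul, eq_comm, map_eq_zero_iff _ (RatFunc.algebraMap_injective k)] at h
  obtain ⟨a, b, ha, hb⟩ := exists_C_of_wronskian_eq_zero c.isCoprime_num_denom
    ((mul_eq_zero.mp h).resolve_left (neg_ne_zero.mpr X_ne_zero))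
  refine ⟨a / b, ?_⟩
  rw [← c.num_div_denom, ha, hb, map_div₀]
  simp [RatFunc.algebraMap_C]

theorem ratFunc_eq_zero_of_derivation_eq_mul
    (hδ : ∀ c, δ c * algebraMap k[X] (RatFunc k) (c.denom ^ 2) = algebraMap k[X] (RatFunc k)
        (-X * (derivative c.num * c.denom - c.num * derivative c.denom)))
    {κ : k} (hκ : ∀ n : ℤ, κ ≠ n) {c : RatFunc k}
    (hc : δ c = algebraMap k (RatFunc k) κ * c) : c = 0 := by
  by_contra hc0
  have hQ : algebraMap k[X] (RatFunc k) c.denom ≠ 0 := by simpa using c.denom_ne_zero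
  have hcQ : c * algebraMap k[X] (RatFunc k) c.denom = algebraMap _ _ c.num := by
    rw [← eq_div_iff hQ, RatFunc.num_div_denom]
  obtain ⟨n, hn⟩ := exists_int_of_X_mul_wronskian (RatFunc.num_ne_zero hc0) c.denom_ne_zero
    (κ := κ) (by
      apply RatFunc.algebraMap_injective k
      rw [← hδ, hc, map_mul, map_mul, ← hcQ, map_pow, RatFunc.algebraMap_C,
        RatFunc.algebraMap_eq_C]
      ring)
  exact hκ n hn

theorem ratFunc_residues
    (hδ : ∀ c, δ c * algebraMap k[X] (RatFunc k) (c.denom ^ 2) = algebraMap k[X] (RatFunc k)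
        (-X * (derivative c.num * c.denom - c.num * derivative c.denom)))
    {u : RatFunc k} (hu : u = algebraMap k[X] _ (1 - X ^ 2) / algebraMap k[X] _ (1 + X ^ 2))
    (h₁ : (1 - X ^ 2 : k[X]) ≠ 0) (h₂ : (1 + X ^ 2 : k[X]) ≠ 0)
    (r : Fin 3 → k) (c : RatFunc k)
    (h : ∑ g, algebraMap k (RatFunc k) (r g) * ![1, u, u⁻¹] g = δ c) : r = 0 := by
  have h₁' : algebraMap k[X] (RatFunc k) (1 - X ^ 2) ≠ 0 := by
    rwa [Ne, map_eq_zero_iff _ (RatFunc.algebraMap_injective k)]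
  have h₂' : algebraMap k[X] (RatFunc k) (1 + X ^ 2) ≠ 0 := by
    rwa [Ne, map_eq_zero_iff _ (RatFunc.algebraMap_injective k)]
  have hu₁ : u * algebraMap k[X] (RatFunc k) (1 + X ^ 2) = algebraMap k[X] _ (1 - X ^ 2) := by
    rw [hu, div_mul_cancel₀ _ h₂']
  have hu₂ : u⁻¹ * algebraMap k[X] (RatFunc k) (1 - X ^ 2) = algebraMap k[X] _ (1 + X ^ 2) := by
    rw [hu, inv_div, div_mul_cancel₀ _ h₁']
  have key := eq_zero_of_residues c.isCoprime_num_denom c.denom_ne_zero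
    (a := r 0) (b := r 1) (c := r 2) (by
      apply RatFunc.algebraMap_injective k
      have hd := hδ c
      rw [← h] at hd
      simp only [Fin.sum_univ_three, Matrix.cons_val_zero, Matrix.cons_val_one, Matrix.cons_val,
        RatFunc.algebraMap_eq_C] at hd
      simp only [map_mul, map_add, map_sub, map_pow, map_neg, map_one, RatFunc.algebraMap_C]
        at hd hu₁ hu₂ ⊢
      generalize algebraMap k[X] (RatFunc k) X = z at *
      generalize algebraMap k[X] (RatFunc k) c.denom = q at *
      linear_combination (1 - z ^ 4) * hd - RatFunc.C (r 1) * q ^ 2 * (1 - z ^ 2) * hu₁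
        - RatFunc.C (r 2) * q ^ 2 * (1 + z ^ 2) * hu₂)
  ext g
  fin_cases g
  exacts [key.1, key.2.1, key.2.2]

end RatFuncDerivation

section WeylPair

variable {k D : Type*} [Field k] [DivisionRing D] [Algebra k D]

theorem mul_mul_ne_of_commutator {x y : D} (hxy : y * x - x * y = 1) (r : k) :
    y * x - algebraMap k D r ≠ 0 := by
  intro h
  have hy : y ≠ 0 := by
    rintro rfl
    simp at hxy
  have h1 : y * (y * x) = y * x * y := by rw [sub_eq_zero.mp h, Algebra.commutes]
  refine hy ?_
  calc y = y * (y * x - x * y) := by rw [hxy, mul_one]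
    _ = y * (y * x) - y * x * y := by noncomm_ring
    _ = 0 := by rw [h1, sub_self]

open Polynomial in
theorem lift_injective_of_commutator [CharZero k] {x y : D} (hxy : y * x - x * y = 1) {u : D}
    (h₁ : (1 - X ^ 2 : k[X]) ≠ 0) (h₂ : (1 + X ^ 2 : k[X]) ≠ 0)
    (hu : u = (1 - y ^ 2) * (1 + y ^ 2)⁻¹) {v : D}
    (hv : v = (y * x - algebraMap k D (5/6))⁻¹ - (y * x - algebraMap k D (1/6))⁻¹) :
    Function.Injective (FreeAlgebra.lift k ![v, u * v * u⁻¹]) := by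
  obtain ⟨φ, hφ⟩ := exists_ratFunc_hom (k := k) hxy
  obtain ⟨δ, hδφ, hδ⟩ := exists_derivation hxy φ hφ
  have hφk : ∀ r : k, φ (algebraMap k (RatFunc k) r) = algebraMap k D r := fun r => by
    rw [RatFunc.algebraMap_eq_C, ← RatFunc.algebraMap_C, hφ, aeval_C]
  let _ : Module (RatFunc k) D := Module.compHom D φ
  have hsmul : ∀ (c : RatFunc k) (d : D), c • d = φ c * d := fun _ _ => rfl
  have : IsScalarTower (RatFunc k) D D := ⟨fun c d e => mul_assoc (φ c) d e⟩
  have : IsScalarTower k (RatFunc k) D := ⟨fun r c d => by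
    rw [hsmul, hsmul, Algebra.smul_def, map_mul, hφk, mul_assoc, Algebra.smul_def]⟩
  have hy : y ≠ 0 := by
    rintro rfl
    simp at hxy
  have hyφ : y = φ (algebraMap k[X] (RatFunc k) X) := by rw [hφ, aeval_X]
  let τ : Module.End (RatFunc k) D :=
    { toFun := fun d => y * d * y⁻¹
      map_add' := fun d e => by simp [mul_add, add_mul]
      map_smul' := fun c d => by
        have : y * φ c = φ c * y := by rw [hyφ, ← map_mul, mul_comm, map_mul]
        simp only [hsmul, RingHom.id_apply]
        rw [← mul_assoc, this]
        simp only [mul_assoc] }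
  have hτ_apply : ∀ d, τ d = y * d * y⁻¹ := fun _ => rfl
  have hτ1 : τ 1 = 1 := by rw [hτ_apply, mul_one, mul_inv_cancel₀ hy]
  have hτinj : Function.Injective τ := by
    intro d e h
    rw [hτ_apply, hτ_apply] at h
    exact mul_left_cancel₀ hy (mul_right_cancel₀ (inv_ne_zero hy) h)
  have hτt : ∀ d, τ (y * x * d) = y * x * τ d + τ d := by
    intro d
    have h : y * x = x * y + 1 := by rw [← hxy]; abel
    simp only [hτ_apply]
    calc y * (y * x * d) * y⁻¹ = y * (y * x) * d * y⁻¹ := by simp only [mul_assoc]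
      _ = _ := by
        nth_rewrite 1 [h]
        noncomm_ring
  let a : Bool → k := fun β => bif β then 1/6 else 5/6
  let p : Bool → D := fun β => (y * x - algebraMap k D (a β))⁻¹
  have hp : ∀ β, y * x * p β = 1 + algebraMap k (RatFunc k) (a β) • p β := by
    intro β
    have := mul_inv_cancel₀ (mul_mul_ne_of_commutator hxy (a β))
    rw [sub_mul, sub_eq_iff_eq_add] at this
    rw [hsmul, hφk, this]
  have hκ : ∀ β β', β ≠ β' → ∀ n : ℤ, a β - a β' ≠ n := by
    intro β β' hβ n hn
    have h3 : ((3 * n : ℤ) : k) = (2 : ℤ) ∨ ((3 * n : ℤ) : k) = (-2 : ℤ) := by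
      cases β <;> cases β' <;> simp [a] at hβ hn <;> push_cast <;> rw [← hn] <;> norm_num
    rcases h3 with h3 | h3 <;> have := Int.cast_injective h3 <;> omega
  set w : RatFunc k := algebraMap k[X] _ (1 - X ^ 2) / algebraMap k[X] _ (1 + X ^ 2) with hw
  have hw0 : w ≠ 0 := by
    rw [hw, div_ne_zero_iff]
    constructor <;> rwa [Ne, map_eq_zero_iff _ (RatFunc.algebraMap_injective k)]
  have huw : u = φ w := by
    rw [hw, map_div₀, hφ, hφ, hu, div_eq_mul_inv]
    simp
  have hind := iteratedWord_independent (k := k) (y * x) δ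
    (fun c d => by simp only [hsmul]; rw [← mul_assoc, hδφ, add_mul, mul_assoc]) (by
      apply φ.injective
      have := hδφ 1
      simpa using this)
    p ![1, w, w⁻¹] (fun β => algebraMap k (RatFunc k) (a β)) hp ((τ - 1).maxGenEigenspace 0)
    (by
      rw [Module.End.mem_maxGenEigenspace]
      exact ⟨1, by simp [hτ1]⟩)
    (fun d hd => mul_mem_maxGenEigenspace τ _ hτt hd)
    (fun β => notMem_maxGenEigenspace τ hτinj _ hτt hτ1 (hp β))
    (fun c hc => ratFunc_mem_range_of_derivation_eq_zero hδ hc)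
    (fun c β β' hβ hc => ratFunc_eq_zero_of_derivation_eq_mul hδ (hκ β β' hβ)
      (by rw [hc, map_sub]))
    (ratFunc_residues hδ hw h₁ h₂)
  have hlin : LinearIndependent (RatFunc k)
      fun e : Bool × List (Fin 3) => iteratedWord p ![1, w, w⁻¹] e.1 e.2 := by
    rw [linearIndependent_iff]
    exact fun c hc => hind c (hc ▸ Submodule.zero_mem _)
  have hfree := lift_injective_of_linearIndependent (k := k) p hw0
    (linearIndependent_sub_of_prod hlin)
  have hv' : v = p false - p true := hv
  have hconj : w • ((p false - p true) * (w⁻¹ • (1 : D))) = u * v * u⁻¹ := by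
    rw [hsmul, hsmul, mul_one, map_inv₀, ← huw, ← hv', mul_assoc]
  rwa [hconj, ← hv'] at hfree

/-- Invertible affine substitutions preserve freeness. -/
theorem lift_affine_injective {k A : Type*} [Field k] [Ring A] [Algebra k A] {v w : A} {a b : k}
    (hb : b ≠ 0) (h : Function.Injective (FreeAlgebra.lift k ![v, w])) :
    Function.Injective (FreeAlgebra.lift k
      ![algebraMap k A a + b • v, algebraMap k A a + b • w]) := by
  let f : FreeAlgebra k (Fin 2) →ₐ[k] FreeAlgebra k (Fin 2) :=
    FreeAlgebra.lift k fun i => algebraMap k _ a + b • FreeAlgebra.ι k i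
  let g : FreeAlgebra k (Fin 2) →ₐ[k] FreeAlgebra k (Fin 2) :=
    FreeAlgebra.lift k fun i => b⁻¹ • (FreeAlgebra.ι k i - algebraMap k _ a)
  have hgf : g.comp f = AlgHom.id k _ := by
    ext i
    simp [f, g, smul_smul, hb]
  have hf : Function.Injective f :=
    Function.LeftInverse.injective (g := g) fun z => congrArg (fun F : _ →ₐ[k] _ => F z) hgf
  have : FreeAlgebra.lift k ![algebraMap k A a + b • v, algebraMap k A a + b • w] =
      (FreeAlgebra.lift k ![v, w]).comp f := by
    ext i
    fin_cases i <;> simp [f]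
  rw [this]
  exact h.comp hf

end WeylPair

section AddInv

variable {k D : Type*} [Field k] [CharZero k] [DivisionRing D] [Algebra k D]

theorem mul_inv_add_inv_eq {t : D} (h₁ : t - algebraMap k D (5/6) ≠ 0)
    (h₂ : t - algebraMap k D (1/6) ≠ 0) {s : D}
    (hs : s = (t - algebraMap k D (5/6)) * (t - algebraMap k D (1/6))⁻¹) :
    s + s⁻¹ = algebraMap k D 2 +
      (2/3 : k) • ((t - algebraMap k D (5/6))⁻¹ - (t - algebraMap k D (1/6))⁻¹) := by
  have hAB : (t - algebraMap k D (5/6)) = (t - algebraMap k D (1/6)) - (2/3 : k) • 1 := by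
    rw [← Algebra.algebraMap_eq_smul_one, sub_sub, ← map_add]
    norm_num
  have hBA : (t - algebraMap k D (1/6)) = (t - algebraMap k D (5/6)) + (2/3 : k) • 1 := by
    rw [hAB, sub_add_cancel]
  have h3 : s = 1 - (2/3 : k) • (t - algebraMap k D (1/6))⁻¹ := by
    rw [hs, hAB, sub_mul, mul_inv_cancel₀ h₂, smul_one_mul]
  have h4 : s⁻¹ = 1 + (2/3 : k) • (t - algebraMap k D (5/6))⁻¹ := by
    rw [hs, mul_inv_rev, inv_inv, hBA, add_mul, mul_inv_cancel₀ h₁, smul_one_mul]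
  have h2 : algebraMap k D 2 = 1 + 1 := by
    rw [← one_add_one_eq_two, map_add, map_one]
  rw [h4, h3, h2, smul_sub]
  abel

end AddInv

open Polynomial in
theorem one_add_X_sq_ne_zero (R : Type*) [Ring R] [Nontrivial R] : (1 + X ^ 2 : R[X]) ≠ 0 := by
  intro h
  simpa using congrArg (fun P => coeff P 0) h

open Polynomial in
theorem one_sub_X_sq_ne_zero (R : Type*) [Ring R] [Nontrivial R] : (1 - X ^ 2 : R[X]) ≠ 0 := by
  intro h
  simpa using congrArg (fun P => coeff P 0) h

theorem WeylAlgebra.Y_mul_X_sub_X_mul_Y (k : Type*) [CommRing k] :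
    WeylAlgebra.Y k * WeylAlgebra.X k - WeylAlgebra.X k * WeylAlgebra.Y k = 1 := by
  have h := RingQuot.mkAlgHom_rel k (WeylRel.rel (k := k))
  rw [map_add, map_mul, map_mul, map_one] at h
  rw [sub_eq_iff_eq_add, add_comm]
  exact h

/-- inside the Ore division ring of fractions `D₁` of the first Weyl algebra
over a field of characteristic zero, with `s = (YX − 5/6)(YX − 1/6)⁻¹` and
`u = (1 − Y²)(1 + Y²)⁻¹`, the elements `s + s⁻¹` and `u(s + s⁻¹)u⁻¹` generate a free
`k`-algebra. -/
theorem free_algebra_in_weyl_fractions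
    (k : Type*) [Field k] [CharZero k]
    -- `D₁` is the Ore division ring of fractions of the Weyl algebra via `f`
    (D₁ : Type*) [DivisionRing D₁] [Algebra k D₁]
    (f : WeylAlgebra k →ₐ[k] D₁)
    (hinj : Function.Injective f)
    (hfrac : ∀ d : D₁, ∃ r s : WeylAlgebra k, s ≠ 0 ∧ d = (f s)⁻¹ * f r) :
    (WeylAlgebra.Y k * WeylAlgebra.X k - algebraMap k (WeylAlgebra k) (5/6) ≠ 0) ∧
    (WeylAlgebra.Y k * WeylAlgebra.X k - algebraMap k (WeylAlgebra k) (1/6) ≠ 0) ∧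
    (1 + WeylAlgebra.Y k ^ 2 ≠ 0) ∧
    (1 - WeylAlgebra.Y k ^ 2 ≠ 0) ∧
    ∀ s u : D₁,
      s = f (WeylAlgebra.Y k * WeylAlgebra.X k - algebraMap k (WeylAlgebra k) (5/6)) *
            (f (WeylAlgebra.Y k * WeylAlgebra.X k - algebraMap k (WeylAlgebra k) (1/6)))⁻¹ →
      u = f (1 - WeylAlgebra.Y k ^ 2) * (f (1 + WeylAlgebra.Y k ^ 2))⁻¹ →
      s ≠ 0 ∧
      Function.Injective ⇑(FreeAlgebra.lift k
        ![s + s⁻¹, u * (s + s⁻¹) * u⁻¹]) := by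
  have hxy : f (WeylAlgebra.Y k) * f (WeylAlgebra.X k)
      - f (WeylAlgebra.X k) * f (WeylAlgebra.Y k) = 1 := by
    rw [← map_mul, ← map_mul, ← map_sub, WeylAlgebra.Y_mul_X_sub_X_mul_Y, map_one]
  have hf : ∀ r : k, f (WeylAlgebra.Y k * WeylAlgebra.X k - algebraMap k (WeylAlgebra k) r) =
      f (WeylAlgebra.Y k) * f (WeylAlgebra.X k) - algebraMap k D₁ r := fun r => by
    rw [map_sub, map_mul, AlgHom.commutes]
  have hadd : f (1 + WeylAlgebra.Y k ^ 2) = 1 + f (WeylAlgebra.Y k) ^ 2 := by simp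
  have hsub : f (1 - WeylAlgebra.Y k ^ 2) = 1 - f (WeylAlgebra.Y k) ^ 2 := by simp
  have hr := mul_mul_ne_of_commutator (k := k) hxy
  have haeval := aeval_injective_of_commutator (k := k) hxy
  have hadd0 : 1 + f (WeylAlgebra.Y k) ^ 2 ≠ 0 := by
    simpa using (map_ne_zero_iff _ haeval).mpr (one_add_X_sq_ne_zero k)
  have hsub0 : 1 - f (WeylAlgebra.Y k) ^ 2 ≠ 0 := by
    simpa using (map_ne_zero_iff _ haeval).mpr (one_sub_X_sq_ne_zero k)
  refine ⟨ne_zero_of_map (f := f) (hf _ ▸ hr _), ne_zero_of_map (f := f) (hf _ ▸ hr _),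
    ne_zero_of_map (f := f) (hadd ▸ hadd0), ne_zero_of_map (f := f) (hsub ▸ hsub0), ?_⟩
  intro s u hs hu
  rw [hf, hf] at hs
  rw [hadd, hsub] at hu
  have hu0 : u ≠ 0 := hu ▸ mul_ne_zero hsub0 (inv_ne_zero hadd0)
  refine ⟨hs ▸ mul_ne_zero (hr _) (inv_ne_zero (hr _)), ?_⟩
  have h := lift_affine_injective (a := 2) (b := 2/3) (by norm_num)
    (lift_injective_of_commutator hxy (one_sub_X_sq_ne_zero k) (one_add_X_sq_ne_zero k) hu rfl)
  rw [mul_inv_add_inv_eq (hr _) (hr _) hs]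
  convert h using 4
  rw [mul_add, add_mul, ← Algebra.commutes, mul_assoc, mul_inv_cancel₀ hu0, mul_one,
    mul_smul_comm, smul_mul_assoc]
end

section
/- Let k be a field of characteristic zero and L a Lie k-algebra such that U(L) is an Ore domain, with Ore division ring of fractions 𝔇(L). Let u, v ∈ L be such that the Lie subalgebra of L generated by {u, v} has dimension at least 3. Set w = [v,u] and V = ½w(uv + vu)w in U(L). Then V − ⅓w³, V + ⅓w³, w + v² and w − v² are nonzero, hence invertible in 𝔇(L), and setting S = (V − ⅓w³)(V + ⅓w³)⁻¹ + (V − ⅓w³)⁻¹(V + ⅓w³) and T = (w + v²)⁻¹(w − v²)S(w + v²)(w − v²)⁻¹, the following hold: (1) the k-subalgebra of 𝔇(L) generated by S and T is the free k-algebra on {S, T}; (2) S and T are symmetric with respect to the principal involution of 𝔇(L). -/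
namespace PBW

variable {k L I : Type*} [Field k] [LieRing L] [LieAlgebra k L] [LinearOrder I]

/-- The basis vector of the polynomial module attached to the monomial `m`. -/
noncomputable abbrev mono (k : Type*) {I : Type*} [Field k] (m : Multiset I) : Multiset I →₀ k :=
  Finsupp.single m 1

/-- One step of the recursive construction of the action of a basis vector `b i` on monomials,
in terms of an action `A` on monomials of smaller size; the list `l` is the sorted monomial. -/
noncomputable def actStep (b : Module.Basis I k L)
    (A : L →ₗ[k] (Multiset I →₀ k) →ₗ[k] (Multiset I →₀ k)) (i : I) :
    List I → (Multiset I →₀ k)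
  | [] => mono k {i}
  | j :: l =>
    if i ≤ j then mono k (i ::ₘ j ::ₘ (l : Multiset I))
    else mono k (i ::ₘ j ::ₘ (l : Multiset I))
      + A (b j) (A (b i) (mono k (l : Multiset I)) - mono k (i ::ₘ (l : Multiset I)))
      + A ⁅b i, b j⁆ (mono k (l : Multiset I))

/-- Approximations of the action of `L` on the polynomial module, correct on monomials of
size less than the given natural number. -/
noncomputable def preAct (b : Module.Basis I k L) :
    ℕ → (L →ₗ[k] (Multiset I →₀ k) →ₗ[k] (Multiset I →₀ k))
  | 0 => 0
  | n + 1 => b.constr k fun i =>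
      Finsupp.linearCombination k fun m => actStep b (preAct b n) i (m.sort (· ≤ ·))

set_option linter.unusedSectionVars false

variable (b : Module.Basis I k L)

lemma preAct_succ (n : ℕ) (i : I) (m : Multiset I) :
    preAct b (n + 1) (b i) (mono k m) = actStep b (preAct b n) i (m.sort (· ≤ ·)) := by
  simp [preAct]

lemma sort_cons {i : I} {m : Multiset I} (h : ∀ j ∈ m, i ≤ j) :
    (i ::ₘ m).sort (· ≤ ·) = i :: m.sort (· ≤ ·) := by
  exact Multiset.sort_cons i m (· ≤ ·) h

lemma preAct_of_le (n : ℕ) {i : I} {m : Multiset I} (h : ∀ j ∈ m, i ≤ j) :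
    preAct b (n + 1) (b i) (mono k m) = mono k (i ::ₘ m) := by
  rw [preAct_succ]
  rcases hl : m.sort (· ≤ ·) with _ | ⟨j, l⟩
  · have : m = 0 := by rw [← Multiset.sort_eq m (· ≤ ·), hl]; rfl
    subst this; simp [actStep]
  · have hm : m = j ::ₘ (l : Multiset I) := by
      rw [← Multiset.sort_eq m (· ≤ ·), hl]; rfl
    have : i ≤ j := h j (by simp [hm])
    simp [actStep, this, hm]

lemma preAct_of_lt (n : ℕ) {i j : I} {m : Multiset I} (hij : j < i) (h : ∀ l ∈ m, j ≤ l) :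
    preAct b (n + 1) (b i) (mono k (j ::ₘ m)) = mono k (i ::ₘ j ::ₘ m)
      + preAct b n (b j) (preAct b n (b i) (mono k m) - mono k (i ::ₘ m))
      + preAct b n ⁅b i, b j⁆ (mono k m) := by
  rw [preAct_succ, sort_cons h]
  simp [actStep, not_le.2 hij]

lemma exists_min_cons {m : Multiset I} {i : I} (h : ¬ ∀ j ∈ m, i ≤ j) :
    ∃ (j : I) (m' : Multiset I), m = j ::ₘ m' ∧ j < i ∧ ∀ l ∈ m', j ≤ l := by
  rcases hl : m.sort (· ≤ ·) with _ | ⟨j, l⟩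
  · have : m = 0 := by rw [← Multiset.sort_eq m (· ≤ ·), hl]; rfl
    simp [this] at h
  · have hm : m = j ::ₘ (l : Multiset I) := by
      rw [← Multiset.sort_eq m (· ≤ ·), hl]; rfl
    have hs : (j :: l).Pairwise (· ≤ ·) := hl ▸ Multiset.pairwise_sort m (· ≤ ·)
    rw [List.pairwise_cons] at hs
    refine ⟨j, l, hm, ?_, by simpa using hs.1⟩
    by_contra! hij
    apply h
    intro a ha
    rw [hm, Multiset.mem_cons] at ha
    rcases ha with rfl | ha
    · exact hij
    · exact hij.trans (hs.1 a (by simpa using ha))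

section Filtered

variable {Γ : Type*} [AddCommMonoid Γ] [PartialOrder Γ] [IsOrderedCancelAddMonoid Γ]

/-- The span of the monomials of degree less than `g`. -/
noncomputable abbrev below (k : Type*) [Field k] {I Γ : Type*} [LT Γ] (D : Multiset I → Γ) (g : Γ) :
    Submodule k (Multiset I →₀ k) := Finsupp.supported k k {m | D m < g}

/-- A linear map that sends the monomials indexed by a set into a submodule sends all combinations
of these monomials into it. -/
lemma map_mem_of_supported {M : Type*} [AddCommGroup M] [Module k M] {s : Set (Multiset I)}
    {N : Submodule k M} (φ : (Multiset I →₀ k) →ₗ[k] M) (h : ∀ m ∈ s, φ (mono k m) ∈ N)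
    {q : Multiset I →₀ k} (hq : q ∈ Finsupp.supported k k s) : φ q ∈ N := by
  rw [Finsupp.supported_eq_span_single] at hq
  have : Submodule.span k ((fun i => Finsupp.single i (1 : k)) '' s) ≤ N.comap φ := by
    rw [Submodule.span_le]
    rintro _ ⟨m, hm, rfl⟩
    exact h m hm
  exact this hq

lemma apply_mem_of_basis {M : Type*} [AddCommGroup M] [Module k M]
    {N : Submodule k M} (φ : L →ₗ[k] M) (h : ∀ i, φ (b i) ∈ N) (x : L) : φ x ∈ N := by
  have : (⊤ : Submodule k L) ≤ N.comap φ := by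
    rw [← b.span_eq, Submodule.span_le]
    rintro _ ⟨i, rfl⟩
    exact h i
  exact this trivial

lemma preAct_sub_mem (D : Multiset I →+ Γ) (hD : ∀ i j l, D {l} < D {i} + D {j}) (n : ℕ) :
    ∀ (i : I) (m : Multiset I), m.card < n →
      preAct b n (b i) (mono k m) - mono k (i ::ₘ m) ∈
        Finsupp.supported k k {m' | D m' < D (i ::ₘ m) ∧ m'.card ≤ m.card} := by
  induction n with
  | zero => simp
  | succ n ih =>
    intro i m hm
    have hcons (i : I) (m) : D (i ::ₘ m) = D {i} + D m := by
      rw [← Multiset.singleton_add, map_add]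
    by_cases h : ∀ j ∈ m, i ≤ j
    · simp [preAct_of_le b n h]
    · obtain ⟨j, m, rfl, hij, hj⟩ := exists_min_cons h
      rw [Multiset.card_cons] at hm
      have hm' : m.card < n := by omega
      rw [preAct_of_lt b n hij hj, add_assoc, add_sub_cancel_left]
      refine Submodule.add_mem _ ?_ ?_
      · refine map_mem_of_supported _ ?_ (ih i m hm')
        rintro m' ⟨h1, h2⟩
        rw [← sub_add_cancel (preAct b n (b j) (mono k m')) (mono k (j ::ₘ m'))]
        have h3 : D (j ::ₘ m') < D (i ::ₘ j ::ₘ m) := by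
          rw [Multiset.cons_swap, hcons j, hcons j]; gcongr
        refine Submodule.add_mem _ (Finsupp.supported_mono ?_ (ih j m' (by omega))) ?_
        · rintro m'' ⟨h4, h5⟩
          simp only [Multiset.card_cons]
          exact ⟨h4.trans h3, by omega⟩
        · refine Finsupp.single_mem_supported k _ ⟨h3, ?_⟩
          simpa using h2
      · refine apply_mem_of_basis b ((preAct b n).flip (mono k m)) (fun l => ?_) _
        rw [LinearMap.flip_apply, ← sub_add_cancel (preAct b n (b l) (mono k m)) (mono k (l ::ₘ m))]
        have h3 : D (l ::ₘ m) < D (i ::ₘ j ::ₘ m) := by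
          rw [hcons, hcons, hcons, ← add_assoc]
          exact add_lt_add_left (hD i j l) _
        refine Submodule.add_mem _ (Finsupp.supported_mono ?_ (ih l m hm')) ?_
        · rintro m'' ⟨h4, h5⟩
          exact ⟨h4.trans h3, by simp; omega⟩
        · exact Finsupp.single_mem_supported k _ ⟨h3, by simp⟩

end Filtered

lemma preAct_sub_mem_card (n : ℕ) (i : I) (m : Multiset I) (h : m.card < n) :
    preAct b n (b i) (mono k m) - mono k (i ::ₘ m) ∈
      Finsupp.supported k k {m' | m'.card ≤ m.card} :=
  Finsupp.supported_mono (fun _ h => h.2)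
    (preAct_sub_mem b (⟨⟨Multiset.card, rfl⟩, Multiset.card_add⟩ : Multiset I →+ ℕ)
      (fun i j l => by change Multiset.card {l} < Multiset.card {i} + Multiset.card {j}; simp) n i m h)

lemma preAct_stable (n : ℕ) : ∀ (x : L) (m : Multiset I), m.card < n →
    preAct b (n + 1) x (mono k m) = preAct b n x (mono k m) := by
  induction n with
  | zero => simp
  | succ n ih =>
    intro x m hm
    suffices h : (preAct b (n + 2)).flip (mono k m) = (preAct b (n + 1)).flip (mono k m) from
      LinearMap.congr_fun h x
    refine b.ext fun i => ?_
    simp only [LinearMap.flip_apply]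
    by_cases h : ∀ j ∈ m, i ≤ j
    · rw [preAct_of_le b _ h, preAct_of_le b _ h]
    · obtain ⟨j, m, rfl, hij, hj⟩ := exists_min_cons h
      rw [Multiset.card_cons] at hm
      have hm' : m.card < n := by omega
      rw [preAct_of_lt b _ hij hj, preAct_of_lt b _ hij hj, ih _ _ hm', ih _ _ hm']
      congr 2
      rw [← sub_eq_zero, ← LinearMap.sub_apply, ← Submodule.mem_bot k]
      refine map_mem_of_supported _ ?_ (preAct_sub_mem_card b n i m hm')
      intro m' (h' : m'.card ≤ m.card)
      rw [LinearMap.sub_apply, ih _ _ (by omega), sub_self]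
      exact Submodule.zero_mem _

/-- The action of `L` on the polynomial module. -/
noncomputable def act : L →ₗ[k] (Multiset I →₀ k) →ₗ[k] (Multiset I →₀ k) :=
  LinearMap.flip <| Finsupp.linearCombination k fun m => (preAct b (m.card + 1)).flip (mono k m)

lemma act_mono (x : L) (m : Multiset I) (n : ℕ) (h : m.card < n) :
    act b x (mono k m) = preAct b n x (mono k m) := by
  induction n, h using Nat.le_induction with
  | base => simp [act]
  | succ n hn ih => rw [preAct_stable b n x m hn, ih]

lemma act_eq_preAct (x : L) (q : Multiset I →₀ k) (n : ℕ)
    (h : q ∈ Finsupp.supported k k {m' | m'.card ≤ n}) :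
    act b x q = preAct b (n + 1) x q := by
  rw [← sub_eq_zero, ← LinearMap.sub_apply, ← Submodule.mem_bot k]
  refine map_mem_of_supported _ ?_ h
  intro m' (h' : m'.card ≤ n)
  rw [LinearMap.sub_apply, act_mono b x m' (n + 1) (by omega), sub_self]
  exact Submodule.zero_mem _

lemma act_of_le {i : I} {m : Multiset I} (h : ∀ j ∈ m, i ≤ j) :
    act b (b i) (mono k m) = mono k (i ::ₘ m) := by
  rw [act_mono b _ _ _ (Nat.lt_succ_self _), preAct_of_le b _ h]

lemma act_sub_mem_card (i : I) (m : Multiset I) :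
    act b (b i) (mono k m) - mono k (i ::ₘ m) ∈
      Finsupp.supported k k {m' | m'.card ≤ m.card} := by
  rw [act_mono b _ _ _ (Nat.lt_succ_self _)]
  exact preAct_sub_mem_card b _ i m (Nat.lt_succ_self _)

lemma act_of_lt {i j : I} {m : Multiset I} (hij : j < i) (h : ∀ l ∈ m, j ≤ l) :
    act b (b i) (mono k (j ::ₘ m)) =
      act b (b j) (act b (b i) (mono k m)) + act b ⁅b i, b j⁆ (mono k m) := by
  have h' : ∀ l ∈ i ::ₘ m, j ≤ l := by
    intro l hl
    rcases Multiset.mem_cons.1 hl with rfl | hl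
    exacts [hij.le, h l hl]
  rw [act_mono b _ _ (m.card + 1 + 1) (by simp), preAct_of_lt b _ hij h,
    ← act_mono b _ _ _ (Nat.lt_succ_self _), ← act_mono b _ _ _ (Nat.lt_succ_self _),
    ← act_eq_preAct b _ _ _ (act_sub_mem_card b i m), map_sub, act_of_le b h', Multiset.cons_swap]
  abel

section Filtered

variable {Γ : Type*} [AddCommMonoid Γ] [PartialOrder Γ] [IsOrderedCancelAddMonoid Γ]

lemma act_sub_mem_below (D : Multiset I →+ Γ) (hD : ∀ i j l, D {l} < D {i} + D {j})
    (i : I) (m : Multiset I) :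
    act b (b i) (mono k m) - mono k (i ::ₘ m) ∈ below k D (D (i ::ₘ m)) := by
  rw [act_mono b _ _ _ (Nat.lt_succ_self _)]
  exact Finsupp.supported_mono (fun _ h => h.1)
    (preAct_sub_mem b D hD _ i m (Nat.lt_succ_self _))

end Filtered

lemma basis_induction {p : L → Prop} (h0 : p 0) (hadd : ∀ x y, p x → p y → p (x + y))
    (hsmul : ∀ (c : k) x, p x → p (c • x)) (hb : ∀ i, p (b i)) (x : L) : p x := by
  have : x ∈ Submodule.span k (Set.range b) := by simp
  induction this using Submodule.span_induction with
  | mem x h => obtain ⟨i, rfl⟩ := h; exact hb i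
  | zero => exact h0
  | add x y _ _ hx hy => exact hadd x y hx hy
  | smul c x _ hx => exact hsmul c x hx

lemma act_bracket_of_basis {q : Multiset I →₀ k}
    (h : ∀ i j, act b (b i) (act b (b j) q) - act b (b j) (act b (b i) q)
      = act b ⁅b i, b j⁆ q) (x y : L) :
    act b x (act b y q) - act b y (act b x q) = act b ⁅x, y⁆ q := by
  induction x using basis_induction b with
  | h0 => simp
  | hadd x x' hx hx' =>
    simp only [map_add, LinearMap.add_apply, add_lie, ← hx, ← hx']; abel
  | hsmul c x hx =>
    simp only [map_smul, LinearMap.smul_apply, smul_lie, ← hx, smul_sub]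
  | hb i =>
    induction y using basis_induction b with
    | h0 => simp
    | hadd x x' hx hx' =>
      simp only [map_add, LinearMap.add_apply, lie_add, ← hx, ← hx']; abel
    | hsmul c x hx =>
      simp only [map_smul, LinearMap.smul_apply, lie_smul, ← hx, smul_sub]
    | hb j => exact h i j

lemma supported_card_mono {q : Multiset I →₀ k} {c n : ℕ}
    (hq : q ∈ Finsupp.supported k k {m : Multiset I | m.card ≤ c}) (h : c < n) :
    q ∈ Finsupp.supported k k {m : Multiset I | m.card < n} := by
  have hs : {m : Multiset I | m.card ≤ c} ⊆ {m | m.card < n} := fun m hm => lt_of_le_of_lt hm h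
  exact Finsupp.supported_mono hs hq

lemma act_bracket_basis (n : ℕ) : ∀ (m : Multiset I), m.card = n → ∀ i j : I,
    act b (b i) (act b (b j) (mono k m)) - act b (b j) (act b (b i) (mono k m))
      = act b ⁅b i, b j⁆ (mono k m) := by
  induction n using Nat.strong_induction_on with
  | _ n ih =>
    have easy : ∀ (m : Multiset I) (i j : I), j < i → (∀ l ∈ m, j ≤ l) →
        act b (b i) (act b (b j) (mono k m)) - act b (b j) (act b (b i) (mono k m))
          = act b ⁅b i, b j⁆ (mono k m) := by
      intro m i j hij h
      rw [act_of_le b h, act_of_lt b hij h, add_sub_cancel_left]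
    have ihx : ∀ (m : Multiset I), m.card < n → ∀ (x y : L),
        act b x (act b y (mono k m)) - act b y (act b x (mono k m)) = act b ⁅x, y⁆ (mono k m) :=
      fun m hm => act_bracket_of_basis b (ih _ hm m rfl)
    have ihq : ∀ q ∈ Finsupp.supported k k {m : Multiset I | m.card < n}, ∀ (x y : L),
        act b x (act b y q) - act b y (act b x q) = act b ⁅x, y⁆ q := by
      intro q hq x y
      have := map_mem_of_supported (N := ⊥)
        ((act b x) ∘ₗ (act b y) - (act b y) ∘ₗ (act b x) - act b ⁅x, y⁆)
        (fun m hm => by simpa [sub_eq_zero] using ihx m hm x y) hq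
      simpa [sub_eq_zero] using this
    -- both indices exceed the least index of the monomial
    have key : ∀ (l : I) (m : Multiset I), m.card < n → (∀ a ∈ m, l ≤ a) → ∀ i j : I, l < i → l < j →
        act b (b i) (act b (b j) (mono k (l ::ₘ m))) =
          act b (b l) (act b (b i) (act b (b j) (mono k m)))
          + act b ⁅b i, b l⁆ (act b (b j) (mono k m))
          + act b ⁅b j, b l⁆ (act b (b i) (mono k m))
          + act b ⁅b i, ⁅b j, b l⁆⁆ (mono k m) := by
      intro l m hm hl i j hi hj
      have hl' : ∀ a ∈ j ::ₘ m, l ≤ a := by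
        intro a ha
        rcases Multiset.mem_cons.1 ha with rfl | ha
        exacts [hj.le, hl a ha]
      have h1 := ihq _ (supported_card_mono (act_sub_mem_card b j m) hm) (b i) (b l)
      have h2 := easy (j ::ₘ m) i l hi hl'
      have h3 := ihx m hm (b i) ⁅b j, b l⁆
      rw [act_of_lt b hj hl, map_add, ← h3]
      simp only [map_sub] at h1
      rw [sub_eq_iff_eq_add] at h1 h2
      rw [sub_eq_iff_eq_add, h2] at h1
      rw [h1]
      abel
    have lt_case : ∀ m : Multiset I, m.card = n → ∀ i j : I, j < i →
        act b (b i) (act b (b j) (mono k m)) - act b (b j) (act b (b i) (mono k m))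
          = act b ⁅b i, b j⁆ (mono k m) := by
      intro m hm i j hij
      by_cases h : ∀ l ∈ m, j ≤ l
      · exact easy m i j hij h
      · obtain ⟨l, m, rfl, hlj, hl⟩ := exists_min_cons h
        have hm' : m.card < n := by rw [← hm]; simp
        have hli := hlj.trans hij
        rw [key l m hm' hl i j hli hlj, key l m hm' hl j i hlj hli]
        have h1 := ihx m hm' (b i) (b j)
        have h2 := ihx m hm' ⁅b i, b j⁆ (b l)
        rw [act_of_le b hl] at h2
        have h3 : act b ⁅⁅b i, b j⁆, b l⁆ (mono k m) = act b ⁅b i, ⁅b j, b l⁆⁆ (mono k m)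
            - act b ⁅b j, ⁅b i, b l⁆⁆ (mono k m) := by
          rw [lie_lie, map_sub, LinearMap.sub_apply]
        rw [h3, ← h1, map_sub, sub_eq_iff_eq_add] at h2
        rw [h2]
        abel
    intro m hm i j
    rcases lt_trichotomy i j with h | rfl | h
    · rw [← neg_inj, neg_sub, lt_case m hm j i h, ← lie_skew, map_neg, LinearMap.neg_apply]
    · simp
    · exact lt_case m hm i j h

end PBW

namespace PBW

attribute [local instance] LieRing.ofAssociativeRing LieAlgebra.ofAssociativeAlgebra

set_option linter.unusedSectionVars false
variable {k L I : Type*} [Field k] [LieRing L] [LieAlgebra k L] [LinearOrder I]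
variable (b : Module.Basis I k L)

/-- The representation of the enveloping algebra on the polynomial module. -/
noncomputable def rep : UniversalEnvelopingAlgebra k L →ₐ[k] Module.End k (Multiset I →₀ k) :=
  UniversalEnvelopingAlgebra.lift k
    { act b with
      map_lie' := by
        intro x y
        ext m : 1
        refine LinearMap.ext_ring ?_
        exact (act_bracket_of_basis b (act_bracket_basis b _ m rfl) x y).symm }

lemma rep_ι (x : L) : rep b (UniversalEnvelopingAlgebra.ι k x) = act b x := by
  rw [rep, UniversalEnvelopingAlgebra.lift_ι_apply]
  rfl

/-- The ordered product of the basis vectors in a list. -/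
noncomputable def listProd (l : List I) : UniversalEnvelopingAlgebra k L :=
  (l.map fun i => UniversalEnvelopingAlgebra.ι k (b i)).prod

/-- The symmetrisation-like map sending a monomial to the corresponding ordered product. -/
noncomputable def ordered : (Multiset I →₀ k) →ₗ[k] UniversalEnvelopingAlgebra k L :=
  Finsupp.linearCombination k fun m => listProd b (m.sort (· ≤ ·))

lemma ordered_mono (m : Multiset I) : ordered b (mono k m) = listProd b (m.sort (· ≤ ·)) := by
  simp [ordered]

lemma ordered_mono_cons {i : I} {m : Multiset I} (h : ∀ j ∈ m, i ≤ j) :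
    ordered b (mono k (i ::ₘ m)) = UniversalEnvelopingAlgebra.ι k (b i) * ordered b (mono k m) := by
  rw [ordered_mono, ordered_mono, sort_cons h, listProd, listProd, List.map_cons, List.prod_cons]

lemma ordered_act_of_basis {q : Multiset I →₀ k} (h : ∀ i, ordered b (act b (b i) q) =
    UniversalEnvelopingAlgebra.ι k (b i) * ordered b q) (x : L) :
    ordered b (act b x q) = UniversalEnvelopingAlgebra.ι k x * ordered b q := by
  induction x using basis_induction b with
  | h0 => simp
  | hadd x y hx hy => simp only [map_add, LinearMap.add_apply, hx, hy, add_mul]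
  | hsmul c x hx => simp only [map_smul, LinearMap.smul_apply, hx, smul_mul_assoc]
  | hb i => exact h i

lemma ordered_act_mono (n : ℕ) : ∀ (m : Multiset I), m.card = n → ∀ i : I,
    ordered b (act b (b i) (mono k m)) =
      UniversalEnvelopingAlgebra.ι k (b i) * ordered b (mono k m) := by
  induction n using Nat.strong_induction_on with
  | _ n ih =>
    intro m hm i
    by_cases h : ∀ j ∈ m, i ≤ j
    · rw [act_of_le b h, ordered_mono_cons b h]
    · obtain ⟨j, m, rfl, hij, hj⟩ := exists_min_cons h
      have hm' : m.card < n := by rw [← hm]; simp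
      have ihq : ∀ q ∈ Finsupp.supported k k {m : Multiset I | m.card < n},
          ordered b (act b (b j) q) = UniversalEnvelopingAlgebra.ι k (b j) * ordered b q := by
        intro q hq
        have := map_mem_of_supported (N := ⊥)
          ((ordered b) ∘ₗ (act b (b j)) -
            (LinearMap.mulLeft k (UniversalEnvelopingAlgebra.ι k (b j))) ∘ₗ ordered b)
          (fun m hm => by simpa [sub_eq_zero] using ih _ hm m rfl j) hq
        simpa [sub_eq_zero] using this
      have hji : ∀ a ∈ i ::ₘ m, j ≤ a := by
        intro a ha
        rcases Multiset.mem_cons.1 ha with rfl | ha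
        exacts [hij.le, hj a ha]
      have h1 := ihq _ (supported_card_mono (act_sub_mem_card b i m) hm')
      rw [map_sub, map_sub, map_sub, act_of_le b hji, ordered_mono_cons b hji, mul_sub, sub_left_inj,
        ih _ hm' m rfl i] at h1
      rw [act_of_lt b hij hj, map_add, h1, ordered_act_of_basis b (ih _ hm' m rfl),
        ordered_mono_cons b hj, LieHom.map_lie, LieRing.of_associative_ring_bracket]
      noncomm_ring

lemma ordered_act (x : L) (q : Multiset I →₀ k) :
    ordered b (act b x q) = UniversalEnvelopingAlgebra.ι k x * ordered b q := by
  induction q using Finsupp.induction_linear with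
  | zero => simp
  | add q q' h h' => simp only [map_add, h, h', mul_add]
  | single m c =>
    rw [← mul_one c, ← smul_eq_mul, ← Finsupp.smul_single, map_smul, map_smul, map_smul,
      ordered_act_of_basis b (ordered_act_mono b _ m rfl), mul_smul_comm]

lemma ι_induction {p : UniversalEnvelopingAlgebra k L → Prop} (hc : ∀ c, p (algebraMap k _ c))
    (hι : ∀ x, p (UniversalEnvelopingAlgebra.ι k x)) (hmul : ∀ x y, p x → p y → p (x * y))
    (hadd : ∀ x y, p x → p y → p (x + y)) (x) : p x := by
  let S : Subalgebra k (UniversalEnvelopingAlgebra k L) :=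
    { carrier := {x | p x}
      mul_mem' := fun h h' => hmul _ _ h h'
      add_mem' := fun h h' => hadd _ _ h h'
      algebraMap_mem' := hc }
  let φ : UniversalEnvelopingAlgebra k L →ₐ[k] S := UniversalEnvelopingAlgebra.lift k
    { toFun x := ⟨UniversalEnvelopingAlgebra.ι k x, hι x⟩
      map_add' x y := by ext; simp
      map_smul' c x := by ext; simp
      map_lie' := by intro x y; ext; simp [LieRing.of_associative_ring_bracket] }
  have : S.val.comp φ = AlgHom.id k _ := by
    ext x
    simp [φ]
  have h := DFunLike.congr_fun this x
  rw [AlgHom.comp_apply, AlgHom.id_apply] at h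
  rw [← h]
  exact (φ x).2

lemma ordered_rep (a : UniversalEnvelopingAlgebra k L) :
    ∀ q : Multiset I →₀ k, ordered b (rep b a q) = a * ordered b q := by
  induction a using ι_induction with
  | hc c => intro q; simp [Algebra.smul_def]
  | hι x => intro q; rw [rep_ι, ordered_act]
  | hmul x y hx hy => intro q; rw [map_mul, Module.End.mul_apply, hx, hy, mul_assoc]
  | hadd x y hx hy => intro q; rw [map_add, LinearMap.add_apply, map_add, hx, hy, add_mul]

/-- The polynomial attached to an element of the enveloping algebra. -/
noncomputable def poly : UniversalEnvelopingAlgebra k L →ₗ[k] (Multiset I →₀ k) :=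
  (LinearMap.applyₗ (mono k 0)) ∘ₗ (rep b).toLinearMap

lemma poly_apply (a : UniversalEnvelopingAlgebra k L) : poly b a = rep b a (mono k 0) := rfl

lemma ordered_poly (a : UniversalEnvelopingAlgebra k L) : ordered b (poly b a) = a := by
  rw [poly_apply, ordered_rep, ordered_mono]
  simp [listProd]

lemma poly_ι (i : I) : poly b (UniversalEnvelopingAlgebra.ι k (b i)) = mono k {i} := by
  rw [poly_apply, rep_ι, act_of_le b (by simp)]
  rfl

end PBW

namespace PBW
set_option linter.unusedSectionVars false
variable {k L I : Type*} [Field k] [LieRing L] [LieAlgebra k L] [LinearOrder I]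
variable (b : Module.Basis I k L)

section Filtered

variable {Γ : Type*} [AddCommMonoid Γ] [LinearOrder Γ] [IsOrderedCancelAddMonoid Γ]
variable (D : Multiset I →+ Γ)

lemma mono_mem_below {m : Multiset I} {g : Γ} (h : D m < g) : mono k m ∈ below k D g :=
  Finsupp.single_mem_supported k _ h

lemma below_mono {g g' : Γ} (h : g ≤ g') : below k D g ≤ below k D g' :=
  Finsupp.supported_mono fun _ (hm : _ < _) => lt_of_lt_of_le hm h

lemma map_cons (i : I) (m : Multiset I) : D (i ::ₘ m) = D {i} + D m := by
  rw [← Multiset.singleton_add, map_add]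

lemma act_mem_below (hD : ∀ i j l, D {l} < D {i} + D {j}) {q : Multiset I →₀ k} {g : Γ} (i : I)
    (hq : q ∈ below k D g) : act b (b i) q ∈ below k D (D {i} + g) := by
  refine map_mem_of_supported _ ?_ hq
  intro m (hm : D m < g)
  have h : D (i ::ₘ m) < D {i} + g := by rw [map_cons]; gcongr
  rw [← sub_add_cancel (act b (b i) (mono k m)) (mono k (i ::ₘ m))]
  exact Submodule.add_mem _ (below_mono D h.le (act_sub_mem_below b D hD i m)) (mono_mem_below D h)

lemma rep_listProd_sub_mem (hD : ∀ i j l, D {l} < D {i} + D {j}) (l : List I) (m : Multiset I) :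
    rep b (listProd b l) (mono k m) - mono k ((l : Multiset I) + m) ∈
      below k D (D ((l : Multiset I) + m)) := by
  induction l with
  | nil => simp [listProd]
  | cons i l ih =>
    have h1 : listProd b (i :: l) = UniversalEnvelopingAlgebra.ι k (b i) * listProd b l := rfl
    have h2 : ((i :: l : List I) : Multiset I) + m = i ::ₘ (l + m) := by
      rw [← Multiset.cons_coe, Multiset.cons_add]
    rw [h1, h2, map_mul, Module.End.mul_apply, rep_ι,
      ← sub_add_sub_cancel _ (act b (b i) (mono k (l + m))), ← map_sub]
    refine Submodule.add_mem _ ?_ (act_sub_mem_below b D hD i _)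
    rw [map_cons]
    exact act_mem_below b D hD i ih

/-- The monomial `m` is the leading monomial of `q`, with nonzero coefficient `c`. -/
def IsLead (q : Multiset I →₀ k) (m : Multiset I) (c : k) : Prop :=
  c ≠ 0 ∧ q - Finsupp.single m c ∈ below k D (D m)

variable {D} in
lemma IsLead.apply_eq {q : Multiset I →₀ k} {m : Multiset I} {c : k} (h : IsLead D q m c) :
    q m = c := by
  have := (Finsupp.mem_supported' k _).1 h.2 m (by simp)
  simpa [sub_eq_zero] using this

lemma exists_isLead (hinj : Function.Injective D) {q : Multiset I →₀ k} (hq : q ≠ 0) :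
    ∃ m c, IsLead D q m c := by
  obtain ⟨m, hm, hmax⟩ := q.support.exists_max_image D (Finsupp.support_nonempty_iff.2 hq)
  refine ⟨m, q m, Finsupp.mem_support_iff.1 hm, (Finsupp.mem_supported' k _).2 ?_⟩
  intro n hn
  by_cases hnm : n = m
  · subst hnm; simp
  · rw [Finsupp.sub_apply, Finsupp.single_eq_of_ne hnm, sub_zero]
    by_contra hqn
    exact hn (lt_of_le_of_ne (hmax n (Finsupp.mem_support_iff.2 hqn)) (hinj.ne hnm))

lemma IsLead.rep_mono (hD : ∀ i j l, D {l} < D {i} + D {j}) {q : Multiset I →₀ k}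
    {m : Multiset I} {c : k} (h : IsLead D q m c) (n : Multiset I) :
    rep b (ordered b q) (mono k n) - Finsupp.single (m + n) c ∈ below k D (D (m + n)) := by
  have key : ∀ m : Multiset I,
      rep b (ordered b (mono k m)) (mono k n) - mono k (m + n) ∈ below k D (D (m + n)) := by
    intro m
    have := rep_listProd_sub_mem b D hD (m.sort (· ≤ ·)) n
    rwa [Multiset.sort_eq, ← ordered_mono] at this
  have h1 : rep b (ordered b (q - Finsupp.single m c)) (mono k n) ∈ below k D (D (m + n)) := by
    refine map_mem_of_supported ((LinearMap.applyₗ (mono k n)) ∘ₗ (rep b).toLinearMap ∘ₗ ordered b)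
      ?_ h.2
    intro m' (hm' : D m' < D m)
    have h3 : D (m' + n) < D (m + n) := by rw [map_add, map_add]; gcongr
    change rep b (ordered b (mono k m')) (mono k n) ∈ _
    rw [← sub_add_cancel (rep b _ _) (mono k (m' + n))]
    exact Submodule.add_mem _ (below_mono D h3.le (key m')) (mono_mem_below D h3)
  have h2 := Submodule.smul_mem _ c (key m)
  rw [smul_sub, ← LinearMap.smul_apply, ← map_smul, ← map_smul] at h2
  simp only [Finsupp.smul_single, smul_eq_mul, mul_one] at h2
  rw [map_sub, map_sub, LinearMap.sub_apply] at h1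
  have := Submodule.add_mem _ h1 h2
  rwa [sub_add_sub_cancel] at this

lemma IsLead.rep (hD : ∀ i j l, D {l} < D {i} + D {j}) {q q' : Multiset I →₀ k}
    {m m' : Multiset I} {c c' : k} (h : IsLead D q m c) (h' : IsLead D q' m' c') :
    IsLead D (rep b (ordered b q) q') (m + m') (c * c') := by
  refine ⟨mul_ne_zero h.1 h'.1, ?_⟩
  have h1 : PBW.rep b (ordered b q) (q' - Finsupp.single m' c') ∈ below k D (D (m + m')) := by
    refine map_mem_of_supported (PBW.rep b (ordered b q)) ?_ h'.2
    intro n (hn : D n < D m')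
    have h3 : D (m + n) < D (m + m') := by rw [map_add, map_add]; gcongr
    rw [← sub_add_cancel (PBW.rep b _ _) (Finsupp.single (m + n) c)]
    exact Submodule.add_mem _ (below_mono D h3.le (h.rep_mono b D hD n))
      (Finsupp.single_mem_supported k _ h3)
  have h2 := Submodule.smul_mem _ c' (h.rep_mono b D hD m')
  rw [smul_sub, ← map_smul] at h2
  simp only [Finsupp.smul_single, smul_eq_mul, mul_one] at h2
  rw [mul_comm c' c] at h2
  rw [map_sub] at h1
  have := Submodule.add_mem _ h1 h2
  rwa [sub_add_sub_cancel] at this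

lemma IsLead.poly_mul (hD : ∀ i j l, D {l} < D {i} + D {j}) {a a' : UniversalEnvelopingAlgebra k L}
    {m m' : Multiset I} {c c' : k} (h : IsLead D (poly b a) m c) (h' : IsLead D (poly b a') m' c') :
    IsLead D (poly b (a * a')) (m + m') (c * c') := by
  have := h.rep b D hD h'
  rwa [ordered_poly, poly_apply b a', ← Module.End.mul_apply, ← map_mul] at this

end Filtered

lemma poly_injective : Function.Injective (poly b) :=
  Function.LeftInverse.injective (ordered_poly b)

variable (wt : I → ℕ)

/-- The total weight of a monomial. -/
def weight (m : Multiset I) : ℕ := (m.map wt).sum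

lemma weight_add (m n : Multiset I) : weight wt (m + n) = weight wt m + weight wt n := by
  simp [weight]

/-- An injective degree function refining the weight. -/
noncomputable def deg : Multiset I →+ ℕ ×ₗ ℕ ×ₗ Lex (I →₀ ℕ) where
  toFun m := toLex (weight wt m, toLex (m.card, toLex (Multiset.toFinsupp m)))
  map_zero' := by simp [weight]
  map_add' m n := by simp [weight]; rfl

lemma deg_injective : Function.Injective (deg wt : Multiset I → _) := by
  intro m n h
  have := congrArg (fun x => (ofLex (ofLex (ofLex x).2).2)) h
  exact Multiset.toFinsupp.injective this

lemma weight_le_of_deg_le {m n : Multiset I} (h : deg wt m ≤ deg wt n) :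
    weight wt m ≤ weight wt n := by
  rcases Prod.Lex.le_iff.1 h with h | h
  · exact h.le
  · exact h.1.le

lemma deg_singleton_lt (h1 : ∀ i, 1 ≤ wt i) (h2 : ∀ i, wt i ≤ 2) (i j l : I) :
    deg wt {l} < deg wt {i} + deg wt {j} := by
  rw [← map_add]
  have hw : weight wt {l} ≤ weight wt ({i} + {j}) := by
    have := h1 i; have := h1 j; have := h2 l
    simp [weight]; omega
  rcases hw.lt_or_eq with hw | hw
  · exact Prod.Lex.lt_iff.2 (Or.inl hw)
  · refine Prod.Lex.lt_iff.2 (Or.inr ⟨hw, Prod.Lex.lt_iff.2 (Or.inl ?_)⟩)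
    change Multiset.card {l} < Multiset.card ({i} + {j})
    simp

/-- The largest weight of a monomial of an element, written multiplicatively. -/
noncomputable def weightVal (a : UniversalEnvelopingAlgebra k L) : WithZero (Multiplicative ℤ) :=
  (poly b a).support.sup fun m => WithZero.exp (weight wt m : ℤ)

lemma weightVal_eq {a : UniversalEnvelopingAlgebra k L} {m : Multiset I} {c : k}
    (h : IsLead (deg wt) (poly b a) m c) :
    weightVal b wt a = WithZero.exp (weight wt m : ℤ) := by
  apply le_antisymm
  · refine Finset.sup_le fun n hn => ?_
    rw [WithZero.exp_le_exp, Nat.cast_le]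
    by_cases hnm : n = m
    · rw [hnm]
    · apply weight_le_of_deg_le
      by_contra hlt
      have := (Finsupp.mem_supported' k _).1 h.2 n (fun h' => hlt (le_of_lt h'))
      rw [Finsupp.sub_apply, Finsupp.single_eq_of_ne hnm, sub_zero] at this
      exact Finsupp.mem_support_iff.1 hn this
  · refine Finset.le_sup (f := fun m => WithZero.exp (weight wt m : ℤ)) ?_
    rw [Finsupp.mem_support_iff, h.apply_eq]
    exact h.1

lemma weightVal_zero : weightVal b wt (0 : UniversalEnvelopingAlgebra k L) = 0 := by
  simp [weightVal]

lemma weightVal_add (x y : UniversalEnvelopingAlgebra k L) :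
    weightVal b wt (x + y) ≤ max (weightVal b wt x) (weightVal b wt y) := by
  classical
  rw [weightVal, weightVal, weightVal, map_add, ← Finset.sup_union]
  exact Finset.sup_mono Finsupp.support_add

lemma isLead_poly_algebraMap {c : k} (hc : c ≠ 0) :
    IsLead (deg wt) (poly b (algebraMap k _ c)) 0 c := by
  refine ⟨hc, ?_⟩
  rw [poly_apply, AlgHom.commutes, Module.algebraMap_end_apply, Finsupp.smul_single, smul_eq_mul,
    mul_one, sub_self]
  exact Submodule.zero_mem _

/-- The weight filtration valuation on the enveloping algebra. -/
noncomputable def weightValuation (h1 : ∀ i, 1 ≤ wt i) (h2 : ∀ i, wt i ≤ 2) :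
    Valuation (UniversalEnvelopingAlgebra k L) (WithZero (Multiplicative ℤ)) where
  toFun := weightVal b wt
  map_zero' := weightVal_zero b wt
  map_one' := by
    have := isLead_poly_algebraMap b wt (one_ne_zero (α := k))
    rw [map_one] at this
    rw [weightVal_eq b wt this]
    simp [weight]
  map_mul' x y := by
    by_cases hx : x = 0
    · simp [hx, weightVal_zero]
    by_cases hy : y = 0
    · simp [hy, weightVal_zero]
    have hp : ∀ {z}, z ≠ 0 → poly b z ≠ 0 := fun hz h => hz (poly_injective b (by simpa using h))
    obtain ⟨m, c, hm⟩ := exists_isLead _ (deg_injective wt) (hp hx)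
    obtain ⟨n, d, hn⟩ := exists_isLead _ (deg_injective wt) (hp hy)
    rw [weightVal_eq b wt hm, weightVal_eq b wt hn,
      weightVal_eq b wt (hm.poly_mul b _ (deg_singleton_lt wt h1 h2) hn), weight_add,
      ← WithZero.exp_add, Nat.cast_add]
  map_add_le_max' x y := weightVal_add b wt x y

section

variable {wt} (h1 : ∀ i, 1 ≤ wt i) (h2 : ∀ i, wt i ≤ 2)

lemma weightValuation_algebraMap {c : k} (hc : c ≠ 0) :
    weightValuation b wt h1 h2 (algebraMap k _ c) = 1 := by
  change weightVal b wt _ = _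
  rw [weightVal_eq b wt (isLead_poly_algebraMap b wt hc)]
  simp [weight]

lemma weightValuation_ι_basis (i : I) :
    weightValuation b wt h1 h2 (UniversalEnvelopingAlgebra.ι k (b i)) =
      WithZero.exp (wt i : ℤ) := by
  change weightVal b wt _ = _
  rw [weightVal, poly_ι, Finsupp.support_single _ one_ne_zero]
  simp [weight]

lemma weightValuation_ι_le (x : L) :
    weightValuation b wt h1 h2 (UniversalEnvelopingAlgebra.ι k x) ≤ WithZero.exp 2 := by
  induction x using basis_induction b with
  | h0 => simp
  | hadd x y hx hy =>
    rw [map_add]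
    exact (Valuation.map_add _ _ _).trans (max_le hx hy)
  | hsmul c x hx =>
    by_cases hc : c = 0
    · simp [hc]
    rw [map_smul, Algebra.smul_def, map_mul, weightValuation_algebraMap b h1 h2 hc, one_mul]
    exact hx
  | hb i =>
    rw [weightValuation_ι_basis, WithZero.exp_le_exp]
    exact_mod_cast h2 i

lemma eq_zero_of_weightValuation_eq_zero {a : UniversalEnvelopingAlgebra k L}
    (h : weightValuation b wt h1 h2 a = 0) : a = 0 := by
  by_contra ha
  obtain ⟨m, c, hm⟩ := exists_isLead _ (deg_injective wt)
    (show poly b a ≠ 0 from fun h => ha (poly_injective b (by simpa using h)))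
  have := weightVal_eq b wt hm
  change weightVal b wt a = 0 at h
  rw [h] at this
  exact WithZero.exp_ne_zero this.symm

end

end PBW

namespace PBW

variable {k L : Type*} [Field k] [LieRing L] [LieAlgebra k L]

lemma lie_mem_span_pair {u v : L} (h : ⁅v, u⁆ ∈ Submodule.span k {u, v}) {x y : L}
    (hx : x ∈ Submodule.span k {u, v}) (hy : y ∈ Submodule.span k {u, v}) :
    ⁅x, y⁆ ∈ Submodule.span k {u, v} := by
  obtain ⟨a, b, rfl⟩ := Submodule.mem_span_pair.1 hx
  obtain ⟨c, d, rfl⟩ := Submodule.mem_span_pair.1 hy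
  have : ⁅a • u + b • v, c • u + d • v⁆ = (b * c - a * d) • ⁅v, u⁆ := by
    simp only [add_lie, lie_add, smul_lie, lie_smul, lie_self, smul_zero, add_zero, zero_add,
      ← lie_skew v u]
    module
  rw [this]
  exact Submodule.smul_mem _ _ h

lemma lie_notMem_span_pair {u v : L}
    (hdim : 3 ≤ Module.rank k (LieSubalgebra.lieSpan k L {u, v})) :
    ⁅v, u⁆ ∉ Submodule.span k {u, v} := by
  intro h
  let M : LieSubalgebra k L :=
    { Submodule.span k {u, v} with lie_mem' := fun hx hy => lie_mem_span_pair h hx hy }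
  have hle : LieSubalgebra.lieSpan k L {u, v} ≤ M := by
    rw [LieSubalgebra.lieSpan_le]
    exact Submodule.subset_span
  have h1 : Module.rank k (LieSubalgebra.lieSpan k L {u, v}) ≤
      Module.rank k (Submodule.span k ({u, v} : Set L)) :=
    Submodule.rank_mono (s := (LieSubalgebra.lieSpan k L {u, v}).toSubmodule) hle
  have h2 : Module.rank k (Submodule.span k ({u, v} : Set L)) ≤ 2 := by
    refine (rank_span_le _).trans (Cardinal.mk_insert_le.trans ?_)
    rw [Cardinal.mk_singleton, one_add_one_eq_two]
  have h3 := hdim.trans (h1.trans h2)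
  have : (3 : ℕ) ≤ 2 := by exact_mod_cast h3
  omega

lemma linearIndependent_lie {u v : L}
    (hdim : 3 ≤ Module.rank k (LieSubalgebra.lieSpan k L {u, v})) :
    LinearIndependent k ![⁅v, u⁆, u, v] := by
  have h := lie_notMem_span_pair hdim
  have h0 : ⁅v, u⁆ ≠ 0 := fun h0 => h (h0 ▸ Submodule.zero_mem _)
  refine linearIndependent_finCons.2 ⟨LinearIndependent.pair_iff.2 fun s t hst => ?_, ?_⟩
  · have h1 : s • ⁅v, u⁆ = 0 := by
      have : ⁅v, s • u + t • v⁆ = 0 := by rw [hst, lie_zero]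
      simpa using this
    have h2 : t • ⁅v, u⁆ = 0 := by
      have : ⁅s • u + t • v, u⁆ = 0 := by rw [hst, zero_lie]
      simpa using this
    exact ⟨(smul_eq_zero.1 h1).resolve_right h0, (smul_eq_zero.1 h2).resolve_right h0⟩
  · simpa [Set.pair_comm] using h

open WithZero in
lemma exists_valuation {u v : L}
    (hdim : 3 ≤ Module.rank k (LieSubalgebra.lieSpan k L {u, v})) :
    ∃ val : Valuation (UniversalEnvelopingAlgebra k L) (WithZero (Multiplicative ℤ)),
      (∀ a, val a = 0 → a = 0) ∧ (∀ c : k, c ≠ 0 → val (algebraMap k _ c) = 1) ∧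
      val (UniversalEnvelopingAlgebra.ι k u) = exp 1 ∧
      val (UniversalEnvelopingAlgebra.ι k v) = exp 1 ∧
      val (UniversalEnvelopingAlgebra.ι k ⁅v, u⁆) = exp 2 ∧
      ∀ x : L, val (UniversalEnvelopingAlgebra.ι k x) ≤ exp 2 := by
  classical
  have hli := linearIndependent_lie hdim
  have hs := hli.linearIndepOn_id
  let b := Module.Basis.extend hs
  have hb : ∀ i : Fin 3, ∃ j, b j = ![⁅v, u⁆, u, v] i ∧ (j : L) = ![⁅v, u⁆, u, v] i := fun i =>
    ⟨⟨_, hs.subset_extend _ (Set.mem_range_self i)⟩, Module.Basis.extend_apply_self hs _, rfl⟩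
  let : LinearOrder (hs.extend (Set.subset_univ _)) := linearOrderOfSTO WellOrderingRel
  let wt : hs.extend (Set.subset_univ _) → ℕ := fun x => if (x : L) = u ∨ (x : L) = v then 1 else 2
  have h1 : ∀ i, 1 ≤ wt i := fun i => by simp only [wt]; split_ifs <;> omega
  have h2 : ∀ i, wt i ≤ 2 := fun i => by simp only [wt]; split_ifs <;> omega
  obtain ⟨jw, hjw, hjw'⟩ := hb 0
  obtain ⟨ju, hju, hju'⟩ := hb 1
  obtain ⟨jv, hjv, hjv'⟩ := hb 2
  simp only [Matrix.cons_val] at hjw hju hjv hjw' hju' hjv'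
  have hwu : ⁅v, u⁆ ≠ u := hli.injective.ne (show (0 : Fin 3) ≠ 1 by decide)
  have hwv : ⁅v, u⁆ ≠ v := hli.injective.ne (show (0 : Fin 3) ≠ 2 by decide)
  have key : ∀ j x, b j = x →
      weightValuation b wt h1 h2 (UniversalEnvelopingAlgebra.ι k x) = exp (wt j : ℤ) := by
    rintro j _ rfl
    exact weightValuation_ι_basis b h1 h2 j
  refine ⟨weightValuation b wt h1 h2, fun a => eq_zero_of_weightValuation_eq_zero b h1 h2,
    fun c => weightValuation_algebraMap b h1 h2, ?_, ?_, ?_, weightValuation_ι_le b h1 h2⟩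
  · rw [key _ _ hju]; simp [wt, hju']
  · rw [key _ _ hjv]; simp [wt, hjv']
  · rw [key _ _ hjw]; simp [wt, hjw', hwu, hwv]

end PBW

namespace OreValuation

section Extension

variable {R D Γ₀ : Type*} [Ring R] [DivisionRing D] [LinearOrderedCommGroupWithZero Γ₀]
variable {f : R →+* D} {val : Valuation R Γ₀}

lemma fraction_unique (hf : Function.Injective f)
    (hore : ∀ a s : R, s ≠ 0 → ∃ t r : R, t ≠ 0 ∧ t * a = r * s)
    (hval : ∀ a, val a = 0 → a = 0) {s r s' r' : R} (hs : s ≠ 0) (hs' : s' ≠ 0)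
    (h : (f s)⁻¹ * f r = (f s')⁻¹ * f r') : (val s)⁻¹ * val r = (val s')⁻¹ * val r' := by
  obtain ⟨t, q, ht, htq⟩ := hore s' s hs
  have hfs : f s ≠ 0 := (map_ne_zero_iff f hf).2 hs
  have hfs' : f s' ≠ 0 := (map_ne_zero_iff f hf).2 hs'
  have h1 : q * r = t * r' := by
    apply hf
    have h2 : f (q * s) * ((f s)⁻¹ * f r) = f (q * r) := by
      rw [map_mul, map_mul, mul_assoc, mul_inv_cancel_left₀ hfs]
    have h3 : f (t * s') * ((f s')⁻¹ * f r') = f (t * r') := by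
      rw [map_mul, map_mul, mul_assoc, mul_inv_cancel_left₀ hfs']
    rw [← h2, ← h3, h, htq]
  have e1 : val t * val s' = val q * val s := by rw [← map_mul, ← map_mul, htq]
  have e2 : val q * val r = val t * val r' := by rw [← map_mul, ← map_mul, h1]
  have hvs : val s ≠ 0 := fun h => hs (hval _ h)
  have hvs' : val s' ≠ 0 := fun h => hs' (hval _ h)
  have hvt : val t ≠ 0 := fun h => ht (hval _ h)
  have hvq : val q ≠ 0 := by
    intro hq
    rw [hq, zero_mul] at e1
    exact mul_ne_zero hvt hvs' e1
  rw [inv_mul_eq_iff_eq_mul₀ hvs, mul_left_comm, eq_comm, inv_mul_eq_iff_eq_mul₀ hvs']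
  apply mul_left_cancel₀ (mul_ne_zero hvt hvq)
  calc val t * val q * (val s * val r') = (val q * val s) * (val t * val r') := by
        simp only [mul_comm, mul_left_comm]
    _ = val t * val q * (val s' * val r) := by
      rw [← e1, ← e2]; simp only [mul_comm, mul_left_comm]

/-- A valuation on an Ore domain extends to its division ring of fractions. -/
lemma exists_extension (hf : Function.Injective f)
    (hgen : ∀ d : D, ∃ r s : R, s ≠ 0 ∧ d = (f s)⁻¹ * f r)
    (hore : ∀ a s : R, s ≠ 0 → ∃ t r : R, t ≠ 0 ∧ t * a = r * s)
    (hval : ∀ a, val a = 0 → a = 0) : ∃ vD : Valuation D Γ₀, ∀ a, vD (f a) = val a := by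
  choose num den hden heq using hgen
  let φ : D → Γ₀ := fun d => (val (den d))⁻¹ * val (num d)
  have key : ∀ s r : R, s ≠ 0 → φ ((f s)⁻¹ * f r) = (val s)⁻¹ * val r := fun s r hs =>
    fraction_unique hf hore hval (hden _) hs (heq _).symm
  have keyf : ∀ a, φ (f a) = val a := by
    intro a
    have : Nontrivial R := ⟨den 0, 0, hden 0⟩
    have := key 1 a one_ne_zero
    simpa using this
  have hne : ∀ {a}, a ≠ 0 → f a ≠ 0 := fun h => (map_ne_zero_iff f hf).2 h
  have hvne : ∀ {a}, a ≠ 0 → val a ≠ 0 := fun h h' => h (hval _ h')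
  have hmul : ∀ {a b : R}, a ≠ 0 → b ≠ 0 → a * b ≠ 0 := by
    intro a b ha hb hab
    have := mul_ne_zero (hne ha) (hne hb)
    rw [← map_mul, hab, map_zero] at this
    exact this rfl
  refine ⟨{ toFun := φ, map_zero' := ?_, map_one' := ?_, map_mul' := ?_, map_add_le_max' := ?_ },
    keyf⟩
  · simpa using keyf 0
  · simpa using keyf 1
  · intro x y
    obtain ⟨r, s, hs, rfl⟩ : ∃ r s : R, s ≠ 0 ∧ x = (f s)⁻¹ * f r := ⟨_, _, hden x, heq x⟩
    obtain ⟨r', s', hs', rfl⟩ : ∃ r s : R, s ≠ 0 ∧ y = (f s)⁻¹ * f r := ⟨_, _, hden y, heq y⟩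
    obtain ⟨t, q, ht, htq⟩ := hore r s' hs'
    have h1 : (f s)⁻¹ * f r * ((f s')⁻¹ * f r') = (f (t * s))⁻¹ * f (q * r') := by
      have h2 : f r * (f s')⁻¹ = (f t)⁻¹ * f q := by
        rw [eq_inv_mul_iff_mul_eq₀ (hne ht), ← mul_assoc, ← map_mul, htq, map_mul,
          mul_inv_cancel_right₀ (hne hs')]
      rw [map_mul, map_mul, mul_inv_rev, mul_assoc, ← mul_assoc (f r), h2]
      simp only [mul_assoc]
    rw [h1, key _ _ (hmul ht hs), key _ _ hs, key _ _ hs', map_mul, map_mul]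
    have e1 : val t * val r = val q * val s' := by rw [← map_mul, ← map_mul, htq]
    have e2 : val q = val t * val r * (val s')⁻¹ := by
      rw [e1, mul_inv_cancel_right₀ (hvne hs')]
    have ht' := hvne ht
    rw [e2, mul_inv]
    have : (val t)⁻¹ * val t = 1 := inv_mul_cancel₀ ht'
    calc (val t)⁻¹ * (val s)⁻¹ * (val t * val r * (val s')⁻¹ * val r')
        = ((val t)⁻¹ * val t) * ((val s)⁻¹ * val r * ((val s')⁻¹ * val r')) := by
          ac_rfl
      _ = _ := by rw [this, one_mul]
  · intro x y
    obtain ⟨r, s, hs, rfl⟩ : ∃ r s : R, s ≠ 0 ∧ x = (f s)⁻¹ * f r := ⟨_, _, hden x, heq x⟩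
    obtain ⟨r', s', hs', rfl⟩ : ∃ r s : R, s ≠ 0 ∧ y = (f s)⁻¹ * f r := ⟨_, _, hden y, heq y⟩
    obtain ⟨t, q, ht, htq⟩ := hore s' s hs
    have hq : q ≠ 0 := by
      rintro rfl
      rw [zero_mul] at htq
      exact hmul ht hs' htq
    have h1 : (f s)⁻¹ * f r = (f (q * s))⁻¹ * f (q * r) := by
      rw [map_mul, map_mul, mul_inv_rev, mul_assoc, inv_mul_cancel_left₀ (hne hq)]
    have h2 : (f s')⁻¹ * f r' = (f (q * s))⁻¹ * f (t * r') := by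
      rw [← htq, map_mul, map_mul, mul_inv_rev, mul_assoc, inv_mul_cancel_left₀ (hne ht)]
    have hqs := hmul hq hs
    rw [h1, h2, ← mul_add, ← map_add, key _ _ hqs, key _ _ hqs, key _ _ hqs]
    rcases le_max_iff.1 (val.map_add (q * r) (t * r')) with h | h
    · exact le_max_of_le_left (mul_le_mul_right h _)
    · exact le_max_of_le_right (mul_le_mul_right h _)

end Extension

section Residue

variable {k : Type*} {D : Type*} {Γ₀ : Type*} [Field k] [DivisionRing D] [Algebra k D]
  [LinearOrderedCommGroupWithZero Γ₀] (v : Valuation D Γ₀)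
  (hk : ∀ c : k, c ≠ 0 → v (algebraMap k D c) = 1)

/-- The valuation ring of a valuation which is trivial on the base field, as a subalgebra. -/
def valuationSubalgebra : Subalgebra k D where
  carrier := {x | v x ≤ 1}
  mul_mem' {x y} hx hy := by
    simp only [Set.mem_ofPred_eq, map_mul] at *
    exact mul_le_one' hx hy
  add_mem' {x y} hx hy := (v.map_add x y).trans (max_le hx hy)
  algebraMap_mem' c := by
    by_cases hc : c = 0
    · simp [hc]
    · exact (hk c hc).le

lemma mem_valuationSubalgebra {x : D} : x ∈ valuationSubalgebra v hk ↔ v x ≤ 1 := Iff.rfl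

/-- The maximal ideal of the valuation ring. -/
def maxIdeal : Ideal (valuationSubalgebra v hk) where
  carrier := {x | v (x : D) < 1}
  add_mem' {x y} hx hy := (v.map_add x y).trans_lt (max_lt hx hy)
  zero_mem' := by simp
  smul_mem' c x hx := by
    simp only [Set.mem_ofPred_eq, smul_eq_mul, MulMemClass.coe_mul, map_mul] at *
    exact (mul_le_of_le_one_left' c.2).trans_lt hx

lemma mem_maxIdeal {x : valuationSubalgebra v hk} : x ∈ maxIdeal v hk ↔ v (x : D) < 1 := Iff.rfl

instance : (maxIdeal v hk).IsTwoSided where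
  mul_mem_of_left {x} c hx := by
    rw [mem_maxIdeal] at *
    rw [MulMemClass.coe_mul, map_mul]
    exact (mul_le_of_le_one_right' c.2).trans_lt hx

/-- The residue ring of the valuation. -/
abbrev Residue : Type _ := valuationSubalgebra v hk ⧸ maxIdeal v hk

instance : Nontrivial (Residue v hk) := by
  refine Ideal.Quotient.nontrivial_iff.2 ?_
  rw [Ideal.ne_top_iff_one, mem_maxIdeal]
  simp

lemma residue_isUnit_or_eq_zero (x : Residue v hk) : IsUnit x ∨ x = 0 := by
  obtain ⟨x, rfl⟩ := Ideal.Quotient.mk_surjective x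
  rw [or_iff_not_imp_right, Ideal.Quotient.eq_zero_iff_mem, mem_maxIdeal, not_lt]
  intro hx
  have h1 : v (x : D) = 1 := le_antisymm x.2 hx
  have h0 : (x : D) ≠ 0 := by rw [← v.ne_zero_iff, h1]; exact one_ne_zero
  let y : valuationSubalgebra v hk := ⟨(x : D)⁻¹, by rw [mem_valuationSubalgebra, map_inv₀, h1, inv_one]⟩
  have hxy : x * y = 1 := Subtype.ext (mul_inv_cancel₀ h0)
  have hyx : y * x = 1 := Subtype.ext (inv_mul_cancel₀ h0)
  exact ⟨⟨Ideal.Quotient.mk _ x, Ideal.Quotient.mk _ y, by rw [← map_mul, hxy, map_one],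
    by rw [← map_mul, hyx, map_one]⟩, rfl⟩

noncomputable instance : DivisionRing (Residue v hk) :=
  DivisionRing.ofIsUnitOrEqZero (residue_isUnit_or_eq_zero v hk)

/-- The residue map. -/
noncomputable def residueMap : valuationSubalgebra v hk →ₐ[k] Residue v hk :=
  Ideal.Quotient.mkₐ k (maxIdeal v hk)

lemma residueMap_eq_zero_iff {x : valuationSubalgebra v hk} :
    residueMap v hk x = 0 ↔ v (x : D) < 1 :=
  Ideal.Quotient.eq_zero_iff_mem

end Residue

end OreValuation

namespace ShiftAlgebra

open Polynomial

section Embedding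

variable {k E : Type*} [Field k] [DivisionRing E] [Algebra k E] {p t : E}

lemma mul_aeval (h : p * t = (t + 2) * p) (q : k[X]) :
    p * aeval t q = aeval t (taylor 2 q) * p := by
  induction q using Polynomial.induction_on' with
  | add q r hq hr => rw [map_add, map_add, map_add, mul_add, add_mul, hq, hr]
  | monomial n c =>
    have hn : p * t ^ n = (t + 2) ^ n * p := by
      have h' : SemiconjBy p t (t + 2) := h
      exact h'.pow_right n
    rw [aeval_monomial, taylor_monomial, map_mul, aeval_C, map_pow, map_add, aeval_X, aeval_C,
      map_ofNat, mul_assoc, ← hn, ← mul_assoc, ← mul_assoc, Algebra.commutes]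

lemma taylor_eq_self [CharZero k] {q : k[X]} (h : taylor 2 q = q) : q = C (q.eval 0) := by
  have h1 : ∀ n : ℕ, q.eval (2 * (n : k)) = q.eval 0 := by
    intro n
    induction n with
    | zero => simp
    | succ n ih => rw [Nat.cast_succ, mul_add, mul_one, ← taylor_eval, h, ih]
  refine eq_of_infinite_eval_eq _ _ (Set.Infinite.mono (s := Set.range fun n : ℕ => 2 * (n : k)) ?_
    (Set.infinite_range_of_injective ?_))
  · rintro _ ⟨n, rfl⟩
    simp [h1]
  · intro m n hmn
    simpa using hmn

lemma aeval_ne_zero [CharZero k] (hp : p ≠ 0) (h : p * t = (t + 2) * p) {q : k[X]} (hq : q ≠ 0) :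
    aeval t q ≠ 0 := by
  induction hd : q.degree using WellFoundedLT.induction generalizing q with
  | _ d ih =>
    intro h0
    have h1 : aeval t (taylor 2 q - q) = 0 := by
      have := mul_aeval h q
      rw [h0, mul_zero, eq_comm, mul_eq_zero, or_iff_left hp] at this
      rw [map_sub, this, h0, sub_zero]
    have h2 : taylor 2 q - q = 0 := by
      by_contra hne
      exact ih _ (hd ▸ degree_sub_lt_right (degree_taylor q 2) hq (leadingCoeff_taylor ..)) hne rfl h1
    have h3 := taylor_eq_self (sub_eq_zero.1 h2)
    rw [h3, aeval_C, map_eq_zero] at h0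
    rw [h0, map_zero] at h3
    exact hq h3

lemma exists_embedding [CharZero k] (hp : p ≠ 0) (h : p * t = (t + 2) * p) :
    ∃ j : RatFunc k →+* E, ∀ q : k[X], j (algebraMap _ _ q) = aeval t q := by
  have hcomm : ∀ q r : k[X], aeval t q * aeval t r = aeval t r * aeval t q := fun q r => by
    rw [← map_mul, mul_comm, map_mul]
  let φ : RatFunc k → E := fun f => aeval t f.num * (aeval t f.denom)⁻¹
  have key : ∀ (f : RatFunc k) (n d : k[X]), d ≠ 0 → f.num * d = n * f.denom →
      φ f = aeval t n * (aeval t d)⁻¹ := by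
    intro f n d hd hnd
    have h1 := aeval_ne_zero hp h hd
    have h2 := aeval_ne_zero hp h f.denom_ne_zero
    rw [eq_mul_inv_iff_mul_eq₀ h1]
    simp only [φ]
    rw [mul_assoc, ← (Commute.inv_right₀ (hcomm d f.denom)).eq, ← mul_assoc, mul_inv_eq_iff_eq_mul₀ h2,
      ← map_mul, hnd, map_mul]
  have hφ : ∀ q : k[X], φ (algebraMap _ _ q) = aeval t q := by
    intro q
    rw [key _ q 1 one_ne_zero (by simp)]
    simp
  refine ⟨{ toFun := φ, map_zero' := ?_, map_one' := ?_, map_mul' := ?_, map_add' := ?_ }, hφ⟩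
  · simpa using hφ 1
  · intro x y
    rw [key _ _ _ (mul_ne_zero x.denom_ne_zero y.denom_ne_zero) (RatFunc.num_denom_mul x y),
      map_mul, map_mul, mul_inv_rev]
    simp only [φ]
    have e : Commute (aeval t x.denom)⁻¹ (aeval t y.num * (aeval t y.denom)⁻¹) :=
      ((show Commute _ _ from hcomm x.denom y.num).mul_right
        (Commute.inv_right₀ (hcomm x.denom y.denom))).inv_left₀
    rw [mul_assoc _ (aeval t x.denom)⁻¹, e.eq]
    simp only [mul_assoc]
  · simpa using hφ 0
  · intro x y
    rw [key _ _ _ (mul_ne_zero x.denom_ne_zero y.denom_ne_zero) (RatFunc.num_denom_add x y)]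
    have h1 := aeval_ne_zero hp h x.denom_ne_zero
    have h2 := aeval_ne_zero hp h y.denom_ne_zero
    simp only [φ]
    rw [map_add, map_mul, map_mul, map_mul, add_mul, mul_inv_rev, hcomm x.denom y.num]
    congr 1
    · rw [mul_assoc, mul_inv_cancel_left₀ h2]
    · rw [((Commute.inv_right₀ (hcomm y.denom x.denom)).inv_left₀).eq, mul_assoc, mul_inv_cancel_left₀ h1]

end Embedding

section Shift

variable {k : Type*} [Field k]

lemma nonZeroDivisors_le_comap_taylor (r : k) :
    nonZeroDivisors k[X] ≤ (nonZeroDivisors k[X]).comap (taylorAlgHom r) := by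
  intro q hq
  rw [Submonoid.mem_comap, mem_nonZeroDivisors_iff_ne_zero]
  exact (taylor_eq_zero r q).not.2 (mem_nonZeroDivisors_iff_ne_zero.1 hq)

/-- The automorphism `X ↦ X + r` of the field of rational functions. -/
noncomputable def shift (r : k) : RatFunc k →ₐ[k] RatFunc k :=
  RatFunc.mapAlgHom (taylorAlgHom r) (nonZeroDivisors_le_comap_taylor r)

lemma shift_algebraMap (r : k) (q : k[X]) :
    shift r (algebraMap _ _ q) = algebraMap _ _ (taylor r q) := by
  have := RatFunc.map_apply_div (taylorAlgHom r) (nonZeroDivisors_le_comap_taylor r) q 1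
  rw [map_one, map_one, map_one, div_one, div_one] at this
  exact this

lemma mul_embedding {E : Type*} [DivisionRing E] [Algebra k E] {p t : E}
    (h : p * t = (t + 2) * p) {j : RatFunc k →+* E}
    (hj : ∀ q : k[X], j (algebraMap _ _ q) = aeval t q) (f : RatFunc k) :
    p * j f = j (shift 2 f) * p := by
  have hpoly : ∀ q : k[X], SemiconjBy p (j (algebraMap _ _ q)) (j (shift 2 (algebraMap _ _ q))) := by
    intro q
    rw [shift_algebraMap, hj, hj]
    exact mul_aeval h q
  obtain ⟨n, d, rfl⟩ : ∃ n d : k[X], f = algebraMap _ _ n / algebraMap _ _ d :=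
    ⟨_, _, f.num_div_denom.symm⟩
  rw [map_div₀, map_div₀, map_div₀, div_eq_mul_inv, div_eq_mul_inv]
  exact (hpoly n).mul_right (hpoly d).inv_right₀

end Shift

end ShiftAlgebra

namespace ShiftAlgebra

open Polynomial

variable {k : Type*} [Field k]

lemma shift_shift (r r' : k) (f : RatFunc k) : shift r (shift r' f) = shift (r + r') f := by
  obtain ⟨n, d, rfl⟩ : ∃ n d : k[X], f = algebraMap _ _ n / algebraMap _ _ d :=
    ⟨_, _, f.num_div_denom.symm⟩
  simp only [map_div₀, shift_algebraMap, taylor_taylor]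

lemma shift_zero (f : RatFunc k) : shift 0 f = f := by
  obtain ⟨n, d, rfl⟩ : ∃ n d : k[X], f = algebraMap _ _ n / algebraMap _ _ d :=
    ⟨_, _, f.num_div_denom.symm⟩
  simp only [map_div₀, shift_algebraMap, taylor_zero]

lemma exists_forall_eval_ne_zero [CharZero k] {d : k[X]} (hd : d ≠ 0) {r : k} (hr : r ≠ 0) (α : k) :
    ∃ M : ℕ, ∀ m : ℕ, M ≤ m → d.eval (α + r * m) ≠ 0 := by
  classical
  have hinj : Function.Injective fun m : ℕ => α + r * (m : k) := by
    intro m n hmn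
    simpa [hr] using hmn
  obtain ⟨M, hM⟩ := ((d.roots.toFinset.finite_toSet).preimage hinj.injOn).bddAbove
  refine ⟨M + 1, fun m hm h0 => ?_⟩
  have := hM (show m ∈ _ by simp [hd, h0])
  omega

lemma eq_algebraMap_of_shift_eq_self [CharZero k] {r : k} (hr : r ≠ 0) {f : RatFunc k}
    (h : shift r f = f) : ∃ c : k, f = algebraMap k _ c := by
  have hd := f.denom_ne_zero
  have hd' := (taylor_eq_zero r f.denom).not.2 hd
  have hinj : Function.Injective (algebraMap k[X] (RatFunc k)) := RatFunc.algebraMap_injective k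
  have heq : taylor r f.num * f.denom = f.num * taylor r f.denom := by
    apply hinj
    rw [← f.num_div_denom, map_div₀, shift_algebraMap, shift_algebraMap,
      div_eq_div_iff ((map_ne_zero_iff _ hinj).2 hd') ((map_ne_zero_iff _ hinj).2 hd),
      ← map_mul, ← map_mul] at h
    exact h
  obtain ⟨M, hM⟩ := exists_forall_eval_ne_zero hd hr 0
  simp only [zero_add] at hM
  set c := f.num.eval (r * M) / f.denom.eval (r * M) with hc
  have key : ∀ m : ℕ, M ≤ m → f.num.eval (r * m) = c * f.denom.eval (r * m) := by
    intro m hm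
    induction m, hm using Nat.le_induction with
    | base => rw [hc, div_mul_cancel₀ _ (hM M le_rfl)]
    | succ m hm ih =>
      have := congrArg (fun q => q.eval (r * m)) heq
      simp only [eval_mul, taylor_eval] at this
      rw [Nat.cast_succ, mul_add, mul_one]
      apply mul_right_cancel₀ (hM m hm)
      rw [this, ih]
      ring
  have hnum : f.num = C c * f.denom := by
    refine eq_of_infinite_eval_eq _ _ (Set.Infinite.mono
      (s := (fun m : ℕ => r * (m : k)) '' Set.Ici M) ?_ ((Set.Ici_infinite M).image ?_))
    · rintro _ ⟨m, hm, rfl⟩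
      simp [key m hm]
    · intro m _ n _ hmn
      simpa [hr] using hmn
  refine ⟨c, ?_⟩
  rw [← f.num_div_denom, hnum, map_mul, mul_div_cancel_right₀ _ ((map_ne_zero_iff _ hinj).2 hd)]
  rfl

lemma eq_zero_of_shift_eq_neg [CharZero k] {f : RatFunc k} (h : shift 2 f = -f) : f = 0 := by
  have h4 : shift (2 + 2) f = f := by rw [← shift_shift, h, map_neg, h, neg_neg]
  obtain ⟨c, rfl⟩ := eq_algebraMap_of_shift_eq_self (by norm_num : (2 + 2 : k) ≠ 0) h4
  rw [AlgHom.commutes, eq_neg_iff_add_eq_zero, ← two_mul] at h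
  exact (mul_eq_zero.1 h).resolve_left (by
    rw [← map_ofNat (algebraMap k (RatFunc k)) 2, map_eq_zero]; exact two_ne_zero)

/-- The rational function `f` is regular at the point `α`. -/
def Reg (α : k) (f : RatFunc k) : Prop :=
  ∃ n d : k[X], d.eval α ≠ 0 ∧ f * algebraMap _ _ d = algebraMap _ _ n

lemma reg_algebraMap (α : k) (q : k[X]) : Reg α (algebraMap _ _ q) :=
  ⟨q, 1, by simp, by simp⟩

lemma reg_const (α c : k) : Reg α (algebraMap k _ c) :=
  reg_algebraMap α (C c)

lemma Reg.mul {α : k} {f g : RatFunc k} (hf : Reg α f) (hg : Reg α g) : Reg α (f * g) := by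
  obtain ⟨n, d, hd, h⟩ := hf
  obtain ⟨n', d', hd', h'⟩ := hg
  exact ⟨n * n', d * d', by simp [hd, hd'], by rw [map_mul, map_mul, mul_mul_mul_comm, h, h']⟩

lemma Reg.add {α : k} {f g : RatFunc k} (hf : Reg α f) (hg : Reg α g) : Reg α (f + g) := by
  obtain ⟨n, d, hd, h⟩ := hf
  obtain ⟨n', d', hd', h'⟩ := hg
  refine ⟨n * d' + d * n', d * d', by simp [hd, hd'], ?_⟩
  rw [map_mul, map_add, map_mul, map_mul, ← h, ← h']
  ring

lemma Reg.neg {α : k} {f : RatFunc k} (hf : Reg α f) : Reg α (-f) := by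
  obtain ⟨n, d, hd, h⟩ := hf
  exact ⟨-n, d, hd, by rw [neg_mul, h, map_neg]⟩

lemma Reg.sub {α : k} {f g : RatFunc k} (hf : Reg α f) (hg : Reg α g) : Reg α (f - g) :=
  sub_eq_add_neg f g ▸ hf.add hg.neg

lemma Reg.shift {r α : k} {f : RatFunc k} (hf : Reg (α + r) f) : Reg α (shift r f) := by
  obtain ⟨n, d, hd, h⟩ := hf
  refine ⟨taylor r n, taylor r d, by rwa [taylor_eval], ?_⟩
  rw [← shift_algebraMap, ← shift_algebraMap, ← map_mul, h]

lemma reg_shift_iff {r α : k} {f : RatFunc k} : Reg α (shift r f) ↔ Reg (α + r) f := by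
  refine ⟨fun h => ?_, Reg.shift⟩
  rw [← add_neg_cancel_right α r] at h
  have := h.shift
  rwa [shift_shift, neg_add_cancel, shift_zero] at this

lemma reg_of_denom_eval_ne_zero {α : k} {f : RatFunc k} (h : f.denom.eval α ≠ 0) : Reg α f := by
  refine ⟨f.num, f.denom, h, ?_⟩
  nth_rewrite 1 [← f.num_div_denom]
  exact div_mul_cancel₀ _ ((map_ne_zero_iff _ (RatFunc.algebraMap_injective k)).2 f.denom_ne_zero)

lemma reg_of_forall_reg_iff [CharZero k] {f : RatFunc k} {r : k} (hr : r ≠ 0) {α : k}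
    (h : ∀ m : ℕ, Reg (α + r * m) f ↔ Reg (α + r * (m + 1)) f) : Reg α f := by
  obtain ⟨M, hM⟩ := exists_forall_eval_ne_zero f.denom_ne_zero hr α
  have h' : ∀ m : ℕ, Reg α f ↔ Reg (α + r * m) f := by
    intro m
    induction m with
    | zero => simp
    | succ m ih => rw [ih, h m, Nat.cast_succ]
  exact (h' M).2 (reg_of_denom_eval_ne_zero (hM M le_rfl))

/-- A coboundary which is regular at all points `α + 2 n`, `n ≠ 0`, is regular at `α`. -/
lemma reg_of_eq_sub [CharZero k] {g h : RatFunc k} {η : ℤˣ} {α : k}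
    (hg : g = ((η : ℤ) : RatFunc k) * shift 2 h - h)
    (hreg : ∀ n : ℤ, n ≠ 0 → Reg (α + 2 * n) g) : Reg α g := by
  have hη : ∀ (β : k) (f : RatFunc k), Reg β (((η : ℤ) : RatFunc k) * f) ↔ Reg β f := by
    intro β f
    rcases Int.units_eq_one_or η with rfl | rfl
    · simp
    · simp only [Units.val_neg, Units.val_one, Int.cast_neg, Int.cast_one, neg_mul, one_mul]
      exact ⟨fun h => neg_neg f ▸ h.neg, Reg.neg⟩
  have hstep : ∀ β : k, Reg β g → (Reg β h ↔ Reg (β + 2) h) := by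
    intro β hβ
    rw [← reg_shift_iff, ← hη β (shift 2 h)]
    constructor
    · intro h1
      rw [← sub_add_cancel (((η : ℤ) : RatFunc k) * shift 2 h) h, ← hg]
      exact hβ.add h1
    · intro h1
      rw [← sub_sub_cancel (((η : ℤ) : RatFunc k) * shift 2 h) h, ← hg]
      exact h1.sub hβ
  have hpos : Reg (α + 2) h := by
    refine reg_of_forall_reg_iff (two_ne_zero (α := k)) fun m => ?_
    have := hstep (α + 2 + 2 * m) (by
      have := hreg (m + 1) (by omega)
      push_cast at this
      rwa [mul_add, mul_one, ← add_assoc, add_right_comm] at this)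
    rw [this, mul_add, mul_one, add_assoc (α + 2)]
  have hneg : Reg α h := by
    refine reg_of_forall_reg_iff (neg_ne_zero.2 (two_ne_zero (α := k))) fun m => ?_
    have := hstep (α + -2 * (m + 1)) (by
      have := hreg (-(m + 1)) (by omega)
      push_cast at this
      convert this using 1
      ring)
    rw [this]
    ring_nf
  rw [hg]
  exact ((hη α _).2 (reg_shift_iff.2 hpos)).sub hneg

/-- The rational function `(X - a) (X + a)⁻¹ + (X - a)⁻¹ (X + a)`. -/
noncomputable def symFun (a : k) : RatFunc k :=
  algebraMap _ _ (X - C a) * (algebraMap _ _ (X + C a))⁻¹ +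
    (algebraMap _ _ (X - C a))⁻¹ * algebraMap _ _ (X + C a)

lemma symFun_mul (a : k) : symFun a * algebraMap _ _ ((X - C a) * (X + C a)) =
    algebraMap _ _ ((X - C a) ^ 2 + (X + C a) ^ 2) := by
  have hinj : Function.Injective (algebraMap k[X] (RatFunc k)) := RatFunc.algebraMap_injective k
  have h1 : algebraMap k[X] (RatFunc k) (X - C a) ≠ 0 :=
    (map_ne_zero_iff _ hinj).2 (X_sub_C_ne_zero a)
  have h2 : algebraMap k[X] (RatFunc k) (X + C a) ≠ 0 :=
    (map_ne_zero_iff _ hinj).2 (X_add_C_ne_zero a)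
  rw [symFun, map_mul, map_add _ ((X - C a) ^ 2), map_pow, map_pow]
  field_simp

lemma reg_symFun {a α : k} (h1 : α ≠ a) (h2 : α ≠ -a) : Reg α (symFun a) :=
  ⟨_, (X - C a) * (X + C a), by
    simpa [sub_eq_zero, h1] using fun h => h2 (eq_neg_of_add_eq_zero_left h), symFun_mul a⟩

lemma not_reg_symFun [CharZero k] {a : k} (ha : a ≠ 0) : ¬ Reg a (symFun a) := by
  rintro ⟨n, d, hd, h⟩
  have h1 : ((X - C a) ^ 2 + (X + C a) ^ 2) * d = n * ((X - C a) * (X + C a)) := by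
    apply RatFunc.algebraMap_injective k
    rw [map_mul, ← symFun_mul, map_mul _ n, ← h]
    ring
  have := congrArg (eval a) h1
  simp [hd, ← two_mul, ha] at this

lemma reg_symFun_inv [CharZero k] {a : k} (ha : a ≠ 0) : Reg a (symFun a)⁻¹ := by
  have hs : symFun a ≠ 0 := fun h => not_reg_symFun ha (h ▸ by simpa using reg_const a 0)
  refine ⟨(X - C a) * (X + C a), (X - C a) ^ 2 + (X + C a) ^ 2, ?_,
    by rw [← symFun_mul, inv_mul_cancel_left₀ hs]⟩
  simp [← two_mul, ha]

lemma eq_C_of_reg_aeval_symFun [CharZero k] {a : k} (ha : a ≠ 0) (m : ℕ) (q : k[X])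
    (hm : q.natDegree ≤ m) (hq : Reg a (aeval (symFun a) q)) : q = C (q.coeff 0) := by
  have hs : symFun a ≠ 0 := fun h => not_reg_symFun ha (h ▸ by simpa using reg_const a 0)
  induction m generalizing q with
  | zero => exact eq_C_of_natDegree_le_zero hm
  | succ m ih =>
    have h1 : aeval (symFun a) q.divX * symFun a + algebraMap k _ (q.coeff 0) =
        aeval (symFun a) q := by
      conv_rhs => rw [← divX_mul_X_add q]
      simp
    have h2 : Reg a (aeval (symFun a) q.divX * symFun a) := by
      rw [eq_sub_of_add_eq h1]
      exact hq.sub (reg_const _ _)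
    have h3 : Reg a (aeval (symFun a) q.divX) := by
      rw [← mul_inv_cancel_right₀ hs (aeval (symFun a) q.divX)]
      exact h2.mul (reg_symFun_inv ha)
    have h4 := ih q.divX (by rw [natDegree_divX_eq_natDegree_tsub_one]; omega) h3
    rw [h4, aeval_C] at h2
    have h5 : q.divX.coeff 0 = 0 := by
      by_contra h5
      apply not_reg_symFun ha
      have := (reg_const a (q.divX.coeff 0)⁻¹).mul h2
      rwa [← mul_assoc, ← map_mul, inv_mul_cancel₀ h5, map_one, one_mul] at this
    conv_lhs => rw [← divX_mul_X_add q, h4, h5]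
    simp

lemma Reg.pow {α : k} {f : RatFunc k} (hf : Reg α f) (n : ℕ) : Reg α (f ^ n) := by
  induction n with
  | zero => simpa using reg_const α 1
  | succ n ih => rw [pow_succ]; exact ih.mul hf

lemma reg_aeval {α : k} {f : RatFunc k} (hf : Reg α f) (q : k[X]) : Reg α (aeval f q) := by
  induction q using Polynomial.induction_on' with
  | add q r hq hr => rw [map_add]; exact hq.add hr
  | monomial n c => rw [aeval_monomial]; exact (reg_const α c).mul (hf.pow n)

/-- A polynomial in the symmetric function without constant term is not a coboundary. -/
lemma eq_zero_of_aeval_symFun_eq_sub [CharZero k] {a : k} (ha : a ≠ 0)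
    (han : ∀ n : ℤ, a ≠ n) {q : k[X]} (hq0 : q.coeff 0 = 0) {h : RatFunc k} {η : ℤˣ}
    (hq : aeval (symFun a) q = ((η : ℤ) : RatFunc k) * shift 2 h - h) : q = 0 := by
  have hreg := reg_of_eq_sub (α := a) hq fun n hn => by
    refine reg_aeval (reg_symFun ?_ ?_) q
    · simpa using hn
    · intro h
      apply han (-n)
      have : (2 : k) * (a + n) = 0 := by linear_combination h
      have := (mul_eq_zero.1 this).resolve_left two_ne_zero
      push_cast
      exact eq_neg_of_add_eq_zero_left this
  rw [eq_C_of_reg_aeval_symFun ha _ q le_rfl hreg, hq0, map_zero]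

end ShiftAlgebra

namespace ShiftAlgebra

section Words

variable {K E : Type*} [Field K] [Ring E] [Module K E]

/-- The product `y ε₁ s ^ (i₁ + 1) y ε₂ s ^ (i₂ + 1) ⋯` attached to a word in the letters
`(ε, i)`. -/
def wordProd (y : ℤˣ → E) (s : K) : List (ℤˣ × ℕ) → E
  | [] => 1
  | a :: w => y a.1 * (s ^ (a.2 + 1) • wordProd y s w)

/-- The sign of the first letter of a word. -/
def headSign (K : Type*) [Field K] : List (ℤˣ × ℕ) → K
  | [] => 1
  | a :: _ => ((a.1 : ℤ) : K)

/-- The exponent of the first letter of a word. -/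
def headExp : List (ℤˣ × ℕ) → ℕ
  | [] => 0
  | a :: _ => a.2

lemma headSign_eq (w : List (ℤˣ × ℕ)) : ∃ ε : ℤˣ, headSign K w = ((ε : ℤ) : K) := by
  cases w with
  | nil => exact ⟨1, by simp [headSign]⟩
  | cons a w => exact ⟨a.1, rfl⟩

lemma sign_mul_self (ε : ℤˣ) : ((ε : ℤ) : K) * ((ε : ℤ) : K) = 1 := by
  rcases Int.units_eq_one_or ε with rfl | rfl <;> simp

/-- The assumptions on a division ring `E` containing a field `K` with an endomorphism `σ` induced
by an element `p`, under which the products `wordProd` are linearly independent over `K`. -/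
structure SkewData (σ : K →+* K) (p : E) (s : K) (y : ℤˣ → E) (B : Submodule K E) : Prop where
  mul_smul : ∀ (f : K) (x : E), p * (f • x) = σ f • (p * x)
  mul_y : ∀ ε : ℤˣ, p * y ε = ((ε : ℤ) : K) • (1 - y ε)
  fix : ∀ f : K, σ f = -f → f = 0
  coboundary : ∀ (J : Finset ℕ) (c : ℕ → K), (∀ i ∈ J, σ (c i) = c i) → ∀ (h : K) (η : ℤˣ),
    ∑ i ∈ J, c i * s ^ (i + 1) = ((η : ℤ) : K) * σ h - h → ∀ i ∈ J, c i = 0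
  one_mem : (1 : E) ∈ B
  mul_mem : ∀ x ∈ B, p * x ∈ B
  base : ∀ (q : K) (ε : ℤˣ), ∀ x ∈ B, p * x + ((ε : ℤ) : K) • x = q • (1 : E) → q = 0

namespace SkewData

/-- The submodule spanned by `B` and the words of length at most `r`. -/
def level (y : ℤˣ → E) (s : K) (B : Submodule K E) (r : ℕ) : Submodule K E :=
  B ⊔ Submodule.span K (wordProd y s '' {w | w.length ≤ r})

lemma wordProd_mem_level (y : ℤˣ → E) (s : K) (B : Submodule K E) {r : ℕ} {w : List (ℤˣ × ℕ)}
    (h : w.length ≤ r) : wordProd y s w ∈ level y s B r :=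
  Submodule.mem_sup_right (Submodule.subset_span ⟨w, h, rfl⟩)

/-- The combinations of words of length exactly `r`. -/
abbrev homog (K : Type*) [Field K] (r : ℕ) : Submodule K (List (ℤˣ × ℕ) →₀ K) :=
  Finsupp.supported K K {w | w.length = r}

lemma length_of_mem_support {r : ℕ} {F : List (ℤˣ × ℕ) →₀ K} (hF : F ∈ homog K r)
    {w : List (ℤˣ × ℕ)} (hw : w ∈ F.support) : w.length = r :=
  (Finsupp.mem_supported K F).1 hF hw

lemma exists_level_succ (y : ℤˣ → E) (s : K) (B : Submodule K E) {r : ℕ} {x : E}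
    (hx : x ∈ level y s B (r + 1)) : ∃ z ∈ level y s B r, ∃ F ∈ homog K (r + 1),
      x = z + Finsupp.linearCombination K (wordProd y s) F := by
  have h1 : {w : List (ℤˣ × ℕ) | w.length ≤ r + 1} =
      {w | w.length ≤ r} ∪ {w | w.length = r + 1} := by
    ext w
    simp only [Set.mem_ofPred_eq, Set.mem_union]
    omega
  rw [level, h1, Set.image_union, Submodule.span_union, ← sup_assoc, Submodule.mem_sup] at hx
  obtain ⟨z, hz, x', hx', rfl⟩ := hx
  obtain ⟨F, hF, rfl⟩ := (Finsupp.mem_span_image_iff_linearCombination K).1 hx'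
  exact ⟨z, hz, F, hF, rfl⟩

variable {σ : K →+* K} {p : E} {s : K} {y : ℤˣ → E} {B : Submodule K E}
  (hd : SkewData σ p s y B)

include hd in
lemma mul_wordProd {w : List (ℤˣ × ℕ)} (hw : w ≠ []) : p * wordProd y s w =
    headSign K w • (s ^ (headExp w + 1) • wordProd y s w.tail - wordProd y s w) := by
  cases w with
  | nil => exact absurd rfl hw
  | cons a w =>
    rw [wordProd, ← mul_assoc, hd.mul_y]
    rcases Int.units_eq_one_or a.1 with h | h <;> simp [h, headSign, headExp, sub_mul]

include hd in
lemma mul_mem_level {r : ℕ} {x : E} (hx : x ∈ level y s B r) : p * x ∈ level y s B r := by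
  have h2 : ∀ x ∈ Submodule.span K (wordProd y s '' {w | w.length ≤ r}),
      p * x ∈ level y s B r := by
    intro x hx
    induction hx using Submodule.span_induction with
    | mem x h =>
      obtain ⟨w, hw, rfl⟩ := h
      simp only [Set.mem_ofPred_eq] at hw
      by_cases hw0 : w = []
      · subst hw0
        exact Submodule.mem_sup_left (hd.mul_mem _ hd.one_mem)
      · rw [hd.mul_wordProd hw0]
        refine Submodule.smul_mem _ _ (Submodule.sub_mem _ (Submodule.smul_mem _ _ ?_) ?_)
        · exact wordProd_mem_level y s B (by rw [List.length_tail]; omega)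
        · exact wordProd_mem_level y s B hw
    | zero => rw [mul_zero]; exact Submodule.zero_mem _
    | add x x' _ _ hx hx' => rw [mul_add]; exact Submodule.add_mem _ hx hx'
    | smul c x _ hx => rw [hd.mul_smul]; exact Submodule.smul_mem _ _ hx
  obtain ⟨b, hb, z, hz, rfl⟩ := Submodule.mem_sup.1 hx
  rw [mul_add]
  exact Submodule.add_mem _ (Submodule.mem_sup_left (hd.mul_mem _ hb)) (h2 z hz)

/-- The leading coefficients of `(p + ε) x` in terms of those of `x`. -/
noncomputable def twist (σ : K →+* K) (ε : ℤˣ) (F : List (ℤˣ × ℕ) →₀ K) :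
    List (ℤˣ × ℕ) →₀ K :=
  Finsupp.onFinset F.support (fun w => ((ε : ℤ) : K) * F w - headSign K w * σ (F w)) fun w hw => by
    rw [Finsupp.mem_support_iff]
    contrapose! hw
    simp [hw]

lemma twist_apply (ε : ℤˣ) (F : List (ℤˣ × ℕ) →₀ K) (w : List (ℤˣ × ℕ)) :
    twist σ ε F w = ((ε : ℤ) : K) * F w - headSign K w * σ (F w) := rfl

lemma support_twist_subset (ε : ℤˣ) (F : List (ℤˣ × ℕ) →₀ K) :
    (twist σ ε F).support ⊆ F.support :=
  Finsupp.support_onFinset_subset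

lemma twist_mem_homog {ε : ℤˣ} {F : List (ℤˣ × ℕ) →₀ K} {r : ℕ} (hF : F ∈ homog K r) :
    twist σ ε F ∈ homog K r := by
  rw [Finsupp.mem_supported] at *
  exact fun w hw => hF (support_twist_subset ε F hw)

include hd in
lemma mul_linearCombination {r : ℕ} (ε : ℤˣ) {F : List (ℤˣ × ℕ) →₀ K} (hF : F ∈ homog K (r + 1)) :
    p * Finsupp.linearCombination K (wordProd y s) F +
        ((ε : ℤ) : K) • Finsupp.linearCombination K (wordProd y s) F =
      ∑ w ∈ F.support, (headSign K w * σ (F w)) • (s ^ (headExp w + 1) • wordProd y s w.tail) +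
        Finsupp.linearCombination K (wordProd y s) (twist σ ε F) := by
  rw [twist, Finsupp.linearCombination_onFinset, Finsupp.linearCombination_apply, Finsupp.sum,
    Finset.mul_sum, Finset.smul_sum, ← Finset.sum_add_distrib, ← Finset.sum_add_distrib]
  refine Finset.sum_congr rfl fun w hw => ?_
  have hw0 : w ≠ [] := by
    rintro rfl
    simpa using length_of_mem_support hF hw
  rw [hd.mul_smul, hd.mul_wordProd hw0]
  module

lemma sum_mem_level {r : ℕ} {F : List (ℤˣ × ℕ) →₀ K} (hF : F ∈ homog K (r + 1)) :
    ∑ w ∈ F.support, (headSign K w * σ (F w)) • (s ^ (headExp w + 1) • wordProd y s w.tail) ∈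
      level y s B r := by
  refine Submodule.sum_mem _ fun w hw => Submodule.smul_mem _ _ (Submodule.smul_mem _ _ ?_)
  refine wordProd_mem_level y s B ?_
  rw [List.length_tail, length_of_mem_support hF hw]
  rfl

/-- Words of length `r + 1` are linearly independent modulo `level r`. -/
def IndepAt (y : ℤˣ → E) (s : K) (B : Submodule K E) (r : ℕ) : Prop :=
  ∀ F ∈ homog K (r + 1), Finsupp.linearCombination K (wordProd y s) F ∈ level y s B r → F = 0

/-- The leading coefficients of `(p + ε) x` are twisted coboundaries, for `x` in `level r`. -/
def CoboundaryAt (σ : K →+* K) (p : E) (s : K) (y : ℤˣ → E) (B : Submodule K E) (r : ℕ) : Prop :=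
  ∀ x ∈ level y s B r, ∀ ε : ℤˣ, ∀ q ∈ homog K r,
    p * x + ((ε : ℤ) : K) • x = Finsupp.linearCombination K (wordProd y s) q →
      ∀ w, ∃ (h : K) (η : ℤˣ), q w = ((η : ℤ) : K) * σ h - h

include hd in
lemma coboundaryAt_zero : CoboundaryAt σ p s y B 0 := by
  intro x hx ε q hq hxq w
  have hx' : x ∈ B := by
    have : level y s B 0 ≤ B := by
      refine sup_le le_rfl (Submodule.span_le.2 ?_)
      rintro _ ⟨w, hw, rfl⟩
      rw [Set.mem_ofPred_eq, Nat.le_zero, List.length_eq_zero_iff] at hw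
      subst hw
      exact hd.one_mem
    exact this hx
  have hq' : q = Finsupp.single [] (q []) := by
    ext w
    by_cases hw : w = []
    · subst hw; simp
    · rw [Finsupp.single_eq_of_ne hw]
      by_contra hqw
      exact hw (List.length_eq_zero_iff.1
        (length_of_mem_support hq (Finsupp.mem_support_iff.2 hqw)))
  rw [hq', Finsupp.linearCombination_single] at hxq
  have := hd.base _ ε x hx' hxq
  exact ⟨0, 1, by rw [hq', this]; simp⟩

include hd in
lemma coboundaryAt_succ {r : ℕ} (hI : IndepAt y s B r) : CoboundaryAt σ p s y B (r + 1) := by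
  intro x hx ε q hq hxq w
  obtain ⟨z, hz, F, hF, rfl⟩ := exists_level_succ y s B hx
  have h1 := hd.mul_linearCombination ε hF
  have h2 : Finsupp.linearCombination K (wordProd y s) (q - twist σ ε F) ∈ level y s B r := by
    have : Finsupp.linearCombination K (wordProd y s) (q - twist σ ε F) =
        (p * z + ((ε : ℤ) : K) • z) + ∑ w ∈ F.support,
          (headSign K w * σ (F w)) • (s ^ (headExp w + 1) • wordProd y s w.tail) := by
      rw [map_sub, ← hxq, sub_eq_iff_eq_add, add_assoc, ← h1, mul_add, smul_add]
      abel
    rw [this]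
    exact Submodule.add_mem _ (Submodule.add_mem _ (hd.mul_mem_level hz)
      (Submodule.smul_mem _ _ hz)) (sum_mem_level hF)
  have h3 := sub_eq_zero.1 (hI _ (Submodule.sub_mem _ hq (twist_mem_homog hF)) h2)
  obtain ⟨δ, hδ⟩ := headSign_eq (K := K) w
  refine ⟨-(((ε : ℤ) : K) * F w), δ * ε, ?_⟩
  rw [h3, twist_apply, hδ, map_neg, map_mul, map_intCast, Units.val_mul, Int.cast_mul]
  linear_combination ((δ : ℤ) : K) * σ (F w) * sign_mul_self (K := K) ε

include hd in
lemma indepAt_of_coboundaryAt [CharZero K] {r : ℕ} (hQ : CoboundaryAt σ p s y B r) :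
    IndepAt y s B r := by
  classical
  intro F
  induction hn : F.support.card using Nat.strong_induction_on generalizing F with
  | _ n ih =>
  intro hF hmem
  by_contra hF0
  obtain ⟨w₀, hw₀⟩ := Finsupp.support_nonempty_iff.2 hF0
  wlog h1 : F w₀ = 1 generalizing F
  · have hne := Finsupp.mem_support_iff.1 hw₀
    have hsupp : ((F w₀)⁻¹ • F).support = F.support :=
      Finsupp.support_smul_eq (inv_ne_zero hne)
    refine this ((F w₀)⁻¹ • F) (hsupp ▸ hn) (Submodule.smul_mem _ _ hF) ?_ ?_ (hsupp ▸ hw₀) ?_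
    · rw [map_smul]; exact Submodule.smul_mem _ _ hmem
    · exact smul_ne_zero (inv_ne_zero hne) hF0
    · simp [hne]
  obtain ⟨ε, hε⟩ := headSign_eq (K := K) w₀
  have hx := hd.mul_linearCombination ε hF
  have htw : twist σ ε F = 0 := by
    refine ih (twist σ ε F).support.card ?_ _ rfl (twist_mem_homog hF) ?_
    · rw [← hn]
      refine Finset.card_lt_card (Finset.ssubset_iff_subset_ne.2 ⟨support_twist_subset ε F, ?_⟩)
      intro h
      rw [← h, Finsupp.mem_support_iff, twist_apply, h1, hε, map_one] at hw₀
      exact hw₀ (sub_self _)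
    · rw [eq_sub_of_add_eq' hx.symm]
      exact Submodule.sub_mem _ (Submodule.add_mem _ (hd.mul_mem_level hmem)
        (Submodule.smul_mem _ _ hmem)) (sum_mem_level hF)
  have hcoef : ∀ w ∈ F.support, headSign K w = ((ε : ℤ) : K) ∧ σ (F w) = F w := by
    intro w hw
    have h2 : ((ε : ℤ) : K) * F w - headSign K w * σ (F w) = 0 := by
      rw [← twist_apply, htw]; rfl
    obtain ⟨δ, hδ⟩ := headSign_eq (K := K) w
    rw [hδ] at h2 ⊢
    have hFw := Finsupp.mem_support_iff.1 hw
    rcases Int.units_eq_one_or ε with rfl | rfl <;> rcases Int.units_eq_one_or δ with rfl | rfl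
    · refine ⟨rfl, ?_⟩
      simp at h2
      linear_combination -h2
    · refine absurd (hd.fix _ ?_) hFw
      simp at h2
      linear_combination h2
    · refine absurd (hd.fix _ ?_) hFw
      simp at h2
      linear_combination -h2
    · refine ⟨rfl, ?_⟩
      simp at h2
      linear_combination h2
  rw [htw, map_zero, add_zero] at hx
  let q : List (ℤˣ × ℕ) →₀ K := ∑ w ∈ F.support,
    Finsupp.single w.tail (((ε : ℤ) : K) * F w * s ^ (headExp w + 1))
  have hq : q ∈ homog K r := by
    refine Submodule.sum_mem _ fun w hw => Finsupp.single_mem_supported K _ ?_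
    rw [Set.mem_ofPred_eq, List.length_tail, length_of_mem_support hF hw]
    rfl
  have hxq : ∑ w ∈ F.support,
      (headSign K w * σ (F w)) • (s ^ (headExp w + 1) • wordProd y s w.tail) =
      Finsupp.linearCombination K (wordProd y s) q := by
    rw [map_sum]
    refine Finset.sum_congr rfl fun w hw => ?_
    rw [Finsupp.linearCombination_single, (hcoef w hw).1, (hcoef w hw).2, smul_smul]
  obtain ⟨h, η, hη⟩ := hQ _ hmem ε q hq (hx.trans hxq) w₀.tail
  let W := F.support.filter fun w => w.tail = w₀.tail
  have hW : ∀ w ∈ W, w = (ε, headExp w) :: w₀.tail := by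
    intro w hw
    obtain ⟨hw, hwt⟩ := Finset.mem_filter.1 hw
    have hs := (hcoef w hw).1
    cases w with
    | nil => simpa using length_of_mem_support hF hw
    | cons a w =>
      rw [← hwt]
      have : a.1 = ε := by
        rw [headSign, Int.cast_inj] at hs
        exact Units.ext hs
      simp [headExp, ← this]
  have hinj : Set.InjOn headExp (W : Set (List (ℤˣ × ℕ))) := by
    intro w hw w' hw' hww'
    rw [hW w hw, hW w' hw', hww']
  let c : ℕ → K := fun i => ((ε : ℤ) : K) * F ((ε, i) :: w₀.tail)
  have hsum : ∑ i ∈ W.image headExp, c i * s ^ (i + 1) = ((η : ℤ) : K) * σ h - h := by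
    rw [← hη, Finset.sum_image hinj, Finsupp.finsetSum_apply]
    simp only [Finsupp.single_apply]
    rw [← Finset.sum_filter]
    refine Finset.sum_congr rfl fun w hw => ?_
    simp only [c]
    rw [← hW w hw]
  have hw₀W : w₀ ∈ W := Finset.mem_filter.2 ⟨hw₀, rfl⟩
  have hzero := hd.coboundary _ c ?_ h η hsum (headExp w₀) (Finset.mem_image_of_mem _ hw₀W)
  · simp only [c] at hzero
    rw [← hW w₀ hw₀W, h1, mul_one] at hzero
    have := sign_mul_self (K := K) ε
    rw [hzero, mul_zero] at this
    exact zero_ne_one this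
  · intro i hi
    obtain ⟨w, hw, rfl⟩ := Finset.mem_image.1 hi
    simp only [c]
    rw [← hW w hw, map_mul, map_intCast, (hcoef w (Finset.mem_filter.1 hw).1).2]

include hd in
lemma indepAt [CharZero K] (r : ℕ) : IndepAt y s B r := by
  suffices h : CoboundaryAt σ p s y B r from hd.indepAt_of_coboundaryAt h
  induction r with
  | zero => exact hd.coboundaryAt_zero
  | succ r ih => exact hd.coboundaryAt_succ (hd.indepAt_of_coboundaryAt ih)

/-- The combinations of words of length less than `n`. -/
def lower (y : ℤˣ → E) (s : K) (n : ℕ) : Submodule K E :=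
  Submodule.span K (wordProd y s '' {w | w.length < n})

lemma lower_mono (y : ℤˣ → E) (s : K) {m n : ℕ} (h : m ≤ n) : lower y s m ≤ lower y s n :=
  Submodule.span_mono (Set.image_mono fun _ hw => lt_of_lt_of_le hw h)

include hd in
lemma eq_zero_of_mem_lower [CharZero K] [Nontrivial E] {n : ℕ} {F : List (ℤˣ × ℕ) →₀ K}
    (hF : F ∈ homog K n)
    (h : Finsupp.linearCombination K (wordProd y s) F ∈ lower y s n) : F = 0 := by
  cases n with
  | zero =>
    have h0 : lower y s 0 = ⊥ := by simp [lower]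
    have hF' : F = Finsupp.single [] (F []) := by
      ext w
      by_cases hw : w = []
      · subst hw; simp
      · rw [Finsupp.single_eq_of_ne hw]
        by_contra hqw
        exact hw (List.length_eq_zero_iff.1
          (length_of_mem_support hF (Finsupp.mem_support_iff.2 hqw)))
    rw [h0, Submodule.mem_bot, hF', Finsupp.linearCombination_single, wordProd,
      smul_eq_zero_iff_left one_ne_zero] at h
    rw [hF', h, Finsupp.single_zero]
  | succ r =>
    refine hd.indepAt r F hF ?_
    have : lower y s (r + 1) ≤ level y s B r :=
      le_sup_of_le_right (Submodule.span_mono (Set.image_mono fun w hw => Nat.lt_succ_iff.1 hw))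
    exact this h

lemma wordProd_sub_mem_closure {c : ℤˣ → E} (hc : ∀ ε, c ε = 2 * y ε - 1)
    (w : List (ℤˣ × ℕ)) : wordProd c s w - (2 ^ w.length) * wordProd y s w ∈
      AddSubgroup.closure {x | ∃ (m : ℕ) (w' : List (ℤˣ × ℕ)), w'.length < w.length ∧
        x = s ^ m • wordProd y s w'} := by
  induction w with
  | nil => simp [wordProd]
  | cons a w ih =>
    set Z := AddSubgroup.closure {x : E | ∃ (m : ℕ) (w' : List (ℤˣ × ℕ)),
      w'.length < (a :: w).length ∧ x = s ^ m • wordProd y s w'} with hZ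
    have key : ∀ x ∈ AddSubgroup.closure {x | ∃ (m : ℕ) (w' : List (ℤˣ × ℕ)),
        w'.length < w.length ∧ x = s ^ m • wordProd y s w'},
        y a.1 * (s ^ (a.2 + 1) • x) ∈ Z ∧ s ^ (a.2 + 1) • x ∈ Z := by
      intro x hx
      induction hx using AddSubgroup.closure_induction with
      | mem x hx =>
        obtain ⟨m, w', hw', rfl⟩ := hx
        constructor
        · refine AddSubgroup.subset_closure ⟨0, (a.1, a.2 + m) :: w', by simpa using hw', ?_⟩
          rw [pow_zero, one_smul, wordProd, smul_smul, ← pow_add, add_right_comm]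
        · refine AddSubgroup.subset_closure ⟨a.2 + 1 + m, w', by simp; omega, ?_⟩
          rw [smul_smul, ← pow_add]
      | zero => simp
      | add x x' _ _ h h' =>
        rw [smul_add, mul_add]
        exact ⟨Z.add_mem h.1 h'.1, Z.add_mem h.2 h'.2⟩
      | neg x _ h =>
        rw [smul_neg, mul_neg]
        exact ⟨Z.neg_mem h.1, Z.neg_mem h.2⟩
    have h1 := key _ ih
    have h2 : s ^ (a.2 + 1) • wordProd y s w ∈ Z :=
      AddSubgroup.subset_closure ⟨a.2 + 1, w, by simp, rfl⟩
    have h3 : wordProd c s (a :: w) - 2 ^ (a :: w).length * wordProd y s (a :: w) =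
        (2 : ℕ) • (y a.1 * (s ^ (a.2 + 1) • (wordProd c s w - 2 ^ w.length * wordProd y s w)))
        - s ^ (a.2 + 1) • (wordProd c s w - 2 ^ w.length * wordProd y s w)
        - (2 ^ w.length : ℕ) • (s ^ (a.2 + 1) • wordProd y s w) := by
      have e : ∀ (n : ℕ) (x : E), (2 : E) ^ n * x = (2 ^ n : ℕ) • x := fun n x => by
        rw [nsmul_eq_mul]; push_cast; rfl
      rw [wordProd, wordProd, hc, e, e, List.length_cons]
      generalize wordProd c s w = H
      generalize wordProd y s w = G
      rw [smul_sub, smul_comm _ _ G, mul_sub, mul_smul_comm (2 ^ w.length : ℕ), sub_mul, one_mul, mul_assoc, two_mul]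
      module
    rw [h3]
    exact Z.sub_mem (Z.sub_mem (Z.nsmul_mem h1.1 _) h1.2) (Z.nsmul_mem h2 _)

lemma wordProd_sub_mem_lower {c : ℤˣ → E} (hc : ∀ ε, c ε = 2 * y ε - 1)
    (w : List (ℤˣ × ℕ)) :
    wordProd c s w - (2 ^ w.length : K) • wordProd y s w ∈ lower y s w.length := by
  have h : AddSubgroup.closure {x | ∃ (m : ℕ) (w' : List (ℤˣ × ℕ)), w'.length < w.length ∧
        x = s ^ m • wordProd y s w'} ≤ (lower y s w.length).toAddSubgroup := by
    rw [AddSubgroup.closure_le]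
    rintro _ ⟨m, w', hw', rfl⟩
    exact Submodule.smul_mem _ _ (Submodule.subset_span ⟨w', hw', rfl⟩)
  have e : (2 ^ w.length : K) • wordProd y s w = 2 ^ w.length * wordProd y s w := by
    rw [show (2 ^ w.length : K) = ((2 ^ w.length : ℕ) : K) by push_cast; rfl, Nat.cast_smul_eq_nsmul,
      nsmul_eq_mul]
    push_cast
    rfl
  rw [e]
  exact h (wordProd_sub_mem_closure hc w)

lemma wordProd_mem_lower {c : ℤˣ → E} (hc : ∀ ε, c ε = 2 * y ε - 1)
    (w : List (ℤˣ × ℕ)) : wordProd c s w ∈ lower y s (w.length + 1) := by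
  rw [← sub_add_cancel (wordProd c s w) ((2 ^ w.length : K) • wordProd y s w)]
  refine Submodule.add_mem _ (lower_mono y s (Nat.le_succ _) (wordProd_sub_mem_lower hc w))
    (Submodule.smul_mem _ _ (Submodule.subset_span ⟨w, Nat.lt_succ_self _, rfl⟩))

include hd in
theorem linearIndependent_wordProd [CharZero K] [Nontrivial E] {c : ℤˣ → E}
    (hc : ∀ ε, c ε = 2 * y ε - 1) : LinearIndependent K (wordProd c s) := by
  classical
  rw [linearIndependent_iff]
  intro F hF
  suffices h : ∀ n, F ∈ Finsupp.supported K K {w : List (ℤˣ × ℕ) | w.length < n} → F = 0 by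
    refine h (F.support.sup List.length + 1) ((Finsupp.mem_supported K F).2 fun w hw => ?_)
    exact Nat.lt_succ_of_le (Finset.le_sup (f := List.length) hw)
  intro n
  induction n with
  | zero =>
    intro h
    rw [Finsupp.mem_supported] at h
    simpa using h
  | succ n ih =>
    intro h
    let F₁ := F.filter fun w : List (ℤˣ × ℕ) => w.length = n
    let F₂ := F.filter fun w : List (ℤˣ × ℕ) => ¬ w.length = n
    have h12 : F₁ + F₂ = F := Finsupp.filter_add_filter_not F _
    have hF₁ : F₁ ∈ homog K n := by
      rw [Finsupp.mem_supported]
      intro w hw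
      exact (Finset.mem_filter.1 (Finsupp.support_filter (fun w : List (ℤˣ × ℕ) => w.length = n) F ▸ hw)).2
    have hF₂ : F₂ ∈ Finsupp.supported K K {w : List (ℤˣ × ℕ) | w.length < n} := by
      rw [Finsupp.mem_supported] at h ⊢
      intro w hw
      obtain ⟨h1, h2⟩ :=
        Finset.mem_filter.1 (Finsupp.support_filter (fun w : List (ℤˣ × ℕ) => ¬ w.length = n) F ▸ hw)
      have := h h1
      simp only [Set.mem_ofPred_eq] at this ⊢
      omega
    have hl₂ : Finsupp.linearCombination K (wordProd c s) F₂ ∈ lower y s n := by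
      rw [Finsupp.linearCombination_apply]
      refine Submodule.sum_mem _ fun w hw => Submodule.smul_mem _ _ ?_
      exact lower_mono y s ((Finsupp.mem_supported K F₂).1 hF₂ hw) (wordProd_mem_lower hc w)
    have hl₁ : Finsupp.linearCombination K (wordProd c s) F₁ -
        (2 ^ n : K) • Finsupp.linearCombination K (wordProd y s) F₁ ∈ lower y s n := by
      rw [Finsupp.linearCombination_apply, Finsupp.linearCombination_apply, Finsupp.sum,
        Finsupp.sum, Finset.smul_sum, ← Finset.sum_sub_distrib]
      refine Submodule.sum_mem _ fun w hw => ?_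
      have hwn := length_of_mem_support hF₁ hw
      rw [smul_comm, ← smul_sub]
      refine Submodule.smul_mem _ _ ?_
      have := wordProd_sub_mem_lower (s := s) hc w
      rwa [hwn] at this
    have hsum : Finsupp.linearCombination K (wordProd c s) F₁ +
        Finsupp.linearCombination K (wordProd c s) F₂ = 0 := by rw [← map_add, h12, hF]
    have h3 : (2 ^ n : K) • Finsupp.linearCombination K (wordProd y s) F₁ ∈ lower y s n := by
      have := Submodule.add_mem _ hl₁ hl₂
      rw [sub_add_eq_add_sub, hsum, zero_sub] at this
      exact (Submodule.neg_mem_iff _).1 this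
    have h4 : F₁ = 0 := by
      refine hd.eq_zero_of_mem_lower hF₁ ?_
      exact (Submodule.smul_mem_iff _ (pow_ne_zero n two_ne_zero)).1 h3
    rw [h4, zero_add] at h12
    exact ih (h12 ▸ hF₂)

end SkewData

end Words

end ShiftAlgebra

namespace ShiftAlgebra

open Polynomial

section Encoding

/-- Words in `S` and `c S c⁻¹`, followed by `S`, written as `s ^ n • wordProd c s w`. -/
def encode : List (Fin 2) → ℕ × List (ℤˣ × ℕ)
  | [] => (1, [])
  | i :: x =>
    if i = 0 then ((encode x).1 + 1, (encode x).2)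
    else match encode x with
      | (n + 1, w) => (0, (1, 0) :: (-1, n) :: w)
      | (0, a :: w) => (0, (1, a.2 + 1) :: w)
      | (0, []) => (0, [])

lemma encode_zero_cons (x : List (Fin 2)) :
    encode (0 :: x) = ((encode x).1 + 1, (encode x).2) := by
  simp [encode]

lemma exists_encode_eq (x : List (Fin 2)) :
    (∃ n w, encode x = (n + 1, w)) ∨ ∃ i w, encode x = (0, (1, i) :: w) := by
  induction x with
  | nil => exact Or.inl ⟨0, [], rfl⟩
  | cons a x ih =>
    by_cases ha : a = 0
    · subst ha
      exact Or.inl ⟨_, _, encode_zero_cons x⟩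
    · obtain ⟨n, w, h⟩ | ⟨i, w, h⟩ := ih
      · exact Or.inr ⟨0, (-1, n) :: w, by simp [encode, ha, h]⟩
      · exact Or.inr ⟨i + 1, w, by simp [encode, ha, h]⟩

lemma encode_one_cons_of_succ {x : List (Fin 2)} {n : ℕ} {w : List (ℤˣ × ℕ)}
    (h : encode x = (n + 1, w)) : encode (1 :: x) = (0, (1, 0) :: (-1, n) :: w) := by
  simp [encode, h]

lemma encode_one_cons_of_zero {x : List (Fin 2)} {i : ℕ} {w : List (ℤˣ × ℕ)}
    (h : encode x = (0, (1, i) :: w)) : encode (1 :: x) = (0, (1, i + 1) :: w) := by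
  simp [encode, h]

lemma encode_one_cons_fst (x : List (Fin 2)) : (encode (1 :: x)).1 = 0 := by
  obtain ⟨n, w, h⟩ | ⟨i, w, h⟩ := exists_encode_eq x
  · rw [encode_one_cons_of_succ h]
  · rw [encode_one_cons_of_zero h]

lemma encode_nil_ne_cons (b : Fin 2) (y : List (Fin 2)) : encode [] ≠ encode (b :: y) := by
  intro h
  fin_cases b
  · change encode [] = encode (0 :: y) at h
    rw [encode_zero_cons, encode, Prod.mk.injEq] at h
    obtain ⟨n, w, hy⟩ | ⟨i, w, hy⟩ := exists_encode_eq y <;> simp [hy] at h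
  · have := encode_one_cons_fst y
    change encode [] = encode (1 :: y) at h
    rw [← h, encode] at this
    simp at this

lemma encode_injective : Function.Injective encode := by
  intro x
  induction x with
  | nil =>
    intro y h
    cases y with
    | nil => rfl
    | cons b y => exact absurd h (encode_nil_ne_cons b y)
  | cons a x ih =>
    intro y h
    cases y with
    | nil => exact absurd h.symm (encode_nil_ne_cons a x)
    | cons b y =>
      obtain rfl | rfl : a = 0 ∨ a = 1 := by omega
      · obtain rfl | rfl : b = 0 ∨ b = 1 := by omega
        · rw [encode_zero_cons, encode_zero_cons, Prod.mk.injEq, Nat.succ_inj] at h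
          rw [ih (Prod.ext h.1 h.2)]
        · have := encode_one_cons_fst y
          rw [← h, encode_zero_cons] at this
          simp at this
      · obtain rfl | rfl : b = 0 ∨ b = 1 := by omega
        · have := encode_one_cons_fst x
          rw [h, encode_zero_cons] at this
          simp at this
        · obtain ⟨n, w, hx⟩ | ⟨i, w, hx⟩ := exists_encode_eq x <;>
            obtain ⟨m, w', hy⟩ | ⟨j, w', hy⟩ := exists_encode_eq y
          · rw [encode_one_cons_of_succ hx, encode_one_cons_of_succ hy] at h
            simp only [Prod.mk.injEq, List.cons.injEq, true_and] at h
            rw [ih (hx.trans (by rw [hy, h.1, h.2]))]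
          · rw [encode_one_cons_of_succ hx, encode_one_cons_of_zero hy] at h
            simp at h
          · rw [encode_one_cons_of_zero hx, encode_one_cons_of_succ hy] at h
            simp at h
          · rw [encode_one_cons_of_zero hx, encode_one_cons_of_zero hy] at h
            simp only [Prod.mk.injEq, List.cons.injEq, true_and, Nat.succ_inj] at h
            rw [ih (hx.trans (by rw [hy, h.1, h.2]))]

end Encoding

section Freeness

lemma injective_lift_of_linearIndependent {k X A : Type*} [Field k] [Ring A] [Algebra k A]
    (g : X → A) (a : A) (hli : LinearIndependent k fun x : List X => (x.map g).prod * a) :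
    Function.Injective (FreeAlgebra.lift k g) := by
  let b := FreeAlgebra.basisFreeMonoid k X
  have hb : ∀ x : FreeMonoid X, FreeAlgebra.lift k g (b x) = (x.toList.map g).prod := by
    intro x
    have h1 : b x = FreeMonoid.lift (FreeAlgebra.ι k) x := by
      simp [b, FreeAlgebra.basisFreeMonoid, FreeAlgebra.equivMonoidAlgebraFreeMonoid]
    rw [h1, ← FreeMonoid.lift_apply]
    refine DFunLike.congr_fun (f := ((FreeAlgebra.lift k g : _ →* A).comp
      (FreeMonoid.lift (FreeAlgebra.ι k)))) (g := FreeMonoid.lift g) ?_ x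
    exact FreeMonoid.hom_eq fun y => by simp
  let G : FreeAlgebra k X →ₗ[k] A :=
    (LinearMap.mulRight k a).comp (FreeAlgebra.lift k g).toLinearMap
  have hGb : (G ∘ b : List X → A) = fun x => (x.map g).prod * a :=
    funext fun x => congrArg (· * a) (hb x)
  have hG : LinearIndependent k (G ∘ b : List X → A) := hGb ▸ hli
  rw [injective_iff_map_eq_zero]
  intro z hz
  have h1 : Finsupp.linearCombination k (G ∘ b) (b.repr z) = 0 := by
    rw [← Finsupp.apply_linearCombination, b.linearCombination_repr]
    simp [G, hz]
  exact b.repr.map_eq_zero_iff.1 (linearIndependent_iff.1 hG _ h1)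

lemma transcendental_symFun {k : Type*} [Field k] [CharZero k] {a : k} (ha : a ≠ 0) :
    Transcendental k (symFun a) := by
  rintro ⟨q, hq0, hq⟩
  have h := eq_C_of_reg_aeval_symFun ha _ q le_rfl (hq ▸ by simpa using reg_const a 0)
  rw [h, aeval_C, map_eq_zero] at hq
  rw [hq, map_zero] at h
  exact hq0 h

variable {k E : Type*} [Field k] [CharZero k] [DivisionRing E] [Algebra k E] {p t : E}

lemma one_add_sign_mul_ne_zero [CharZero E] (h : p * t = (t + 2) * p) (ε : ℤˣ) :
    1 + ((ε : ℤ) : E) * p ≠ 0 := by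
  intro h0
  rcases Int.units_eq_one_or ε with rfl | rfl
  · have hp : p = -1 := eq_neg_of_add_eq_zero_right (by simpa using h0)
    simp [hp] at h
  · have hp : p = 1 := (sub_eq_zero.1 (by simpa [← sub_eq_add_neg] using h0)).symm
    simp [hp] at h

lemma pow_mul_eq (h : p * t = (t + 2) * p) (n : ℕ) : p ^ n * t = (t + 2 * n) * p ^ n := by
  induction n with
  | zero => simp
  | succ n ih =>
    rw [pow_succ, mul_assoc, h, ← mul_assoc, mul_add, ih, Nat.cast_succ]
    have : Commute (2 : E) (p ^ n) := Commute.ofNat_left _ _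
    rw [← this.eq]
    noncomm_ring

variable [Module (RatFunc k) E] {j : RatFunc k →+* E}
  (hj : ∀ q : k[X], j (algebraMap _ _ q) = aeval t q) (hsmul : ∀ (f : RatFunc k) (x : E), f • x = j f * x)

include hj hsmul in
lemma linearIndependent_pow_embedding (hp : p ≠ 0) (h : p * t = (t + 2) * p) :
    LinearIndependent (RatFunc k) fun n : ℕ => p ^ n := by
  let R : Module.End (RatFunc k) E :=
    { toFun := fun x => x * t
      map_add' := fun x y => add_mul x y t
      map_smul' := fun f x => by simp only [hsmul, mul_assoc, RingHom.id_apply] }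
  refine Module.End.eigenvectors_linearIndependent' R
    (fun n : ℕ => algebraMap k[X] (RatFunc k) (X + C 2 * (n : k[X]))) ?_ _ fun n => ?_
  · intro m n hmn
    simpa using RatFunc.algebraMap_injective k hmn
  · refine ⟨Module.End.mem_eigenspace_iff.2 ?_, pow_ne_zero n hp⟩
    rw [hsmul, hj]
    have := pow_mul_eq h n
    rw [← map_ofNat (algebraMap k E) 2] at this
    simpa [R] using this

include hj hsmul in
lemma skewData (hp : p ≠ 0) (h : p * t = (t + 2) * p) {a : k} (ha : a ≠ 0)
    (han : ∀ n : ℤ, a ≠ n) :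
    SkewData (shift (2 : k) : RatFunc k →+* RatFunc k) p (symFun a)
      (fun ε : ℤˣ => (1 + ((ε : ℤ) : E) * p)⁻¹)
      (Submodule.span (RatFunc k) (Set.range fun n : ℕ => p ^ n)) where
  mul_smul f x := by
    rw [hsmul, hsmul, ← mul_assoc, mul_embedding h hj, mul_assoc]
    rfl
  mul_y ε := by
    have : CharZero E := charZero_of_injective_algebraMap (algebraMap k E).injective
    have h1 := one_add_sign_mul_ne_zero h ε
    have h2 : ((ε : ℤ) : E) * ((ε : ℤ) : E) = 1 := by
      rw [← Int.cast_mul, ← Units.val_mul, ← sq, Int.units_sq, Units.val_one, Int.cast_one]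
    rw [hsmul, map_intCast, ← sub_eq_zero]
    rw [← mul_left_inj' h1, zero_mul, sub_mul, mul_assoc, inv_mul_cancel₀ h1, mul_assoc, sub_mul,
      inv_mul_cancel₀ h1]
    rw [one_mul, add_sub_cancel_left, ← mul_assoc, h2]
    simp
  fix f hf := eq_zero_of_shift_eq_neg hf
  coboundary J c hc f η hsum := by
    have h1 : ∀ i, ∃ r : k, i ∈ J → c i = algebraMap k _ r := fun i => by
      by_cases hi : i ∈ J
      · obtain ⟨r, hr⟩ := eq_algebraMap_of_shift_eq_self (two_ne_zero) (hc i hi)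
        exact ⟨r, fun _ => hr⟩
      · exact ⟨0, fun h => absurd h hi⟩
    choose r hr using h1
    have hq := eq_zero_of_aeval_symFun_eq_sub ha han (q := ∑ i ∈ J, C (r i) * X ^ (i + 1))
      (by simp) (h := f) (η := η) (by
        refine Eq.trans ?_ hsum
        rw [map_sum]
        refine Finset.sum_congr rfl fun i hi => ?_
        simp [hr i hi])
    intro i hi
    have := congrArg (coeff · (i + 1)) hq
    simp [coeff_X_pow, hi] at this
    rw [hr i hi, this, map_zero]
  one_mem := Submodule.subset_span ⟨0, pow_zero p⟩
  mul_mem x hx := by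
    induction hx using Submodule.span_induction with
    | mem x hx =>
      obtain ⟨n, rfl⟩ := hx
      exact Submodule.subset_span ⟨n + 1, pow_succ' p n⟩
    | zero => rw [mul_zero]; exact Submodule.zero_mem _
    | add x y _ _ hx hy => rw [mul_add]; exact Submodule.add_mem _ hx hy
    | smul f x _ hx =>
      rw [hsmul, ← mul_assoc, mul_embedding h hj, mul_assoc, ← hsmul]
      exact Submodule.smul_mem _ _ hx
  base q ε x hx hxq := by
    have hli := linearIndependent_pow_embedding hj hsmul hp h
    obtain ⟨F, rfl⟩ := Finsupp.mem_span_range_iff_exists_finsupp.1 hx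
    have hx : Finsupp.linearCombination (RatFunc k) (fun n : ℕ => p ^ n) F =
      F.sum fun i f => f • p ^ i := rfl
    rw [← hx] at hxq
    let G : ℕ →₀ RatFunc k := (F.mapRange (shift (2 : k)) (map_zero _)).mapDomain Nat.succ +
      ((ε : ℤ) : RatFunc k) • F - Finsupp.single 0 q
    have hG : G = 0 := by
      refine linearIndependent_iff.1 hli G ?_
      rw [map_sub, map_add, map_smul, Finsupp.linearCombination_single, pow_zero, ← hxq,
        Finsupp.linearCombination_mapDomain, Finsupp.linearCombination_apply,
        Finsupp.sum_mapRange_index (by simp), Finsupp.linearCombination_apply,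
        Finsupp.sum, Finsupp.sum, Finset.mul_sum, sub_eq_zero]
      congr 1
      refine Finset.sum_congr rfl fun i _ => ?_
      rw [hsmul, hsmul, ← mul_assoc, mul_embedding h hj, mul_assoc, ← pow_succ']
      rfl
    have hF : F = 0 := by
      by_contra hF
      have hne := Finsupp.support_nonempty_iff.2 hF
      set N := F.support.max' hne with hN
      have h1 : F (N + 1) = 0 := by
        by_contra h1
        have := F.support.le_max' _ (Finsupp.mem_support_iff.2 h1)
        omega
      have h2 : G (N + 1) = shift 2 (F N) := by
        simp only [G, Finsupp.sub_apply, Finsupp.add_apply, Finsupp.smul_apply, h1]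
        rw [Finsupp.mapDomain_apply Nat.succ_injective]
        simp
      rw [hG, Finsupp.zero_apply, eq_comm, map_eq_zero] at h2
      exact Finsupp.mem_support_iff.1 (F.support.max'_mem hne) h2
    rw [hF, map_zero, mul_zero, smul_zero, add_zero, eq_comm, hsmul, mul_one, map_eq_zero] at hxq
    exact hxq

omit [Module (RatFunc k) E] in
/-- If `p t = (t + 2) p`, a rational function of `t` with poles at `± a` and its conjugate by a
rational function of `p` generate a free algebra. -/
theorem injective_lift (hp : p ≠ 0) (h : p * t = (t + 2) * p) {a : k} (ha : a ≠ 0)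
    (han : ∀ n : ℤ, a ≠ n) {S T : E}
    (hS : S = (t - algebraMap k E a) * (t + algebraMap k E a)⁻¹ +
      (t - algebraMap k E a)⁻¹ * (t + algebraMap k E a))
    (hT : T = (1 + p)⁻¹ * (1 - p) * S * (1 + p) * (1 - p)⁻¹) :
    Function.Injective (FreeAlgebra.lift k ![S, T]) := by
  obtain ⟨j, hj⟩ := exists_embedding (k := k) hp h
  let _ : Module (RatFunc k) E := Module.compHom E j
  have hsmul : ∀ (f : RatFunc k) (x : E), f • x = j f * x := fun _ _ => rfl
  have : IsScalarTower k (RatFunc k) E := ⟨fun c f x => by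
    have hjc : j (algebraMap k _ c) = algebraMap k E c := by
      rw [IsScalarTower.algebraMap_apply k k[X] (RatFunc k), hj, algebraMap_eq, aeval_C]
    rw [hsmul, hsmul, Algebra.smul_def, map_mul, hjc, mul_assoc, ← Algebra.smul_def]⟩
  have : CharZero E := charZero_of_injective_algebraMap (algebraMap k E).injective
  let y : ℤˣ → E := fun ε => (1 + ((ε : ℤ) : E) * p)⁻¹
  let c : ℤˣ → E := fun ε => 2 * y ε - 1
  have hli := (skewData hj hsmul hp h ha han).linearIndependent_wordProd (c := c) fun _ => rfl
  have hpow : LinearIndependent k fun n : ℕ => symFun a ^ n := by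
    have := (Polynomial.basisMonomials k).linearIndependent.map' (aeval (symFun a)).toLinearMap
      (LinearMap.ker_eq_bot.2 (transcendental_iff_injective.1 (transcendental_symFun ha)))
    have he : (fun n : ℕ => symFun a ^ n) =
        (aeval (symFun a)).toLinearMap ∘ Polynomial.basisMonomials k := by
      ext n
      simp
    rw [he]
    exact this
  have hli' := (linearIndependent_smul hpow hli).comp encode encode_injective
  have hp1 : 1 + p ≠ 0 := by simpa using one_add_sign_mul_ne_zero h 1
  have hp2 : 1 - p ≠ 0 := by simpa [← sub_eq_add_neg] using one_add_sign_mul_ne_zero h (-1)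
  have hc1 : c 1 = (1 + p)⁻¹ * (1 - p) := by
    rw [eq_inv_mul_iff_mul_eq₀ hp1]
    simp only [c, y, Units.val_one, Int.cast_one, one_mul]
    rw [mul_sub, two_mul, mul_add, mul_inv_cancel₀ hp1]
    noncomm_ring
  have hc2 : c (-1) = (1 + p) * (1 - p)⁻¹ := by
    rw [eq_mul_inv_iff_mul_eq₀ hp2]
    simp only [c, y, Units.val_neg, Units.val_one, Int.cast_neg, Int.cast_one, neg_mul, one_mul,
      ← sub_eq_add_neg]
    rw [sub_mul, mul_assoc, inv_mul_cancel₀ hp2]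
    noncomm_ring
  have hcc : c (-1) * c 1 = 1 := by
    have hcomm : (1 + p) * (1 - p) = (1 - p) * (1 + p) := by noncomm_ring
    rw [hc1, hc2, mul_assoc, ← mul_assoc _ _ (1 - p), ← mul_inv_rev, hcomm, mul_inv_rev,
      inv_mul_cancel_right₀ hp2, mul_inv_cancel₀ hp1]
  have hjS : j (symFun a) = S := by
    rw [symFun, hS]
    simp only [hj, map_add, map_mul, map_sub, map_inv₀, aeval_X, aeval_C]
  have hTc : T = c 1 * S * c (-1) := by
    rw [hc1, hc2, hT]
    simp only [mul_assoc]
  have key : ∀ x : List (Fin 2), (x.map ![S, T]).prod * S =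
      symFun a ^ (encode x).1 • wordProd c (symFun a) (encode x).2 := by
    have hSsmul : ∀ (n : ℕ) (x : E), S * (symFun a ^ n • x) = symFun a ^ (n + 1) • x := by
      intro n x
      rw [← hjS, ← hsmul, smul_smul, pow_succ']
    intro x
    induction x with
    | nil => simp [encode, wordProd, hsmul, hjS]
    | cons i x ih =>
      rw [List.map_cons, List.prod_cons, mul_assoc, ih]
      obtain rfl | rfl : i = 0 ∨ i = 1 := by omega
      · rw [encode_zero_cons]
        exact hSsmul _ _
      · change T * _ = _
        obtain ⟨n, w, hx⟩ | ⟨i, w, hx⟩ := exists_encode_eq x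
        · rw [encode_one_cons_of_succ hx, hx, hTc]
          simp only [wordProd, pow_zero, one_smul, zero_add]
          rw [mul_assoc, mul_assoc, pow_one, hsmul (symFun a), hjS]
        · rw [encode_one_cons_of_zero hx, hx, hTc]
          simp only [wordProd, pow_zero, one_smul]
          rw [mul_assoc, mul_assoc, ← mul_assoc (c (-1)), hcc, one_mul, hSsmul]
  exact injective_lift_of_linearIndependent ![S, T] S ((funext key : _ = _) ▸ hli')

end Freeness

end ShiftAlgebra

namespace OreValuation

section Reduction

variable {k D E : Type*} [Field k] [DivisionRing D] [Algebra k D] [DivisionRing E] [Algebra k E]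
  {O : Subalgebra k D} (r : O →ₐ[k] E)

/-- `ReducesTo r x e` means that `x` lies in the domain of `r` and has residue `e`. -/
def ReducesTo (x : D) (e : E) : Prop := ∃ h : x ∈ O, r ⟨x, h⟩ = e

variable {r}

namespace ReducesTo

variable {x y : D} {e e' : E}

lemma add (h : ReducesTo r x e) (h' : ReducesTo r y e') : ReducesTo r (x + y) (e + e') := by
  obtain ⟨hx, rfl⟩ := h
  obtain ⟨hy, rfl⟩ := h'
  exact ⟨O.add_mem hx hy, map_add r ⟨x, hx⟩ ⟨y, hy⟩⟩

lemma sub (h : ReducesTo r x e) (h' : ReducesTo r y e') : ReducesTo r (x - y) (e - e') := by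
  obtain ⟨hx, rfl⟩ := h
  obtain ⟨hy, rfl⟩ := h'
  exact ⟨O.sub_mem hx hy, map_sub r ⟨x, hx⟩ ⟨y, hy⟩⟩

lemma mul (h : ReducesTo r x e) (h' : ReducesTo r y e') : ReducesTo r (x * y) (e * e') := by
  obtain ⟨hx, rfl⟩ := h
  obtain ⟨hy, rfl⟩ := h'
  exact ⟨O.mul_mem hx hy, map_mul r ⟨x, hx⟩ ⟨y, hy⟩⟩

lemma of_algebraMap (c : k) : ReducesTo r (algebraMap k D c) (algebraMap k E c) :=
  ⟨O.algebraMap_mem c, r.commutes c⟩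

lemma one : ReducesTo r (1 : D) (1 : E) := ⟨O.one_mem, map_one r⟩

lemma unique (h : ReducesTo r x e) (h' : ReducesTo r x e') : e = e' := by
  obtain ⟨hx, rfl⟩ := h
  obtain ⟨_, rfl⟩ := h'
  rfl

lemma ne_zero (h : ReducesTo r x e) (he : e ≠ 0) : x ≠ 0 := by
  rintro rfl
  obtain ⟨hx, rfl⟩ := h
  exact he (map_zero r)

lemma injective_lift (h : ReducesTo r x e) (h' : ReducesTo r y e')
    (hinj : Function.Injective (FreeAlgebra.lift k ![e, e'])) :
    Function.Injective (FreeAlgebra.lift k ![x, y]) := by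
  obtain ⟨hx, rfl⟩ := h
  obtain ⟨hy, rfl⟩ := h'
  have h1 : FreeAlgebra.lift k ![r ⟨x, hx⟩, r ⟨y, hy⟩] =
      r.comp (FreeAlgebra.lift k ![⟨x, hx⟩, ⟨y, hy⟩]) := by
    ext i
    fin_cases i <;> simp
  have h2 : FreeAlgebra.lift k ![x, y] =
      O.val.comp (FreeAlgebra.lift k ![⟨x, hx⟩, ⟨y, hy⟩]) := by
    ext i
    fin_cases i <;> simp
  rw [h1, AlgHom.coe_comp] at hinj
  rw [h2, AlgHom.coe_comp]
  exact Subtype.val_injective.comp hinj.of_comp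

variable {Γ₀ : Type*} [LinearOrderedCommGroupWithZero Γ₀] {ν : Valuation D Γ₀}
  (hO : ∀ x, x ∈ O ↔ ν x ≤ 1) (hr : ∀ x : O, r x = 0 ↔ ν x < 1)

include hO in
lemma of_le_one (h : ν x ≤ 1) : ∃ e, ReducesTo r x e := ⟨_, (hO x).2 h, rfl⟩

include hO hr in
lemma congr (h : ReducesTo r x e) (hxy : ν (x - y) < 1) : ReducesTo r y e := by
  obtain ⟨hx, rfl⟩ := h
  have hxy' := (hO _).2 hxy.le
  have hy : y ∈ O := by simpa using O.sub_mem hx hxy'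
  refine ⟨hy, ?_⟩
  have : r (⟨x, hx⟩ - ⟨y, hy⟩) = 0 := (hr _).2 hxy
  rw [map_sub, sub_eq_zero] at this
  exact this.symm

include hO hr in
lemma inv (h : ReducesTo r x e) (he : e ≠ 0) : ReducesTo r x⁻¹ e⁻¹ := by
  have hx0 := h.ne_zero he
  obtain ⟨hx, rfl⟩ := h
  have h1 : ν x = 1 := le_antisymm ((hO x).1 hx) (not_lt.1 fun h => he ((hr _).2 h))
  have hx' : x⁻¹ ∈ O := (hO _).2 (by rw [map_inv₀, h1, inv_one])
  refine ⟨hx', eq_inv_of_mul_eq_one_left ?_⟩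
  rw [← map_mul, ← map_one r]
  exact congrArg r (Subtype.ext (inv_mul_cancel₀ hx0))

end ReducesTo

variable {Γ₀ : Type*} [LinearOrderedCommGroupWithZero Γ₀] {ν : Valuation D Γ₀}

lemma valuation_commutator_mul_le {w x y : D} {g h : Γ₀} (hx : ν x ≤ g) (hy : ν y ≤ g)
    (hwx : ν (w * x - x * w) ≤ h) (hwy : ν (w * y - y * w) ≤ h) :
    ν (w * (x * y) - x * y * w) ≤ h * g := by
  have e : w * (x * y) - x * y * w = (w * x - x * w) * y + x * (w * y - y * w) := by noncomm_ring
  rw [e]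
  refine ν.map_add_le ?_ ?_
  · rw [map_mul]
    exact mul_le_mul' hwx hy
  · rw [map_mul, mul_comm h]
    exact mul_le_mul' hx hwy

lemma exists_reducesTo_conj (hO : ∀ x, x ∈ O ↔ ν x ≤ 1) (hr : ∀ x : O, r x = 0 ↔ ν x < 1)
    {w x : D} (hw : w ≠ 0) (hx : ν x ≤ ν w) (hwx : ν (w * x - x * w) < ν w * ν w) :
    ∃ e : E, ReducesTo r (w⁻¹ * x) e ∧ ReducesTo r (x * w⁻¹) e ∧
      ReducesTo r (w * x * w⁻¹ * w⁻¹) e ∧ ReducesTo r (w⁻¹ * w⁻¹ * x * w) e := by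
  have hνw : ν w ≠ 0 := ν.ne_zero_iff.2 hw
  set c := w * x - x * w with hc
  have hsmall : (ν w)⁻¹ * (ν w)⁻¹ * ν c < 1 := by
    rw [← mul_inv, inv_mul_lt_one₀ (zero_lt_iff.2 (mul_ne_zero hνw hνw))]
    exact hwx
  obtain ⟨e, he⟩ : ∃ e : E, ReducesTo r (w⁻¹ * x) e := by
    refine ReducesTo.of_le_one hO ?_
    rw [map_mul, map_inv₀]
    exact inv_mul_le_one_of_le₀ hx zero_le
  have he' : ReducesTo r (x * w⁻¹) e := by
    refine he.congr hO hr ?_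
    have : w⁻¹ * x - x * w⁻¹ = - (w⁻¹ * c * w⁻¹) := by
      rw [hc, mul_sub, sub_mul, inv_mul_cancel_left₀ hw, mul_assoc, mul_inv_cancel_right₀ hw,
        neg_sub]
    rw [this, Valuation.map_neg, map_mul, map_mul, map_inv₀, mul_right_comm]
    exact hsmall
  refine ⟨e, he, he', he'.congr hO hr ?_, he.congr hO hr ?_⟩
  · have : x * w⁻¹ - w * x * w⁻¹ * w⁻¹ = - (c * (w⁻¹ * w⁻¹)) := by
      rw [hc, sub_mul, neg_sub, ← mul_assoc, mul_inv_cancel_right₀ hw, ← mul_assoc]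
    rw [this, Valuation.map_neg, map_mul, map_mul, map_inv₀, mul_comm]
    exact hsmall
  · have : w⁻¹ * x - w⁻¹ * w⁻¹ * x * w = w⁻¹ * w⁻¹ * c := by
      rw [hc, mul_sub]
      simp only [mul_assoc, inv_mul_cancel_left₀ hw]
    rw [this, map_mul, map_mul, map_inv₀]
    exact hsmall

/-- The relation between the residues of `w⁻¹ v²` and `½ w (u v + v u) w⁻²`. -/
theorem exists_residues (hO : ∀ x, x ∈ O ↔ ν x ≤ 1) (hr : ∀ x : O, r x = 0 ↔ ν x < 1)
    (h2 : ν 2 = 1) {g : Γ₀} (hg : 1 < g) {u v w X : D} (hw : w = v * u - u * v)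
    (hX : X + X = u * v + v * u) (hu : ν u = g) (hv : ν v = g) (hνw : ν w = g ^ 2)
    (hwu : ν (w * u - u * w) ≤ g ^ 2) (hwv : ν (w * v - v * w) ≤ g ^ 2) :
    ∃ p t : E, p ≠ 0 ∧ p * t = (t + 2) * p ∧
      ReducesTo r (w⁻¹ * v ^ 2) p ∧ ReducesTo r (v ^ 2 * w⁻¹) p ∧
      ReducesTo r (w * X * w⁻¹ * w⁻¹) t ∧ ReducesTo r (w⁻¹ * w⁻¹ * X * w) t := by
  have hg0 : g ≠ 0 := (zero_lt_one.trans hg).ne'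
  have hw0 : w ≠ 0 := by
    rw [← ν.ne_zero_iff, hνw]
    exact pow_ne_zero 2 hg0
  have hlt : g ^ 2 * g < ν w * ν w := by
    rw [hνw]
    exact mul_lt_mul_of_pos_left (lt_self_pow₀ hg one_lt_two) (zero_lt_iff.2 (pow_ne_zero 2 hg0))
  have hadd : ∀ x : D, ν (x + x) = ν x := fun x => by rw [← two_mul, map_mul, h2, one_mul]
  have hνX : ν X ≤ ν w := by
    rw [← hadd, hX, hνw]
    refine ν.map_add_le ?_ ?_ <;> rw [map_mul, hu, hv, sq]
  have hνQ : ν (v ^ 2) = ν w := by rw [map_pow, hv, hνw]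
  have hwX : ν (w * X - X * w) < ν w * ν w := by
    refine lt_of_le_of_lt ?_ hlt
    have e : (w * X - X * w) + (w * X - X * w) =
        (w * (u * v) - u * v * w) + (w * (v * u) - v * u * w) := by
      have : (w * X - X * w) + (w * X - X * w) = w * (X + X) - (X + X) * w := by noncomm_ring
      rw [this, hX]
      noncomm_ring
    rw [← hadd, e]
    exact ν.map_add_le (valuation_commutator_mul_le hu.le hv.le hwu hwv)
      (valuation_commutator_mul_le hv.le hu.le hwv hwu)
  have hwQ : ν (w * v ^ 2 - v ^ 2 * w) < ν w * ν w := by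
    refine lt_of_le_of_lt ?_ hlt
    rw [sq v]
    exact valuation_commutator_mul_le hv.le hv.le hwv hwv
  have hQX : ν (v ^ 2 * X - X * v ^ 2 - (v ^ 2 * w + v ^ 2 * w)) < ν w * ν w := by
    refine lt_of_le_of_lt ?_ hlt
    have e : (v ^ 2 * X - X * v ^ 2 - (v ^ 2 * w + v ^ 2 * w)) +
        (v ^ 2 * X - X * v ^ 2 - (v ^ 2 * w + v ^ 2 * w)) =
        (w * v - v * w) * v + (v * (w * v - v * w) + (v * (w * v - v * w) + v * (w * v - v * w))) := by
      have : (v ^ 2 * X - X * v ^ 2 - (v ^ 2 * w + v ^ 2 * w)) +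
          (v ^ 2 * X - X * v ^ 2 - (v ^ 2 * w + v ^ 2 * w)) =
          v ^ 2 * (X + X) - (X + X) * v ^ 2 - 4 * (v ^ 2 * w) := by noncomm_ring
      rw [this, hX, hw]
      noncomm_ring
    have hb : ν (v * (w * v - v * w)) ≤ g ^ 2 * g := by
      rw [map_mul, hv, mul_comm]
      exact mul_le_mul' hwv le_rfl
    rw [← hadd, e]
    refine ν.map_add_le ?_ (ν.map_add_le hb (ν.map_add_le hb hb))
    rw [map_mul, hv]
    exact mul_le_mul' hwv le_rfl
  obtain ⟨p, hp1, hp2, -, -⟩ := exists_reducesTo_conj hO hr hw0 hνQ.le hwQ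
  obtain ⟨t, ht1, ht2, ht3, ht4⟩ := exists_reducesTo_conj hO hr hw0 hνX hwX
  refine ⟨p, t, ?_, ?_, hp1, hp2, ht3, ht4⟩
  · rintro rfl
    obtain ⟨h, h'⟩ := hp1
    have := (hr _).1 h'
    rw [map_mul, map_inv₀, hνQ, inv_mul_cancel₀ (ν.ne_zero_iff.2 hw0)] at this
    exact lt_irrefl _ this
  · have h1 : ReducesTo r (w⁻¹ * v ^ 2 * (X * w⁻¹)) ((t + 2) * p) := by
      have := (ht1.mul hp2).add (hp1.add hp1)
      rw [add_mul, two_mul]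
      refine this.congr hO hr ?_
      have e : w⁻¹ * X * (v ^ 2 * w⁻¹) + (w⁻¹ * v ^ 2 + w⁻¹ * v ^ 2) - w⁻¹ * v ^ 2 * (X * w⁻¹) =
          - (w⁻¹ * (v ^ 2 * X - X * v ^ 2 - (v ^ 2 * w + v ^ 2 * w)) * w⁻¹) := by
        simp only [mul_sub, sub_mul, mul_add, add_mul, mul_assoc, mul_inv_cancel₀ hw0, mul_one]
        abel
      rw [e, Valuation.map_neg, map_mul, map_mul, map_inv₀, mul_right_comm, ← mul_inv,
        inv_mul_lt_one₀ (zero_lt_iff.2 (mul_ne_zero (ν.ne_zero_iff.2 hw0) (ν.ne_zero_iff.2 hw0)))]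
      exact hQX
    exact (hp1.mul ht2).unique h1

end Reduction

end OreValuation

namespace OreValuation

/-- If the residues of `w⁻¹ v²` and `w X w⁻²` satisfy the shift relation, then the elements built
from `V = w X w`, `w` and `v` generate a free algebra. -/
theorem injective_lift_of_reducesTo {k D E : Type*} [Field k] [CharZero k] [DivisionRing D]
    [Algebra k D] [DivisionRing E] [Algebra k E] {O : Subalgebra k D} {r : O →ₐ[k] E}
    {Γ₀ : Type*} [LinearOrderedCommGroupWithZero Γ₀] {ν : Valuation D Γ₀}
    (hO : ∀ x, x ∈ O ↔ ν x ≤ 1) (hr : ∀ x : O, r x = 0 ↔ ν x < 1)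
    {w v X : D} (hw : w ≠ 0) {p t : E} (hp : p ≠ 0) (h : p * t = (t + 2) * p)
    (hp1 : ReducesTo r (w⁻¹ * v ^ 2) p) (hp2 : ReducesTo r (v ^ 2 * w⁻¹) p)
    (ht1 : ReducesTo r (w * X * w⁻¹ * w⁻¹) t) (ht2 : ReducesTo r (w⁻¹ * w⁻¹ * X * w) t)
    {c : k} (hc : c ≠ 0) (hcn : ∀ n : ℤ, c ≠ n) {N₁ N₂ : D}
    (hN₁ : N₁ = w * X * w - algebraMap k D c * w ^ 3)
    (hN₂ : N₂ = w * X * w + algebraMap k D c * w ^ 3) :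
    N₁ ≠ 0 ∧ N₂ ≠ 0 ∧ w + v ^ 2 ≠ 0 ∧ w - v ^ 2 ≠ 0 ∧
    ∀ S T : D, S = N₁ * N₂⁻¹ + N₁⁻¹ * N₂ →
      T = (w + v ^ 2)⁻¹ * (w - v ^ 2) * S * (w + v ^ 2) * (w - v ^ 2)⁻¹ →
      Function.Injective (FreeAlgebra.lift k ![S, T]) := by
  have : CharZero E := charZero_of_injective_algebraMap (algebraMap k E).injective
  have hpos : 1 + p ≠ 0 := by simpa using ShiftAlgebra.one_add_sign_mul_ne_zero h 1
  have hneg : 1 - p ≠ 0 := by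
    simpa [← sub_eq_add_neg] using ShiftAlgebra.one_add_sign_mul_ne_zero h (-1)
  have ht : ∀ b : k, t - algebraMap k E b ≠ 0 := fun b => by
    simpa using ShiftAlgebra.aeval_ne_zero hp h (Polynomial.X_sub_C_ne_zero b)
  have htc : t - algebraMap k E c ≠ 0 := ht c
  have htc' : t + algebraMap k E c ≠ 0 := by simpa using ht (-c)
  set a := algebraMap k D c
  have hac : ∀ x : D, a * x = x * a := Algebra.commutes c
  have ha : ReducesTo r a (algebraMap k E c) := .of_algebraMap c
  set t₁ := w * X * w⁻¹ * w⁻¹ with ht₁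
  set t₂ := w⁻¹ * w⁻¹ * X * w with ht₂
  set p₁ := w⁻¹ * v ^ 2 with hp₁
  set p₂ := v ^ 2 * w⁻¹ with hp₂
  have ha₁ := ht1.sub ha
  have ha₁' := ht1.add ha
  have ha₂ := ht2.sub ha
  have ha₂' := ht2.add ha
  have hb₁ := ReducesTo.one.add hp1
  have hb₁' := ReducesTo.one.sub hp1
  have hb₂ := ReducesTo.one.add hp2
  have hb₂' := ReducesTo.one.sub hp2
  have hw3 : w ^ 3 ≠ 0 := pow_ne_zero 3 hw
  have e₁ : w * X * w = t₁ * w ^ 3 := by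
    rw [ht₁, pow_succ', sq]
    simp only [mul_assoc, inv_mul_cancel_left₀ hw]
  have e₂ : w * X * w = w ^ 3 * t₂ := by
    rw [ht₂, pow_succ, sq]
    simp only [mul_assoc, mul_inv_cancel_left₀ hw]
  have hN₁l : N₁ = (t₁ - a) * w ^ 3 := by rw [hN₁, e₁, sub_mul]
  have hN₂l : N₂ = (t₁ + a) * w ^ 3 := by rw [hN₂, e₁, add_mul]
  have hN₁r : N₁ = w ^ 3 * (t₂ - a) := by rw [hN₁, e₂, mul_sub, hac]
  have hN₂r : N₂ = w ^ 3 * (t₂ + a) := by rw [hN₂, e₂, mul_add, hac]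
  have f₁ : w + v ^ 2 = w * (1 + p₁) := by rw [hp₁, mul_add, mul_one, mul_inv_cancel_left₀ hw]
  have f₂ : w - v ^ 2 = w * (1 - p₁) := by rw [hp₁, mul_sub, mul_one, mul_inv_cancel_left₀ hw]
  have f₃ : w + v ^ 2 = (1 + p₂) * w := by rw [hp₂, add_mul, one_mul, inv_mul_cancel_right₀ hw]
  have f₄ : w - v ^ 2 = (1 - p₂) * w := by rw [hp₂, sub_mul, one_mul, inv_mul_cancel_right₀ hw]
  refine ⟨?_, ?_, ?_, ?_, ?_⟩
  · rw [hN₁l]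
    exact mul_ne_zero (ha₁.ne_zero htc) hw3
  · rw [hN₂l]
    exact mul_ne_zero (ha₁'.ne_zero htc') hw3
  · rw [f₁]
    exact mul_ne_zero hw (hb₁.ne_zero hpos)
  · rw [f₂]
    exact mul_ne_zero hw (hb₁'.ne_zero hneg)
  · intro S T hS hT
    have hS' : S = (t₁ - a) * (t₁ + a)⁻¹ + (t₂ - a)⁻¹ * (t₂ + a) := by
      rw [hS]
      congr 1
      · rw [hN₁l, hN₂l, mul_inv_rev, ← mul_assoc, mul_inv_cancel_right₀ hw3]
      · rw [hN₁r, hN₂r, mul_inv_rev, mul_assoc, inv_mul_cancel_left₀ hw3]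
    have hT' : T = (1 + p₁)⁻¹ * (1 - p₁) * S * (1 + p₂) * (1 - p₂)⁻¹ := by
      have g₁ : (w + v ^ 2)⁻¹ * (w - v ^ 2) = (1 + p₁)⁻¹ * (1 - p₁) := by
        rw [f₁, f₂, mul_inv_rev, mul_assoc, inv_mul_cancel_left₀ hw]
      have g₂ : (w + v ^ 2) * (w - v ^ 2)⁻¹ = (1 + p₂) * (1 - p₂)⁻¹ := by
        rw [f₃, f₄, mul_inv_rev, ← mul_assoc, mul_inv_cancel_right₀ hw]
      rw [hT, g₁, mul_assoc, g₂, ← mul_assoc]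
    have hSr := (ha₁.mul (ha₁'.inv hO hr htc')).add ((ha₂.inv hO hr htc).mul ha₂')
    rw [← hS'] at hSr
    have hTr := ((((hb₁.inv hO hr hpos).mul hb₁').mul hSr).mul hb₂).mul (hb₂'.inv hO hr hneg)
    rw [← hT'] at hTr
    exact hSr.injective_lift hTr (ShiftAlgebra.injective_lift hp h hc hcn rfl rfl)

end OreValuation

section Involution

variable {k D : Type*} [Field k] [DivisionRing D] [Algebra k D] {σ : D →ₗ[k] D}
  (hmul : ∀ a b : D, σ (a * b) = σ b * σ a) (hinv : ∀ a : D, σ (σ a) = a)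

include hmul hinv

lemma involution_inv (x : D) : σ x⁻¹ = (σ x)⁻¹ := by
  have h1 : σ 1 = 1 := by
    have := hmul 1 (σ 1)
    rwa [one_mul, hinv, one_mul, eq_comm] at this
  by_cases hx : x = 0
  · simp [hx]
  · refine eq_inv_of_mul_eq_one_left ?_
    rw [← hmul, mul_inv_cancel₀ hx, h1]

/-- `N₁ N₂⁻¹ + N₁⁻¹ N₂` is symmetric when the involution exchanges `N₁` and `N₂`. -/
lemma involution_quotient_sum {x y : D} (hx : σ x = y) :
    σ (x * y⁻¹ + x⁻¹ * y) = x * y⁻¹ + x⁻¹ * y := by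
  have hy : σ y = x := hx ▸ hinv x
  rw [map_add, hmul, hmul, involution_inv hmul hinv, involution_inv hmul hinv, hx, hy, add_comm]

lemma involution_conj {x y S : D} (hx : σ x = - y) (hS : σ S = S) :
    σ (x⁻¹ * y * S * x * y⁻¹) = x⁻¹ * y * S * x * y⁻¹ := by
  have hy : σ y = - x := by rw [← neg_eq_iff_eq_neg, ← map_neg, ← hx, hinv]
  simp only [hmul, involution_inv hmul hinv, hx, hy, hS, inv_neg, neg_mul, mul_neg, neg_neg, mul_assoc]

end Involution

/-- if `U(L)` is an Ore domain (char 0) and `u, v ∈ L` generate a Lie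
subalgebra of dimension at least 3, then with `w = ⁅v,u⁆`, `V = ½w(uv + vu)w`,
`S = (V − w³/3)(V + w³/3)⁻¹ + (V − w³/3)⁻¹(V + w³/3)` and
`T = (w + v²)⁻¹(w − v²)S(w + v²)(w − v²)⁻¹`, the elements `S, T` of `𝔇(L)` generate a
free `k`-algebra and are symmetric for the principal involution. -/
theorem free_symmetric_algebra_in_ore_enveloping_fractions
    (k : Type*) [Field k] [CharZero k]
    (L : Type*) [LieRing L] [LieAlgebra k L]
    -- `U(L)` is an Ore domain
    [IsDomain (UniversalEnvelopingAlgebra k L)]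
    (horeL : ∀ a s : UniversalEnvelopingAlgebra k L, s ≠ 0 →
      ∃ t r : UniversalEnvelopingAlgebra k L, t ≠ 0 ∧ t * a = r * s)
    (horeR : ∀ a s : UniversalEnvelopingAlgebra k L, s ≠ 0 →
      ∃ t r : UniversalEnvelopingAlgebra k L, t ≠ 0 ∧ a * t = s * r)
    -- the Lie subalgebra generated by `{u, v}` has dimension at least 3
    (u v : L)
    (hdim : 3 ≤ Module.rank k ↥(LieSubalgebra.lieSpan k L {u, v})) :
    -- for any realization `D` of the Ore division ring of fractions `𝔇(L)`,
    -- with principal involution `σ`: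
    ∀ (D : Type*) [DivisionRing D] [Algebra k D]
      (f : UniversalEnvelopingAlgebra k L →ₐ[k] D),
      Function.Injective f →
      (∀ d : D, ∃ r s : UniversalEnvelopingAlgebra k L, s ≠ 0 ∧ d = (f s)⁻¹ * f r) →
      ∀ σ : D →ₗ[k] D,
        (∀ a a' : D, σ (a * a') = σ a' * σ a) →
        (∀ a : D, σ (σ a) = a) →
        (∀ x : L, σ (f (UniversalEnvelopingAlgebra.ι k x)) =
          - f (UniversalEnvelopingAlgebra.ι k x)) →
        ∀ U W : UniversalEnvelopingAlgebra k L,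
          U = UniversalEnvelopingAlgebra.ι k u →
          W = UniversalEnvelopingAlgebra.ι k v →
          ∀ Wb V : UniversalEnvelopingAlgebra k L,
            Wb = UniversalEnvelopingAlgebra.ι k ⁅v, u⁆ →
            V = ((1 : k)/2) • (Wb * (U * W + W * U) * Wb) →
            -- the four elements are nonzero (hence invertible in `𝔇(L)`)
            (V - ((1 : k)/3) • Wb ^ 3 ≠ 0) ∧
            (V + ((1 : k)/3) • Wb ^ 3 ≠ 0) ∧
            (Wb + W ^ 2 ≠ 0) ∧
            (Wb - W ^ 2 ≠ 0) ∧
            ∀ S T : D,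
              S = f (V - ((1 : k)/3) • Wb ^ 3) * (f (V + ((1 : k)/3) • Wb ^ 3))⁻¹ +
                  (f (V - ((1 : k)/3) • Wb ^ 3))⁻¹ * f (V + ((1 : k)/3) • Wb ^ 3) →
              T = (f (Wb + W ^ 2))⁻¹ * f (Wb - W ^ 2) * S * f (Wb + W ^ 2) *
                  (f (Wb - W ^ 2))⁻¹ →
              -- (1) `S` and `T` generate a free `k`-algebra on `{S, T}`
              Function.Injective ⇑(FreeAlgebra.lift k ![S, T]) ∧
              -- (2) `S` and `T` are symmetric for the principal involution
              σ S = S ∧ σ T = T := by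
  intro D _ _ f hf hgen σ hmul hinv hσ U W hU hW Wb V hWb hV
  obtain ⟨val, hval0, hvalk, hvalu, hvalv, hvalw, hval⟩ := PBW.exists_valuation hdim
  obtain ⟨vD, hvD⟩ := OreValuation.exists_extension (f := (f : _ →+* D)) hf hgen horeL hval0
  replace hvD : ∀ a, vD (f a) = val a := hvD
  have hk : ∀ c : k, c ≠ 0 → vD (algebraMap k D c) = 1 := fun c hc => by
    rw [← f.commutes, hvD, hvalk c hc]
  have hO := fun x => OreValuation.mem_valuationSubalgebra vD hk (x := x)
  have hr := fun x => OreValuation.residueMap_eq_zero_iff vD hk (x := x)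
  have h2 : vD 2 = 1 := by
    rw [← map_ofNat (algebraMap k D) 2]
    exact hk 2 two_ne_zero
  have hexp : WithZero.exp (2 : ℤ) = WithZero.exp 1 ^ 2 := by
    rw [← WithZero.exp_nsmul]; rfl
  have hbr : ∀ x y : L, f (UniversalEnvelopingAlgebra.ι k ⁅x, y⁆) =
      f (UniversalEnvelopingAlgebra.ι k x) * f (UniversalEnvelopingAlgebra.ι k y) -
        f (UniversalEnvelopingAlgebra.ι k y) * f (UniversalEnvelopingAlgebra.ι k x) := by
    intro x y
    let := LieRing.ofAssociativeRing (A := UniversalEnvelopingAlgebra k L)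
    rw [LieHom.map_lie, LieRing.of_associative_ring_bracket, map_sub, map_mul, map_mul]
  set X : D := algebraMap k D (1 / 2) * (f U * f W + f W * f U) with hX
  have hXX : X + X = f U * f W + f W * f U := by
    rw [hX, ← add_mul, ← map_add, add_halves, map_one, one_mul]
  obtain ⟨p, t, hp, hpt, hp1, hp2, ht1, ht2⟩ := OreValuation.exists_residues hO hr h2
    (g := WithZero.exp 1) (u := f U) (v := f W) (w := f Wb) (X := X)
    (by rw [← WithZero.exp_zero, WithZero.exp_lt_exp]; exact zero_lt_one)
    (by rw [hU, hW, hWb, hbr]) hXX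
    (by rw [hU, hvD, hvalu]) (by rw [hW, hvD, hvalv]) (by rw [hWb, hvD, hvalw, hexp])
    (by rw [hU, hWb, ← hbr, hvD, ← hexp]; exact hval _)
    (by rw [hW, hWb, ← hbr, hvD, ← hexp]; exact hval _)
  have hw0 : f Wb ≠ 0 := by
    rw [← vD.ne_zero_iff, hWb, hvD, hvalw]
    exact WithZero.exp_ne_zero
  have hfV : f V = f Wb * X * f Wb := by
    rw [hV, hX, map_smul, Algebra.smul_def]
    simp only [map_mul, map_add, mul_assoc]
    rw [Algebra.left_comm]
  have hfw : f (((1 : k) / 3) • Wb ^ 3) = algebraMap k D (1 / 3) * f Wb ^ 3 := by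
    rw [map_smul, map_pow, Algebra.smul_def]
  have hc : (1 / 3 : k) ≠ 0 := by simp
  have hcn : ∀ n : ℤ, (1 / 3 : k) ≠ n := by
    intro n hn
    rw [div_eq_iff three_ne_zero] at hn
    have : (1 : ℤ) = n * 3 := by exact_mod_cast hn
    omega
  obtain ⟨n₁, n₂, n₃, n₄, hfree⟩ := OreValuation.injective_lift_of_reducesTo hO hr hw0 hp hpt
    hp1 hp2 ht1 ht2 hc hcn (N₁ := f (V - ((1 : k) / 3) • Wb ^ 3))
    (N₂ := f (V + ((1 : k) / 3) • Wb ^ 3)) (by rw [map_sub, hfV, hfw])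
    (by rw [map_add, hfV, hfw])
  rw [← map_pow, ← map_add] at n₃
  rw [← map_pow, ← map_sub] at n₄
  refine ⟨(map_ne_zero_iff f hf).1 n₁, (map_ne_zero_iff f hf).1 n₂, (map_ne_zero_iff f hf).1 n₃,
    (map_ne_zero_iff f hf).1 n₄, fun S T hS hT => ⟨hfree S T hS ?_, ?_⟩⟩
  · rw [hT]
    simp only [map_add, map_sub, map_pow]
  have hσU : σ (f U) = - f U := hU ▸ hσ u
  have hσW : σ (f W) = - f W := hW ▸ hσ v
  have hσw : σ (f Wb) = - f Wb := hWb ▸ hσ _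
  have hσV : σ (f V) = f V := by
    rw [hV, map_smul, map_smul]
    simp only [map_mul, map_add, hmul, hσU, hσW, hσw, neg_mul, mul_neg, neg_neg]
    rw [mul_assoc, add_comm (f W * f U)]
  have hσ3 : σ (f (((1 : k) / 3) • Wb ^ 3)) = - f (((1 : k) / 3) • Wb ^ 3) := by
    rw [map_smul, map_smul, pow_succ, sq]
    simp only [map_mul, hmul, hσw, neg_mul, mul_neg, neg_neg, smul_neg, mul_assoc]
  have hσS : σ S = S := by
    rw [hS]
    exact involution_quotient_sum hmul hinv (by rw [map_sub, map_sub, map_add, hσV, hσ3, sub_neg_eq_add])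
  refine ⟨hσS, ?_⟩
  rw [hT]
  refine involution_conj hmul hinv ?_ hσS
  rw [map_add, map_add, map_sub, sq, map_mul, hmul, hσW, hσw, neg_mul_neg, neg_sub, neg_add_eq_sub]
end
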